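/- arXiv:1112.0098 — 5 statements merged into one kernel-verified Lean document; each statement's English description precedes it below -/
import Mathlib

section
/- If f : (0,∞) → (0,∞) is operator monotone, then the function t ↦ f(t)/t is operator monotone decreasing (i.e., t ↦ −f(t)/t is operator monotone) on (0,∞). -/
open Matrix Set
open scoped ComplexOrder

noncomputable section

/-- `f` is `n`-matrix monotone on `I`. -/
def MatMonoOn (n : ℕ) (I : Set ℝ) (f : ℝ → ℝ) : Prop :=
  ∀ (A B : Matrix (Fin n) (Fin n) ℂ) (hA : A.IsHermitian) (hB : B.IsHermitian),
    (∀ i, hA.eigenvalues i ∈ I) → (∀ i, hB.eigenvalues i ∈ I) →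
    (B - A).PosSemidef → (hB.cfc f - hA.cfc f).PosSemidef

/-- `f` is `n`-matrix concave on `I`. -/
def MatConcaveOn (n : ℕ) (I : Set ℝ) (f : ℝ → ℝ) : Prop :=
  ∀ (A B : Matrix (Fin n) (Fin n) ℂ) (hA : A.IsHermitian) (hB : B.IsHermitian)
    (s : ℝ), s ∈ Icc (0:ℝ) 1 →
    (∀ i, hA.eigenvalues i ∈ I) → (∀ i, hB.eigenvalues i ∈ I) →
    ∀ (hC : ((s:ℂ) • A + ((1:ℂ) - (s:ℂ)) • B).IsHermitian),
      (hC.cfc f - ((s:ℂ) • hA.cfc f + ((1:ℂ) - (s:ℂ)) • hB.cfc f)).PosSemidef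

/-- `f` is `n`-matrix convex on `I`. -/
def MatConvexOn (n : ℕ) (I : Set ℝ) (f : ℝ → ℝ) : Prop :=
  ∀ (A B : Matrix (Fin n) (Fin n) ℂ) (hA : A.IsHermitian) (hB : B.IsHermitian)
    (s : ℝ), s ∈ Icc (0:ℝ) 1 →
    (∀ i, hA.eigenvalues i ∈ I) → (∀ i, hB.eigenvalues i ∈ I) →
    ∀ (hC : ((s:ℂ) • A + ((1:ℂ) - (s:ℂ)) • B).IsHermitian),
      (((s:ℂ) • hA.cfc f + ((1:ℂ) - (s:ℂ)) • hB.cfc f) - hC.cfc f).PosSemidef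

/-- First divided difference. -/
def dd (f : ℝ → ℝ) (t s : ℝ) : ℝ :=
  if t = s then deriv f t else (f t - f s) / (t - s)

/-- Second divided difference. -/
def dd2 (f : ℝ → ℝ) (t s r : ℝ) : ℝ :=
  if t = s then
    (if s = r then deriv (deriv f) t / 2 else (deriv f t - dd f t r) / (t - r))
  else if t = r then (deriv f t - dd f t s) / (t - s)
  else (dd f t s - dd f s r) / (t - r)

/-- A matrix intertwining two real diagonal matrices intertwines all functions of them. -/
lemma diagonal_comp_mul_eq {ι κ : Type*} [Fintype ι] [Fintype κ] [DecidableEq ι] [DecidableEq κ]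
    {e : ι → ℝ} {d : κ → ℝ} {W : Matrix ι κ ℂ}
    (h : diagonal (fun i => (e i : ℂ)) * W = W * diagonal (fun i => (d i : ℂ))) (f : ℝ → ℝ) :
    diagonal (fun i => (f (e i) : ℂ)) * W = W * diagonal (fun i => (f (d i) : ℂ)) := by
  ext i j
  have hij := congrFun (congrFun h i) j
  simp only [diagonal_mul, mul_diagonal] at hij ⊢
  by_cases hW : W i j = 0
  · simp [hW]
  · rw [mul_comm] at hij
    rw [Complex.ofReal_injective (mul_left_cancel₀ hW hij), mul_comm]

section Diagonalization

variable {ι : Type*} [Fintype ι] [DecidableEq ι]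

lemma Matrix.IsHermitian.exists_unitary_cfc_eq {A : Matrix ι ι ℂ} (hA : A.IsHermitian) :
    ∃ P : Matrix ι ι ℂ, P * Pᴴ = 1 ∧ Pᴴ * P = 1 ∧
      A = P * diagonal (fun i => (hA.eigenvalues i : ℂ)) * Pᴴ ∧
      ∀ f : ℝ → ℝ, hA.cfc f = P * diagonal (fun i => (f (hA.eigenvalues i) : ℂ)) * Pᴴ := by
  refine ⟨hA.eigenvectorUnitary, ?_, ?_, ?_, fun f => ?_⟩
  · exact Unitary.coe_mul_star_self hA.eigenvectorUnitary
  · exact Unitary.coe_star_mul_self hA.eigenvectorUnitary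
  · exact hA.spectral_theorem
  · rfl

lemma Matrix.IsHermitian.intertwine_eigenvalues {A P U : Matrix ι ι ℂ} (hA : A.IsHermitian)
    {d : ι → ℝ} (hP : Pᴴ * P = 1) (hU : Uᴴ * U = 1)
    (hAP : A = P * diagonal (fun i => (hA.eigenvalues i : ℂ)) * Pᴴ)
    (hAU : A = U * diagonal (fun i => (d i : ℂ)) * Uᴴ) :
    diagonal (fun i => (hA.eigenvalues i : ℂ)) * (Pᴴ * U) =
      (Pᴴ * U) * diagonal (fun i => (d i : ℂ)) := by
  have h : Pᴴ * A * U = Pᴴ * A * U := rfl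
  conv_lhs at h => rw [hAP]
  conv_rhs at h => rw [hAU]
  simpa only [mul_assoc, hU, mul_one, ← mul_assoc Pᴴ P, hP, one_mul] using h

/-- The functional calculus may be computed in any diagonalization. -/
lemma Matrix.IsHermitian.cfc_eq_of_eq_conj {A U : Matrix ι ι ℂ} (hA : A.IsHermitian)
    {d : ι → ℝ} (hU : U * Uᴴ = 1) (hAU : A = U * diagonal (fun i => (d i : ℂ)) * Uᴴ)
    (f : ℝ → ℝ) : hA.cfc f = U * diagonal (fun i => (f (d i) : ℂ)) * Uᴴ := by
  obtain ⟨P, hP, hP', hAP, hcfc⟩ := hA.exists_unitary_cfc_eq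
  have h := diagonal_comp_mul_eq
    (hA.intertwine_eigenvalues hP' (mul_eq_one_comm.mp hU) hAP hAU) f
  calc hA.cfc f
      = P * (diagonal (fun i => (f (hA.eigenvalues i) : ℂ)) * (Pᴴ * U)) * Uᴴ := by
        simp only [hcfc, mul_assoc, hU, mul_one]
    _ = U * diagonal (fun i => (f (d i) : ℂ)) * Uᴴ := by
        rw [h]; simp only [← mul_assoc, hP, one_mul]

lemma Matrix.IsHermitian.exists_eigenvalues_eq_of_eq_conj {A U : Matrix ι ι ℂ}
    (hA : A.IsHermitian) {d : ι → ℝ} (hU : U * Uᴴ = 1)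
    (hAU : A = U * diagonal (fun i => (d i : ℂ)) * Uᴴ) (i : ι) :
    ∃ j, hA.eigenvalues i = d j := by
  obtain ⟨P, hP, hP', hAP, -⟩ := hA.exists_unitary_cfc_eq
  have h := hA.intertwine_eigenvalues hP' (mul_eq_one_comm.mp hU) hAP hAU
  obtain ⟨j, hj⟩ : ∃ j, (Pᴴ * U) i j ≠ 0 := by
    by_contra! h0
    have h1 : ((Pᴴ * U) * (Uᴴ * P)) i i = 1 := by
      rw [show (Pᴴ * U) * (Uᴴ * P) = Pᴴ * (U * Uᴴ) * P by simp only [mul_assoc], hU, mul_one, hP',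
        one_apply_eq]
    simp [mul_apply (M := Pᴴ * U), h0] at h1
  refine ⟨j, ?_⟩
  have hij := congrFun (congrFun h i) j
  simp only [diagonal_mul, mul_diagonal] at hij
  rw [mul_comm] at hij
  exact Complex.ofReal_injective (mul_left_cancel₀ hj hij)

lemma isHermitian_conj_diagonal_ofReal {κ : Type*} (U : Matrix κ ι ℂ) (d : ι → ℝ) :
    (U * diagonal (fun i => (d i : ℂ)) * Uᴴ).IsHermitian :=
  isHermitian_mul_mul_conjTranspose U
    (isHermitian_diagonal_of_self_adjoint _ (by ext i; simp))

/-- Matrix monotonicity expressed through diagonalizations, for an arbitrary finite index type. -/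
lemma MatMonoOn.posSemidef_conj_diagonal {I : Set ℝ} {f : ℝ → ℝ}
    (hf : MatMonoOn (Fintype.card ι) I f) {U V : Matrix ι ι ℂ} {d e : ι → ℝ}
    (hU : U * Uᴴ = 1) (hV : V * Vᴴ = 1) (hd : ∀ i, d i ∈ I) (he : ∀ i, e i ∈ I)
    (h : (V * diagonal (fun i => (e i : ℂ)) * Vᴴ -
      U * diagonal (fun i => (d i : ℂ)) * Uᴴ).PosSemidef) :
    (V * diagonal (fun i => (f (e i) : ℂ)) * Vᴴ -
      U * diagonal (fun i => (f (d i) : ℂ)) * Uᴴ).PosSemidef := by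
  let σ := (Fintype.equivFin ι).symm
  have key : ∀ (X : Matrix ι ι ℂ) (c : ι → ℝ),
      (X * diagonal (fun i => (c i : ℂ)) * Xᴴ).submatrix σ σ =
      X.submatrix σ σ * diagonal (fun i => (c (σ i) : ℂ)) * (X.submatrix σ σ)ᴴ := by
    intro X c
    rw [conjTranspose_submatrix, ← submatrix_mul_equiv _ _ σ σ σ,
      ← submatrix_mul_equiv _ _ σ σ σ, submatrix_diagonal_equiv]
    rfl
  have unit : ∀ X : Matrix ι ι ℂ, X * Xᴴ = 1 → X.submatrix σ σ * (X.submatrix σ σ)ᴴ = 1 := by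
    intro X hX
    rw [conjTranspose_submatrix, submatrix_mul_equiv, hX, submatrix_one_equiv]
  have hUh := isHermitian_conj_diagonal_ofReal (U.submatrix σ σ) (fun i => d (σ i))
  have hVh := isHermitian_conj_diagonal_ofReal (V.submatrix σ σ) (fun i => e (σ i))
  have h' := hf _ _ hUh hVh
    (fun i => by
      obtain ⟨j, hj⟩ := hUh.exists_eigenvalues_eq_of_eq_conj (unit U hU) rfl i
      exact hj ▸ hd _)
    (fun i => by
      obtain ⟨j, hj⟩ := hVh.exists_eigenvalues_eq_of_eq_conj (unit V hV) rfl i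
      exact hj ▸ he _)
    (by rw [← key, ← key]; exact h.submatrix σ)
  rw [hUh.cfc_eq_of_eq_conj (unit U hU) rfl, hVh.cfc_eq_of_eq_conj (unit V hV) rfl,
    ← key U (fun i => f (d i)), ← key V (fun i => f (e i))] at h'
  exact (posSemidef_submatrix_equiv σ).mp h'

lemma posSemidef_one_sub_conjTranspose_mul_self {K : Matrix ι ι ℂ}
    (h : (1 - K * Kᴴ).PosSemidef) : (1 - Kᴴ * K).PosSemidef := by
  let : Invertible (1 : Matrix ι ι ℂ) := invertibleOne
  have h1 := PosDef.fromBlocks₁₁ (A := (1 : Matrix ι ι ℂ)) K 1 PosDef.one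
  have h2 := PosDef.fromBlocks₂₂ (1 : Matrix ι ι ℂ) K (D := 1) PosDef.one
  simp only [inv_one, mul_one] at h1 h2
  exact h1.mp (h2.mpr h)

/-- Every isometry `(K, D)` is the first block column of a unitary matrix. -/
lemma exists_fromBlocks_unitary {K D : Matrix ι ι ℂ} (h : Kᴴ * K + Dᴴ * D = 1) :
    ∃ E F : Matrix ι ι ℂ, (fromBlocks K E D F)ᴴ * fromBlocks K E D F = 1 := by
  let v : ι ⊕ ι → EuclideanSpace ℂ (ι ⊕ ι) := fun j =>
    WithLp.toLp 2 (fun i => fromBlocks K 0 D 0 i j)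
  have hv : Orthonormal ℂ ((range (Sum.inl : ι → ι ⊕ ι)).domRestrict v) := by
    rw [orthonormal_iff_ite]
    rintro ⟨_, i, rfl⟩ ⟨_, j, rfl⟩
    have hij := congrFun (congrFun h i) j
    simp only [Matrix.add_apply, mul_apply, conjTranspose_apply, one_apply] at hij
    trans if i = j then 1 else 0
    · simpa [v, PiLp.inner_apply, mul_comm] using hij
    · by_cases hne : i = j
      · subst hne
        rw [if_pos rfl, if_pos rfl]
      · rw [if_neg hne, if_neg fun h0 => hne (Sum.inl_injective (congrArg Subtype.val h0))]
  obtain ⟨b, hb⟩ := hv.exists_orthonormalBasis_extension_of_card_eq finrank_euclideanSpace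
  let U : Matrix (ι ⊕ ι) (ι ⊕ ι) ℂ := of fun i j => b j i
  have hU : Uᴴ * U = 1 := by
    ext i j
    have hij := orthonormal_iff_ite.mp b.orthonormal i j
    rw [one_apply, ← hij]
    simp [U, mul_apply, PiLp.inner_apply, mul_comm]
  refine ⟨U.toBlocks₁₂, U.toBlocks₂₂, ?_⟩
  have hblocks : fromBlocks K U.toBlocks₁₂ D U.toBlocks₂₂ = U := by
    conv_rhs => rw [← fromBlocks_toBlocks U]
    congr 1 <;> ext i j <;> simp [U, v, toBlocks₁₁, toBlocks₂₁, hb (Sum.inl j) ⟨j, rfl⟩]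
  rw [hblocks, hU]

lemma Matrix.IsHermitian.exists_posSemidef_diagonal_sub {A : Matrix ι ι ℂ} (hA : A.IsHermitian) :
    ∃ c : ℝ, 0 < c ∧ (diagonal (fun _ => (c : ℂ)) - A).PosSemidef := by
  obtain ⟨P, hP, -, hAP, -⟩ := hA.exists_unitary_cfc_eq
  obtain ⟨c, hc⟩ := (finite_range hA.eigenvalues).bddAbove
  refine ⟨max c 1, by positivity, ?_⟩
  have h : diagonal (fun _ => ((max c 1 : ℝ) : ℂ)) - A =
      P * diagonal (fun i => ((max c 1 - hA.eigenvalues i : ℝ) : ℂ)) * Pᴴ := by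
    have h1 : diagonal (fun i => ((max c 1 - hA.eigenvalues i : ℝ) : ℂ)) =
        ((max c 1 : ℝ) : ℂ) • 1 - diagonal (fun i => (hA.eigenvalues i : ℂ)) := by
      rw [smul_one_eq_diagonal, diagonal_sub]; simp
    rw [h1, mul_sub, sub_mul, ← hAP, Matrix.mul_smul, Matrix.smul_mul, mul_one, hP, smul_one_eq_diagonal]
  rw [h]
  refine PosSemidef.mul_mul_conjTranspose_same (PosSemidef.diagonal fun i => ?_) P
  have := hc (mem_range_self i)
  exact Complex.zero_le_real.mpr (sub_nonneg.mpr (this.trans (le_max_left _ _)))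

omit [DecidableEq ι] in
lemma posSemidef_sub_of_forall_one_sub_smul {X Y : Matrix ι ι ℂ} (hXY : (X - Y).IsHermitian)
    (h : ∀ η ∈ Ioo (0 : ℝ) 1, (X - ((1 - η : ℝ) : ℂ) • Y).PosSemidef) :
    (X - Y).PosSemidef := by
  refine PosSemidef.of_dotProduct_mulVec_nonneg hXY fun x => ?_
  have hcont : Continuous fun η : ℝ => star x ⬝ᵥ ((X - ((1 - η : ℝ) : ℂ) • Y) *ᵥ x) := by
    fun_prop
  have hlim := (hcont.tendsto 0).mono_left (nhdsWithin_le_nhds (s := Ioi 0))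
  simp only [sub_zero, Complex.ofReal_one, one_smul] at hlim
  refine ge_of_tendsto hlim ?_
  filter_upwards [Ioo_mem_nhdsGT (zero_lt_one' ℝ)] with η hη
  exact (h η hη).dotProduct_mulVec_nonneg x

omit [Fintype ι] in
lemma diagonal_sum_eq_fromBlocks {κ : Type*} [DecidableEq κ] (h : ι ⊕ κ → ℂ) :
    diagonal h = fromBlocks (diagonal fun i => h (Sum.inl i)) 0 0
      (diagonal fun i => h (Sum.inr i)) := by
  rw [fromBlocks_diagonal]
  congr 1
  ext i
  cases i <;> rfl

omit [Fintype ι] [DecidableEq ι] in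
lemma fromBlocks_sub_fromBlocks (A B C D A' B' C' D' : Matrix ι ι ℂ) :
    fromBlocks A B C D - fromBlocks A' B' C' D' =
      fromBlocks (A - A') (B - B') (C - C') (D - D') := by
  simp only [sub_eq_add_neg, fromBlocks_neg, fromBlocks_add]

omit [DecidableEq ι] in
lemma fromBlocks_conj_blockDiagonal (K E D F P Q : Matrix ι ι ℂ) :
    (fromBlocks K E D F)ᴴ * fromBlocks P 0 0 Q * fromBlocks K E D F =
      fromBlocks (Kᴴ * P * K + Dᴴ * Q * D) (Kᴴ * P * E + Dᴴ * Q * F)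
        (Eᴴ * P * K + Fᴴ * Q * D) (Eᴴ * P * E + Fᴴ * Q * F) := by
  simp [fromBlocks_conjTranspose, fromBlocks_multiply]

open MatrixOrder in
lemma Matrix.PosSemidef.exists_eq_conjTranspose_mul_self {A : Matrix ι ι ℂ} (hA : A.PosSemidef) :
    ∃ D : Matrix ι ι ℂ, A = Dᴴ * D :=
  CStarAlgebra.nonneg_iff_eq_star_mul_self.mp hA.nonneg

/-- A Hermitian block matrix with positive definite upper left corner is made positive semidefinite
by adding a large multiple of the identity to the lower right corner. -/
lemma exists_posSemidef_fromBlocks {A Y Z : Matrix ι ι ℂ} (hA : A.PosDef) (hZ : Z.IsHermitian) :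
    ∃ c : ℝ, 0 < c ∧ (fromBlocks A Y Yᴴ (Matrix.diagonal (fun _ => (c : ℂ)) - Z)).PosSemidef := by
  let := hA.isUnit.invertible
  obtain ⟨c, hc, h⟩ := (hZ.add (isHermitian_conjTranspose_mul_mul Y
    hA.inv.isHermitian)).exists_posSemidef_diagonal_sub
  refine ⟨c, hc, (PosDef.fromBlocks₁₁ Y _ hA).mpr ?_⟩
  rwa [sub_sub]

lemma posDef_diagonal_sub_of_isometry {a a' : ι → ℝ} {δ : ℝ} (hδ : 0 < δ)
    (hδa : ∀ i, δ < a i - a' i) {K D : Matrix ι ι ℂ} (hD : 1 - Kᴴ * K = Dᴴ * D) :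
    (diagonal (fun i => (a i : ℂ)) - (diagonal (fun i => (a' i : ℂ)) +
      Dᴴ * Matrix.diagonal (fun _ => (δ : ℂ)) * D)).PosDef := by
  have h : diagonal (fun i => (a i : ℂ)) - (diagonal (fun i => (a' i : ℂ)) +
      Dᴴ * Matrix.diagonal (fun _ => (δ : ℂ)) * D) =
      diagonal (fun i => ((a i - a' i - δ : ℝ) : ℂ)) + (δ : ℂ) • (Kᴴ * K) := by
    have h1 : diagonal (fun i => ((a i - a' i - δ : ℝ) : ℂ)) = diagonal (fun i => (a i : ℂ)) -
        diagonal (fun i => (a' i : ℂ)) - (δ : ℂ) • 1 := by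
      rw [smul_one_eq_diagonal, diagonal_sub, diagonal_sub]; simp
    rw [h1, ← smul_one_eq_diagonal, Matrix.mul_smul, Matrix.smul_mul, mul_one, ← hD, smul_sub]
    abel
  rw [h]
  refine PosDef.add_posSemidef (PosDef.diagonal fun i => ?_)
    ((posSemidef_conjTranspose_mul_self K).smul (Complex.zero_le_real.mpr hδ.le))
  exact Complex.zero_lt_real.mpr (sub_pos.mpr (hδa i))

/-- **Hansen's inequality** `Kᴴ f(b) K ≤ f(a)` for a contraction `K` with `Kᴴ b K = a' < a`. -/
lemma posSemidef_diagonal_sub_conj_of_contraction {f : ℝ → ℝ}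
    (hpos : ∀ t ∈ Ioi (0 : ℝ), 0 < f t) (hf : ∀ n, MatMonoOn n (Ioi 0) f)
    {a a' b : ι → ℝ} (ha' : ∀ i, 0 < a' i) (haa' : ∀ i, a' i < a i) (hb : ∀ i, 0 < b i)
    {K : Matrix ι ι ℂ} (hK : (1 - Kᴴ * K).PosSemidef)
    (hKb : Kᴴ * diagonal (fun i => (b i : ℂ)) * K = diagonal (fun i => (a' i : ℂ))) :
    (diagonal (fun i => (f (a i) : ℂ)) -
      Kᴴ * diagonal (fun i => (f (b i) : ℂ)) * K).PosSemidef := by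
  obtain ⟨D, hD⟩ := hK.exists_eq_conjTranspose_mul_self
  obtain ⟨E, F, hU⟩ := exists_fromBlocks_unitary (K := K) (D := D) (by rw [← hD]; abel)
  obtain ⟨δ, hδa, hδ⟩ : ∃ δ : ℝ, (∀ i, δ < a i - a' i) ∧ 0 < δ := by
    have h : ∀ᶠ δ : ℝ in nhdsWithin 0 (Ioi 0), ∀ i, δ < a i - a' i := by
      rw [Filter.eventually_all]
      exact fun i => nhdsWithin_le_nhds (Iio_mem_nhds (sub_pos.mpr (haa' i)))
    exact (h.and self_mem_nhdsWithin).exists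
  have hcorner := posDef_diagonal_sub_of_isometry hδ hδa hD
  have hZ : (Eᴴ * diagonal (fun i => (b i : ℂ)) * E +
      Fᴴ * Matrix.diagonal (fun _ => (δ : ℂ)) * F).IsHermitian := by
    simpa using (isHermitian_conj_diagonal_ofReal Eᴴ b).add
      (isHermitian_conj_diagonal_ofReal Fᴴ fun _ => δ)
  obtain ⟨c, hc, hblock⟩ := exists_posSemidef_fromBlocks (Y :=
    -(Kᴴ * diagonal (fun i => (b i : ℂ)) * E + Dᴴ * Matrix.diagonal (fun _ => (δ : ℂ)) * F)) hcorner hZ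
  have hmono := (hf (Fintype.card (ι ⊕ ι))).posSemidef_conj_diagonal
    (U := (fromBlocks K E D F)ᴴ) (V := 1) (d := Sum.elim b fun _ => δ) (e := Sum.elim a fun _ => c)
    (by rwa [conjTranspose_conjTranspose]) (by simp)
    (by rintro (i | i) <;> simp [hb, hδ])
    (by rintro (i | i) <;> simp [hc, (ha' i).trans (haa' i)])
    (by
      rw [diagonal_sum_eq_fromBlocks, diagonal_sum_eq_fromBlocks]
      simp only [Sum.elim_inl, Sum.elim_inr, conjTranspose_conjTranspose,
        fromBlocks_conj_blockDiagonal, conjTranspose_one, one_mul, mul_one, fromBlocks_sub_fromBlocks, hKb]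
      convert! hblock using 2 <;>
        simp [conjTranspose_mul, mul_assoc, diagonal_conjTranspose, Pi.star_def, add_comm])
  rw [diagonal_sum_eq_fromBlocks, diagonal_sum_eq_fromBlocks] at hmono
  simp only [Sum.elim_inl, Sum.elim_inr, conjTranspose_conjTranspose,
    fromBlocks_conj_blockDiagonal, conjTranspose_one, one_mul, mul_one, fromBlocks_sub_fromBlocks] at hmono
  have h11 := hmono.submatrix Sum.inl
  have hrest : (Dᴴ * Matrix.diagonal (fun _ => (f δ : ℂ)) * D).PosSemidef :=
    PosSemidef.conjTranspose_mul_mul_same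
      (PosSemidef.diagonal fun _ => Complex.zero_le_real.mpr (hpos δ hδ).le) D
  convert! h11.add hrest using 1
  ext i j
  simp only [Matrix.sub_apply, submatrix_apply, Matrix.add_apply, fromBlocks_apply₁₁]
  ring

/-- `W a Wᴴ ≤ b` implies `Wᴴ (f(b) / b) W ≤ f(a) / a` for diagonal `a`, `b` and unitary `W`. -/
lemma posSemidef_diagonal_div_sub_conj {f : ℝ → ℝ}
    (hpos : ∀ t ∈ Ioi (0 : ℝ), 0 < f t) (hf : ∀ n, MatMonoOn n (Ioi 0) f)
    {a b : ι → ℝ} (ha : ∀ i, 0 < a i) (hb : ∀ i, 0 < b i) {W : Matrix ι ι ℂ} (hW : W * Wᴴ = 1)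
    (h : (diagonal (fun i => (b i : ℂ)) -
      W * diagonal (fun i => (a i : ℂ)) * Wᴴ).PosSemidef) :
    (diagonal (fun i => ((f (a i) / a i : ℝ) : ℂ)) -
      Wᴴ * diagonal (fun i => ((f (b i) / b i : ℝ) : ℂ)) * W).PosSemidef := by
  have hW' : Wᴴ * W = 1 := mul_eq_one_comm.mp hW
  refine posSemidef_sub_of_forall_one_sub_smul ?_ fun η hη => ?_
  · refine IsHermitian.sub ?_ ?_
    · simpa using isHermitian_conj_diagonal_ofReal (1 : Matrix ι ι ℂ) fun i => f (a i) / a i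
    · simpa using isHermitian_conj_diagonal_ofReal Wᴴ fun i => f (b i) / b i
  have hη0 : 0 < 1 - η := sub_pos.mpr hη.2
  let α : ι → ℝ := fun i => √((1 - η) * a i)
  let β : ι → ℝ := fun i => (√(b i))⁻¹
  have hα : ∀ i, α i * α i = (1 - η) * a i := fun i =>
    Real.mul_self_sqrt (mul_pos hη0 (ha i)).le
  have hα0 : ∀ i, α i ≠ 0 := fun i => (Real.sqrt_pos.mpr (mul_pos hη0 (ha i))).ne'
  have hβ : ∀ i, β i * β i = (b i)⁻¹ := fun i => by
    simp only [β]
    rw [← mul_inv, Real.mul_self_sqrt (hb i).le]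
  let dg : (ι → ℝ) → Matrix ι ι ℂ := fun d => diagonal fun i => (d i : ℂ)
  have dg_mul : ∀ c d : ι → ℝ, dg c * dg d = dg fun i => c i * d i := fun c d => by
    simp [dg, diagonal_mul_diagonal]
  have dg_mul_mul : ∀ (c d : ι → ℝ) (X : Matrix ι ι ℂ),
      dg c * (dg d * X) = dg (fun i => c i * d i) * X := fun c d X => by
    rw [← mul_assoc, dg_mul]
  have dg_star : ∀ d : ι → ℝ, (dg d)ᴴ = dg d := fun d => by
    simp [dg, diagonal_conjTranspose, Pi.star_def]
  have dg_one : dg (fun _ => 1) = 1 := by simp [dg]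
  have dg_smul : ∀ (r : ℝ) (d : ι → ℝ), (r : ℂ) • dg d = dg fun i => r * d i := fun r d => by
    ext i j
    by_cases hij : i = j <;> simp [dg, hij]
  change (dg b - W * dg a * Wᴴ).PosSemidef at h
  change (dg (fun i => f (a i) / a i) - ((1 - η : ℝ) : ℂ) •
    (Wᴴ * dg (fun i => f (b i) / b i) * W)).PosSemidef
  have hKb : ∀ g : ι → ℝ, (dg β * W * dg α)ᴴ * dg g * (dg β * W * dg α) =
      dg α * (Wᴴ * dg (fun i => g i / b i) * W) * dg α := fun g => by
    have hg : (fun i => β i * (g i * β i)) = fun i => g i / b i := by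
      ext i
      rw [div_eq_mul_inv, ← hβ]; ring
    simp only [conjTranspose_mul, dg_star, mul_assoc, dg_mul_mul, hg]
  have hcontr : (1 - (dg β * W * dg α)ᴴ * (dg β * W * dg α)).PosSemidef := by
    apply posSemidef_one_sub_conjTranspose_mul_self
    have hη1 : (dg fun _ => η).PosSemidef :=
      PosSemidef.diagonal fun _ => Complex.zero_le_real.mpr hη.1.le
    have h2 := ((h.conjTranspose_mul_mul_same (dg β)).smul
      (Complex.zero_le_real.mpr hη0.le)).add hη1
    have hββ : (fun i => β i * (b i * β i)) = fun _ => 1 := by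
      ext i
      rw [mul_left_comm, hβ, mul_inv_cancel₀ (hb i).ne']
    have hαα : dg (fun i => α i * α i) = ((1 - η : ℝ) : ℂ) • dg a := by
      simp only [hα, dg_smul]
    have hηη : dg (fun _ => η) = (η : ℂ) • 1 := by
      simp only [dg, smul_one_eq_diagonal]
    convert! h2 using 1
    simp only [conjTranspose_mul, dg_star, Matrix.mul_sub, Matrix.sub_mul, mul_assoc, dg_mul,
      dg_mul_mul, hββ, hαα, hηη, dg_one, smul_sub, Matrix.mul_smul, Matrix.smul_mul]
    push_cast
    module
  have hansen := posSemidef_diagonal_sub_conj_of_contraction hpos hf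
    (a := a) (a' := fun i => (1 - η) * a i) (b := b)
    (fun i => mul_pos hη0 (ha i)) (fun i => by nlinarith [ha i, hη.1]) hb hcontr (by
      refine (hKb b).trans ?_
      have : (fun i => b i / b i) = fun _ => 1 := by ext i; exact div_self (hb i).ne'
      rw [this, dg_one, mul_one, hW', mul_one, dg_mul]
      simp only [hα, dg])
  change (dg (fun i => f (a i)) - (dg β * W * dg α)ᴴ * dg (fun i => f (b i)) *
    (dg β * W * dg α)).PosSemidef at hansen
  rw [hKb] at hansen
  have h3 := (hansen.conjTranspose_mul_mul_same (dg fun i => (α i)⁻¹)).smul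
      (Complex.zero_le_real.mpr hη0.le)
  convert! h3 using 1
  have e1 : (fun i => (α i)⁻¹ * α i) = fun _ => 1 := by ext i; exact inv_mul_cancel₀ (hα0 i)
  have e2 : (fun i => α i * (α i)⁻¹) = fun _ => 1 := by ext i; exact mul_inv_cancel₀ (hα0 i)
  have e3 : (fun i => (1 - η) * ((α i)⁻¹ * (f (a i) * (α i)⁻¹))) = fun i => f (a i) / a i := by
    ext i
    have : (α i)⁻¹ * (f (a i) * (α i)⁻¹) = f (a i) * (α i * α i)⁻¹ := by
      rw [mul_inv]; ring
    rw [this, hα]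
    have := (ha i).ne'
    field_simp
  simp only [dg_star, Matrix.mul_sub, Matrix.sub_mul, mul_assoc, dg_mul, dg_mul_mul, smul_sub, dg_smul, e1, e2,
    e3, dg_one, one_mul, mul_one]

end Diagonalization

theorem stmt12 (f : ℝ → ℝ) (hpos : ∀ t ∈ Ioi (0:ℝ), 0 < f t)
    (hf : ∀ n, MatMonoOn n (Ioi 0) f) :
    ∀ n, MatMonoOn n (Ioi 0) (fun t => -(f t / t)) := by
  intro n A B hA hB hAI hBI hAB
  obtain ⟨P, hP, hP', hAP, hcfcA⟩ := hA.exists_unitary_cfc_eq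
  obtain ⟨Q, hQ, hQ', hBQ, hcfcB⟩ := hB.exists_unitary_cfc_eq
  have hW : (Qᴴ * P) * (Qᴴ * P)ᴴ = 1 := by
    rw [conjTranspose_mul, conjTranspose_conjTranspose,
      show Qᴴ * P * (Pᴴ * Q) = Qᴴ * (P * Pᴴ) * Q by simp only [mul_assoc], hP, mul_one, hQ']
  have hdiag := posSemidef_diagonal_div_sub_conj hpos hf hAI hBI hW (by
    have h := hAB.conjTranspose_mul_mul_same Q
    rw [mul_sub, sub_mul] at h
    convert! h using 2
    · conv_rhs => rw [hBQ]
      simp only [mul_assoc, hQ', mul_one]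
      rw [← mul_assoc, hQ', one_mul]
    · conv_rhs => rw [hAP]
      simp only [conjTranspose_mul, conjTranspose_conjTranspose, mul_assoc])
  have h := hdiag.mul_mul_conjTranspose_same P
  convert! h using 1
  rw [hcfcA, hcfcB]
  have hneg : ∀ d : Fin n → ℝ, diagonal (fun i => ((-(f (d i) / d i) : ℝ) : ℂ)) =
      -diagonal (fun i => ((f (d i) / d i : ℝ) : ℂ)) := fun d => by
    rw [diagonal_neg]; simp
  rw [hneg, hneg, mul_sub, sub_mul]
  simp only [conjTranspose_mul, conjTranspose_conjTranspose, mul_neg, neg_mul, sub_neg_eq_add]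
  rw [show P * (Pᴴ * Q * diagonal (fun i => ((f (hB.eigenvalues i) / hB.eigenvalues i : ℝ) : ℂ)) *
      (Qᴴ * P)) * Pᴴ = (P * Pᴴ) * Q *
      diagonal (fun i => ((f (hB.eigenvalues i) / hB.eigenvalues i : ℝ) : ℂ)) * Qᴴ * (P * Pᴴ) by
      simp only [mul_assoc], hP, one_mul, mul_one]
  abel

end
end

section
/- If f : (0,∞) → (0,∞) is operator monotone, then the transpose function f^♯(t) = t/f(t) is operator monotone on (0,∞). -/
open Matrix Set
open scoped ComplexOrder

noncomputable section

lemma posDef_smul_one {n : Type*} [DecidableEq n] {c : ℝ} (hc : 0 < c) :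
    (c • (1 : Matrix n n ℂ)).PosDef :=
  PosDef.one.smul hc

lemma posSemidef_smul_one {n : Type*} [DecidableEq n] {c : ℝ} (hc : 0 ≤ c) :
    (c • (1 : Matrix n n ℂ)).PosSemidef :=
  PosSemidef.one.smul hc

lemma posSemidef_of_forall_sub_smul {n : Type*} [Fintype n] {M N : Matrix n n ℂ}
    (hM : M.IsHermitian) (hN : N.IsHermitian)
    (h : ∀ s : ℝ, 0 < s → s < 1 → (M - s • N).PosSemidef) :
    (M - N).PosSemidef := by
  refine PosSemidef.of_dotProduct_mulVec_nonneg (hM.sub hN) fun x => ?_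
  have hlim : Filter.Tendsto (fun s : ℝ => star x ⬝ᵥ ((M - s • N) *ᵥ x)) (nhdsWithin 1 (Iio 1))
      (nhds (star x ⬝ᵥ ((M - (1 : ℝ) • N) *ᵥ x))) := by
    apply tendsto_nhdsWithin_of_tendsto_nhds
    apply Continuous.tendsto
    fun_prop
  rw [one_smul] at hlim
  refine ge_of_tendsto hlim ?_
  filter_upwards [Ioo_mem_nhdsLT (zero_lt_one' ℝ)] with s hs
  exact (h s hs.1 hs.2).dotProduct_mulVec_nonneg x

section AuxiliaryMatrixLemmas

variable {m n : Type*} [Fintype m] [Fintype n] [DecidableEq m] [DecidableEq n]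

/-- The functional calculus respects intertwining relations between Hermitian matrices. -/
lemma cfc_intertwine (f : ℝ → ℝ) {Y : Matrix m m ℂ} {A : Matrix n n ℂ} (hY : Y.IsHermitian)
    (hA : A.IsHermitian) {V : Matrix m n ℂ} (h : Y * V = V * A) :
    cfc f Y * V = V * cfc f A := by
  have hfin : (spectrum ℝ Y ∪ spectrum ℝ A).Finite :=
    Y.finite_real_spectrum.union A.finite_real_spectrum
  set p := Lagrange.interpolate hfin.toFinset id f
  have hpf : ∀ x ∈ spectrum ℝ Y ∪ spectrum ℝ A, f x = p.eval x := fun x hx =>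
    (Lagrange.eval_interpolate_at_node f (Function.injective_id.injOn)
      (hfin.mem_toFinset.2 hx)).symm
  rw [cfc_congr (fun x hx => hpf x (Or.inl hx)), cfc_congr (fun x hx => hpf x (Or.inr hx)),
    cfc_polynomial p Y hY.isSelfAdjoint, cfc_polynomial p A hA.isSelfAdjoint]
  have hpow : ∀ k : ℕ, Y ^ k * V = V * A ^ k := by
    intro k
    induction k with
    | zero => simp
    | succ k ih => rw [pow_succ, Matrix.mul_assoc, h, ← Matrix.mul_assoc, ih, Matrix.mul_assoc,
        ← pow_succ]
  induction p using Polynomial.induction_on' with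
  | add p q hp hq => simp only [map_add, Matrix.add_mul, Matrix.mul_add, hp, hq]
  | monomial k a =>
    simp only [Polynomial.aeval_monomial, Algebra.algebraMap_eq_smul_one, smul_mul_assoc, one_mul,
      Matrix.smul_mul, Matrix.mul_smul, hpow]

lemma isHermitian_cfc (f : ℝ → ℝ) (A : Matrix n n ℂ) : (cfc f A).IsHermitian :=
  cfc_predicate f A

lemma continuousOn_spectrum (f : ℝ → ℝ) (A : Matrix n n ℂ) : ContinuousOn f (spectrum ℝ A) :=
  A.finite_real_spectrum.continuousOn f

lemma cfc_mul_matrix (f g : ℝ → ℝ) (A : Matrix n n ℂ) :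
    cfc f A * cfc g A = cfc (fun t => f t * g t) A :=
  (cfc_mul f g A (continuousOn_spectrum f A) (continuousOn_spectrum g A)).symm

lemma posSemidef_cfc {f : ℝ → ℝ} {A : Matrix n n ℂ} (h : ∀ t ∈ spectrum ℝ A, 0 ≤ f t) :
    (cfc f A).PosSemidef := by
  open scoped MatrixOrder in
  exact Matrix.nonneg_iff_posSemidef.1 (cfc_nonneg h)

lemma Matrix.PosSemidef.nonneg_of_mem_spectrum {A : Matrix n n ℂ} (hA : A.PosSemidef) {t : ℝ}
    (ht : t ∈ spectrum ℝ A) : 0 ≤ t := by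
  rw [hA.isHermitian.spectrum_real_eq_range_eigenvalues] at ht
  obtain ⟨i, rfl⟩ := ht
  exact hA.eigenvalues_nonneg i

lemma Matrix.PosDef.pos_of_mem_spectrum {A : Matrix n n ℂ} (hA : A.PosDef) {t : ℝ}
    (ht : t ∈ spectrum ℝ A) : 0 < t := by
  rw [hA.isHermitian.spectrum_real_eq_range_eigenvalues] at ht
  obtain ⟨i, rfl⟩ := ht
  exact hA.eigenvalues_pos i

lemma cfc_sub_const {A : Matrix n n ℂ} (hA : A.IsHermitian) (c : ℝ) :
    cfc (fun t => t - c) A = A - c • 1 := by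
  have hA' : IsSelfAdjoint A := hA
  rw [cfc_sub (fun t => t) (fun _ => c) A, cfc_id' ℝ A, cfc_const c A,
    Algebra.algebraMap_eq_smul_one]

lemma Matrix.PosDef.exists_sub_smul_one_posSemidef {A : Matrix n n ℂ} (hA : A.PosDef) :
    ∃ c : ℝ, 0 < c ∧ (A - c • 1).PosSemidef := by
  obtain ⟨c, hc0, hc⟩ : ∃ c : ℝ, 0 < c ∧ ∀ t ∈ spectrum ℝ A, c ≤ t := by
    rcases (spectrum ℝ A).eq_empty_or_nonempty with h | h
    · exact ⟨1, one_pos, by simp [h]⟩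
    · obtain ⟨c, hc, hmin⟩ := A.finite_real_spectrum.exists_minimal h
      exact ⟨c, hA.pos_of_mem_spectrum hc, fun t ht => (le_total c t).elim id (hmin ht)⟩
  refine ⟨c, hc0, ?_⟩
  rw [← cfc_sub_const hA.isHermitian]
  exact posSemidef_cfc fun t ht => sub_nonneg.2 (hc t ht)

lemma Matrix.IsHermitian.exists_smul_one_sub_posSemidef {A : Matrix n n ℂ} (hA : A.IsHermitian) :
    ∃ c : ℝ, 0 < c ∧ (c • 1 - A).PosSemidef := by
  obtain ⟨c, hc⟩ := A.finite_real_spectrum.bddAbove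
  refine ⟨max c 1, lt_max_of_lt_right one_pos, ?_⟩
  have hA' : IsSelfAdjoint A := hA
  have : max c 1 • 1 - A = cfc (fun t => max c 1 - t) A := by
    rw [cfc_sub (fun _ => max c 1) (fun t => t) A, cfc_id' ℝ A, cfc_const _ A,
      Algebra.algebraMap_eq_smul_one]
  rw [this]
  exact posSemidef_cfc fun t ht => sub_nonneg.2 ((hc ht).trans (le_max_left _ _))

lemma Matrix.PosDef.cfc_mul_eq_one {A : Matrix n n ℂ} (hA : A.PosDef) {g h : ℝ → ℝ}
    (hgh : ∀ t, 0 < t → g t * h t = 1) : cfc g A * cfc h A = 1 := by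
  rw [cfc_mul_matrix, cfc_congr (g := fun _ => 1) fun t ht => hgh t (hA.pos_of_mem_spectrum ht)]
  exact cfc_const_one ℝ A hA.isHermitian.isSelfAdjoint

lemma Matrix.PosDef.inv_cfc {A : Matrix n n ℂ} (hA : A.PosDef) {g : ℝ → ℝ}
    (hg : ∀ t, 0 < t → 0 < g t) : (cfc g A)⁻¹ = cfc (fun t => (g t)⁻¹) A :=
  Matrix.inv_eq_right_inv (hA.cfc_mul_eq_one fun t ht => mul_inv_cancel₀ (hg t ht).ne')

lemma Matrix.PosDef.posDef_cfc {A : Matrix n n ℂ} (hA : A.PosDef) {g : ℝ → ℝ}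
    (hg : ∀ t, 0 < t → 0 < g t) : (cfc g A).PosDef := by
  open scoped MatrixOrder in
  exact (posSemidef_cfc fun t ht => (hg t (hA.pos_of_mem_spectrum ht)).le).posDef_iff_isUnit.2
    (IsUnit.of_mul_eq_one _ (hA.cfc_mul_eq_one fun t ht => mul_inv_cancel₀ (hg t ht).ne'))

lemma Matrix.PosDef.cfc_sqrt_mul_self {A : Matrix n n ℂ} (hA : A.PosDef) :
    cfc Real.sqrt A * cfc Real.sqrt A = A := by
  rw [cfc_mul_matrix, cfc_congr (g := fun t => t) fun t ht =>
    Real.mul_self_sqrt (hA.pos_of_mem_spectrum ht).le]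
  exact cfc_id' ℝ A hA.isHermitian.isSelfAdjoint

lemma Matrix.PosDef.cfc_sqrt_mul_cfc_inv_sqrt {A : Matrix n n ℂ} (hA : A.PosDef) :
    cfc Real.sqrt A * cfc (fun t => (√t)⁻¹) A = 1 :=
  hA.cfc_mul_eq_one fun _ ht => mul_inv_cancel₀ (Real.sqrt_pos.2 ht).ne'

lemma Matrix.PosDef.cfc_inv_sqrt_mul_self {A : Matrix n n ℂ} (hA : A.PosDef) :
    cfc (fun t => (√t)⁻¹) A * cfc (fun t => (√t)⁻¹) A = A⁻¹ := by
  conv_rhs => rw [← hA.cfc_sqrt_mul_self, Matrix.mul_inv_rev,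
    Matrix.inv_eq_right_inv hA.cfc_sqrt_mul_cfc_inv_sqrt]

lemma Matrix.PosDef.cfc_inv_sqrt_conj {A : Matrix n n ℂ} (hA : A.PosDef) :
    cfc (fun t => (√t)⁻¹) A * A * cfc (fun t => (√t)⁻¹) A = 1 := by
  have h := hA.cfc_sqrt_mul_cfc_inv_sqrt
  conv_lhs => enter [1, 2]; rw [← hA.cfc_sqrt_mul_self]
  rw [← mul_assoc, mul_eq_one_comm.1 h, one_mul, h]

lemma Matrix.PosDef.cfc_inv_sqrt_mul_cfc_mul {A : Matrix n n ℂ} (hA : A.PosDef) (f : ℝ → ℝ) :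
    cfc (fun t => (√t)⁻¹) A * cfc f A * cfc (fun t => (√t)⁻¹) A = cfc (fun t => f t / t) A := by
  rw [cfc_mul_matrix, cfc_mul_matrix]
  refine cfc_congr fun t ht => ?_
  have ht' := hA.pos_of_mem_spectrum ht
  have hsq := Real.mul_self_sqrt ht'.le
  have hne := (Real.sqrt_pos.2 ht').ne'
  calc (√t)⁻¹ * f t * (√t)⁻¹ = f t / (√t * √t) := by field_simp
    _ = f t / t := by rw [hsq]

/-- The inverse is antitone on positive definite matrices. -/
lemma Matrix.PosDef.inv_sub_inv_posSemidef {A B : Matrix n n ℂ} (hA : A.PosDef) (hB : B.PosDef)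
    (hAB : (B - A).PosSemidef) : (A⁻¹ - B⁻¹).PosSemidef := by
  have := hB.isUnit.invertible
  have := hA.inv.isUnit.invertible
  have h₁ := hB.fromBlocks₁₁ (1 : Matrix n n ℂ) A⁻¹
  have h₂ := hA.inv.fromBlocks₂₂ B (1 : Matrix n n ℂ)
  have hdet : IsUnit A.det := A.isUnit_iff_isUnit_det.1 hA.isUnit
  rw [Matrix.nonsing_inv_nonsing_inv A hdet] at h₂
  simp only [conjTranspose_one, one_mul, mul_one] at h₁ h₂
  exact h₁.1 (h₂.2 hAB)

/-- A positive matrix bounded by `c` is dominated by a small perturbation of its compression to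
the range of a projection plus a large multiple of the complementary projection. -/
lemma posSemidef_compression_sub {X P : Matrix n n ℂ} (hX : X.PosSemidef) {c : ℝ}
    (hc : (c • 1 - X).PosSemidef) (hP : P.IsHermitian) (hPP : P * P = P) {s : ℝ} (hs : 0 < s) :
    (P * X * P + (s ^ 2 * c) • P + ((1 + (s ^ 2)⁻¹) * c) • (1 - P) - X).PosSemidef := by
  set Q := 1 - P with hQ
  have hQh : Qᴴ = Q := by simp [hQ, hP.eq]
  have hQQ : Q * Q = Q := by simp [hQ, mul_sub, sub_mul, hPP]
  have hXe : X = P * X * P + P * X * Q + Q * X * P + Q * X * Q := by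
    rw [hQ]; noncomm_ring
  have h₁ := hX.conjTranspose_mul_mul_same (s • P - s⁻¹ • Q)
  have h₂ := (hc.conjTranspose_mul_mul_same P).smul (sq_nonneg s)
  have h₃ := (hc.conjTranspose_mul_mul_same Q).smul (show 0 ≤ 1 + (s ^ 2)⁻¹ by positivity)
  convert (h₁.add h₂).add h₃ using 1
  conv_lhs => rw [sub_eq_add_neg]; arg 2; rw [hXe]
  simp only [conjTranspose_sub, conjTranspose_smul, hP.eq, hQh, star_trivial, sub_mul, mul_sub,
    smul_mul_assoc, mul_smul_comm, mul_one, hPP, hQQ]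
  match_scalars <;> field_simp <;> ring

end AuxiliaryMatrixLemmas

lemma MatMonoOn.posSemidef_cfc_sub {n : ℕ} {f : ℝ → ℝ} (hf : MatMonoOn n (Ioi 0) f)
    {A B : Matrix (Fin n) (Fin n) ℂ} (hA : A.PosDef) (hB : B.PosDef) (hAB : (B - A).PosSemidef) :
    (cfc f B - cfc f A).PosSemidef := by
  rw [hA.isHermitian.cfc_eq, hB.isHermitian.cfc_eq]
  exact hf A B _ _ hA.eigenvalues_pos hB.eigenvalues_pos hAB

/-- There is a pair of isometries with complementary ranges into a space of twice the dimension. -/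
lemma exists_complementary_isometries (n : ℕ) :
    ∃ V W : Matrix (Fin (n + n)) (Fin n) ℂ, Vᴴ * V = 1 ∧ Wᴴ * W = 1 ∧ Vᴴ * W = 0 ∧
      Wᴴ * V = 0 ∧ V * Vᴴ + W * Wᴴ = 1 := by
  have hne : ∀ i j : Fin n, Fin.castAdd n i ≠ Fin.natAdd n j := fun i j h => by
    have := congrArg Fin.val h
    simp only [Fin.val_castAdd, Fin.val_natAdd] at this
    omega
  refine ⟨(1 : Matrix _ _ ℂ).submatrix id (Fin.castAdd n),
    (1 : Matrix _ _ ℂ).submatrix id (Fin.natAdd n), ?_, ?_, ?_, ?_, ?_⟩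
  · ext i j
    simp [Matrix.mul_apply, Matrix.one_apply]
  · ext i j
    simp [Matrix.mul_apply, Matrix.one_apply]
  · ext i j
    simp [Matrix.mul_apply, Matrix.one_apply, hne, -Fin.natAdd_eq_addNat]
  · ext i j
    simp [Matrix.mul_apply, Matrix.one_apply, (hne _ _).symm, -Fin.natAdd_eq_addNat]
  · ext i j
    refine Fin.addCases (fun i => ?_) (fun i => ?_) i <;>
      refine Fin.addCases (fun j => ?_) (fun j => ?_) j <;>
      simp [Matrix.mul_apply, Matrix.one_apply, hne, (hne _ _).symm, -Fin.natAdd_eq_addNat]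

/-- Hansen's inequality for contractions, with a strictly positive margin. -/
lemma MatMonoOn.hansen {n : ℕ} {f : ℝ → ℝ} (hpos : ∀ t ∈ Ioi (0 : ℝ), 0 < f t)
    (hf : MatMonoOn n (Ioi 0) f) (hf₂ : MatMonoOn (n + n) (Ioi 0) f)
    {A B K : Matrix (Fin n) (Fin n) ℂ} (hA : A.PosDef) (hB : B.PosDef)
    (hK : (1 - Kᴴ * K).PosSemidef) {η : ℝ} (hη : 0 < η)
    (hAB : (A - Kᴴ * B * K - η • 1).PosSemidef) :
    (cfc f A - Kᴴ * cfc f B * K).PosSemidef := by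
  obtain ⟨b, hb0, hb⟩ := hB.exists_sub_smul_one_posSemidef
  obtain ⟨V₁, V₂, h11, h22, h12, h21, hsum⟩ := exists_complementary_isometries n
  obtain ⟨D, hD⟩ : ∃ D : Matrix (Fin n) (Fin n) ℂ, Dᴴ * D = 1 - Kᴴ * K := by
    refine ⟨cfc Real.sqrt (1 - Kᴴ * K), ?_⟩
    have hsq := cfc_mul_matrix Real.sqrt Real.sqrt (1 - Kᴴ * K)
    rw [(isHermitian_cfc _ _).eq, hsq, cfc_congr (g := fun t => t) fun t ht =>
      Real.mul_self_sqrt (hK.nonneg_of_mem_spectrum ht)]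
    exact cfc_id' ℝ _ hK.isHermitian.isSelfAdjoint
  obtain ⟨δ, hδ0, hδb, hδη⟩ : ∃ δ : ℝ, 0 < δ ∧ δ ≤ b ∧ δ ≤ η / 2 :=
    ⟨min b (η / 2), by positivity, min_le_left _ _, min_le_right _ _⟩
  have k11 : ∀ M : Matrix (Fin n) (Fin n) ℂ, V₁ᴴ * (V₁ * M) = M := fun M => by
    rw [← Matrix.mul_assoc, h11, Matrix.one_mul]
  have k22 : ∀ M : Matrix (Fin n) (Fin n) ℂ, V₂ᴴ * (V₂ * M) = M := fun M => by
    rw [← Matrix.mul_assoc, h22, Matrix.one_mul]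
  have k12 : ∀ M : Matrix (Fin n) (Fin n) ℂ, V₁ᴴ * (V₂ * M) = 0 := fun M => by
    rw [← Matrix.mul_assoc, h12, Matrix.zero_mul]
  have k21 : ∀ M : Matrix (Fin n) (Fin n) ℂ, V₂ᴴ * (V₁ * M) = 0 := fun M => by
    rw [← Matrix.mul_assoc, h21, Matrix.zero_mul]
  set V := V₁ * K + V₂ * D with hV
  set X := V₁ * B * V₁ᴴ + δ • (V₂ * V₂ᴴ) with hXdef
  have hVV : Vᴴ * V = 1 := by
    simp only [hV, conjTranspose_add, conjTranspose_mul, Matrix.add_mul, Matrix.mul_add,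
      Matrix.mul_assoc, k11, k22, k12, k21, Matrix.mul_zero, add_zero, zero_add, hD]
    abel
  have hXV₁ : X * V₁ = V₁ * B := by
    simp [hXdef, Matrix.add_mul, Matrix.mul_assoc, h11, h21]
  have hXV₂ : X * V₂ = V₂ * (δ • (1 : Matrix (Fin n) (Fin n) ℂ)) := by
    simp [hXdef, Matrix.add_mul, Matrix.mul_assoc, h12, h22]
  have hX : X.PosDef := by
    have : X = δ • 1 + (V₁ * (B - b • 1) * V₁ᴴ + (b - δ) • (V₁ * V₁ᴴ)) := by
      rw [hXdef, ← hsum, Matrix.mul_sub, Matrix.sub_mul, Matrix.mul_smul, Matrix.smul_mul,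
        Matrix.mul_one]
      module
    rw [this]
    exact (posDef_smul_one hδ0).add_posSemidef ((hb.mul_mul_conjTranspose_same V₁).add
      ((posSemidef_self_mul_conjTranspose V₁).smul (sub_nonneg.2 hδb)))
  obtain ⟨c, hc0, hc⟩ := hX.isHermitian.exists_smul_one_sub_posSemidef
  obtain ⟨s, hs0, hs⟩ : ∃ s : ℝ, 0 < s ∧ s ^ 2 * c = η / 2 :=
    ⟨√(η / 2 / c), by positivity, by
      rw [Real.sq_sqrt (by positivity), div_mul_cancel₀ _ hc0.ne']⟩
  set Z := Vᴴ * X * V + (η / 2) • 1 with hZdef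
  have hZ : Z.PosDef :=
    (posDef_smul_one (half_pos hη)).posSemidef_add (hX.posSemidef.conjTranspose_mul_mul_same V)
  set P := V * Vᴴ with hPdef
  have hP : P.IsHermitian := isHermitian_mul_conjTranspose_self V
  have hPV : P * V = V := by rw [hPdef, Matrix.mul_assoc, hVV, Matrix.mul_one]
  have hPP : P * P = P := by rw [hPdef, ← Matrix.mul_assoc, hPV]
  set Y := P * X * P + (s ^ 2 * c) • P + ((1 + (s ^ 2)⁻¹) * c) • (1 - P) with hYdef
  have hYX : (Y - X).PosSemidef := posSemidef_compression_sub hX.posSemidef hc hP hPP hs0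
  have hY : Y.PosDef := by simpa using hX.add_posSemidef hYX
  have hYV : Y * V = V * Z := by
    have hQV : (1 - P) * V = 0 := by rw [Matrix.sub_mul, hPV, Matrix.one_mul, sub_self]
    rw [hYdef, hs, Matrix.add_mul, Matrix.add_mul, Matrix.smul_mul, Matrix.smul_mul, hQV, hPV,
      Matrix.mul_assoc, hPV, smul_zero, add_zero, hZdef, hPdef, Matrix.mul_add V (Vᴴ * X * V),
      Matrix.mul_smul, Matrix.mul_one]
    simp only [Matrix.mul_assoc]
  have hVX : Vᴴ * cfc f X * V = Kᴴ * cfc f B * K + f δ • (Dᴴ * D) := by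
    have e₁ := cfc_intertwine f hX.isHermitian hB.isHermitian hXV₁
    have e₂ := cfc_intertwine f hX.isHermitian (posDef_smul_one hδ0).isHermitian hXV₂
    rw [← Algebra.algebraMap_eq_smul_one, cfc_algebraMap, Algebra.algebraMap_eq_smul_one,
      Matrix.mul_smul, Matrix.mul_one] at e₂
    rw [Matrix.mul_assoc, hV, Matrix.mul_add, ← Matrix.mul_assoc, ← Matrix.mul_assoc, e₁, e₂]
    simp only [conjTranspose_add, conjTranspose_mul, Matrix.add_mul, Matrix.mul_add,
      Matrix.smul_mul, Matrix.mul_smul, Matrix.mul_assoc, k11, k22, k12, k21, Matrix.mul_zero,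
      add_zero, zero_add]
  have hVY : Vᴴ * cfc f Y * V = cfc f Z := by
    rw [Matrix.mul_assoc, cfc_intertwine f hY.isHermitian hZ.isHermitian hYV, ← Matrix.mul_assoc,
      hVV, Matrix.one_mul]
  have hXY := (hf₂.posSemidef_cfc_sub hX hY hYX).conjTranspose_mul_mul_same V
  rw [Matrix.mul_sub, Matrix.sub_mul, hVX, hVY] at hXY
  have hVXV : Vᴴ * X * V = Kᴴ * B * K + δ • (Dᴴ * D) := by
    rw [Matrix.mul_smul, Matrix.mul_one] at hXV₂
    rw [Matrix.mul_assoc, hV, Matrix.mul_add, ← Matrix.mul_assoc, ← Matrix.mul_assoc, hXV₁, hXV₂]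
    simp only [conjTranspose_add, conjTranspose_mul, Matrix.add_mul, Matrix.mul_add,
      Matrix.smul_mul, Matrix.mul_smul, Matrix.mul_assoc, k11, k22, k12, k21, Matrix.mul_zero,
      add_zero, zero_add]
  have hAZ : (A - Z).PosSemidef := by
    have : A - Z = (A - Kᴴ * B * K - η • 1) + (η / 2 - δ) • 1 + δ • (Kᴴ * K) := by
      rw [hZdef, hVXV, hD]
      module
    rw [this]
    exact (hAB.add (posSemidef_smul_one (sub_nonneg.2 hδη))).add
      ((posSemidef_conjTranspose_mul_self K).smul hδ0.le)
  have hfin := ((hf.posSemidef_cfc_sub hZ hA hAZ).add hXY).add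
    ((posSemidef_conjTranspose_mul_self D).smul (hpos δ hδ0).le)
  convert hfin using 1
  abel

/-- For an operator monotone `f : (0,∞) → (0,∞)`, the function `t ↦ f t / t` is operator
antitone. -/
lemma cfc_div_id_sub_posSemidef {n : ℕ} {f : ℝ → ℝ} (hpos : ∀ t ∈ Ioi (0 : ℝ), 0 < f t)
    (hf : MatMonoOn n (Ioi 0) f) (hf₂ : MatMonoOn (n + n) (Ioi 0) f)
    {A B : Matrix (Fin n) (Fin n) ℂ} (hA : A.PosDef) (hB : B.PosDef) (hAB : (B - A).PosSemidef) :
    (cfc (fun t => f t / t) A - cfc (fun t => f t / t) B).PosSemidef := by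
  obtain ⟨a, ha0, ha⟩ := hA.exists_sub_smul_one_posSemidef
  set R := cfc Real.sqrt A
  set T := cfc (fun t => (√t)⁻¹) A
  set S := cfc (fun t => (√t)⁻¹) B
  have hRh : Rᴴ = R := isHermitian_cfc _ _
  have hTh : Tᴴ = T := isHermitian_cfc _ _
  have hSh : Sᴴ = S := isHermitian_cfc _ _
  have hRR : R * R = A := hA.cfc_sqrt_mul_self
  have hRT : R * T = 1 := hA.cfc_sqrt_mul_cfc_inv_sqrt
  have hTR : T * R = 1 := mul_eq_one_comm.1 hRT
  have hK : (1 - (S * R)ᴴ * (S * R)).PosSemidef := by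
    have := (hA.inv_sub_inv_posSemidef hB hAB).conjTranspose_mul_mul_same R
    have hRAR : R * A⁻¹ * R = 1 := by
      rw [← hRR, Matrix.mul_inv_rev, Matrix.inv_eq_right_inv hRT, ← mul_assoc, hRT, one_mul, hTR]
    rw [hRh, mul_sub, sub_mul, hRAR, ← hB.cfc_inv_sqrt_mul_self] at this
    simpa only [conjTranspose_mul, hRh, hSh, mul_assoc] using this
  have hKB : (S * R)ᴴ * B * (S * R) = A := by
    rw [conjTranspose_mul, hRh, hSh]
    calc R * S * B * (S * R) = R * (S * B * S) * R := by noncomm_ring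
      _ = A := by rw [hB.cfc_inv_sqrt_conj, mul_one, hRR]
  refine posSemidef_of_forall_sub_smul (isHermitian_cfc _ _) (isHermitian_cfc _ _)
    fun s hs0 hs1 => ?_
  have hK' : (√s • (S * R))ᴴ * (√s • (S * R)) = s • ((S * R)ᴴ * (S * R)) := by
    simp [smul_smul, Real.mul_self_sqrt hs0.le]
  have hKM : ∀ M, (√s • (S * R))ᴴ * M * (√s • (S * R)) = s • ((S * R)ᴴ * M * (S * R)) := by
    simp [smul_smul, Real.mul_self_sqrt hs0.le]
  have hansen := hf.hansen (K := √s • (S * R)) (η := (1 - s) * a) hpos hf₂ hA hB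
    (by
      rw [hK']
      convert (posSemidef_smul_one (sub_nonneg.2 hs1.le)).add (hK.smul hs0.le) using 1
      module)
    (mul_pos (sub_pos.2 hs1) ha0)
    (by
      rw [hKM, hKB]
      convert ha.smul (sub_nonneg.2 hs1.le) using 1
      module)
  convert hansen.conjTranspose_mul_mul_same T using 1
  rw [hKM, hTh, mul_sub, sub_mul, hA.cfc_inv_sqrt_mul_cfc_mul, mul_smul_comm, smul_mul_assoc,
    ← hB.cfc_inv_sqrt_mul_cfc_mul, conjTranspose_mul, hRh, hSh]
  congr 2
  calc S * cfc f B * S = (T * R) * (S * cfc f B * S) * (R * T) := by rw [hTR, hRT, one_mul, mul_one]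
    _ = _ := by noncomm_ring

theorem stmt13 (f : ℝ → ℝ) (hpos : ∀ t ∈ Ioi (0:ℝ), 0 < f t)
    (hf : ∀ n, MatMonoOn n (Ioi 0) f) :
    ∀ n, MatMonoOn n (Ioi 0) (fun t => t / f t) := by
  intro n A B hAh hBh hAe hBe hAB
  have hA : A.PosDef := hAh.posDef_iff_eigenvalues_pos.2 hAe
  have hB : B.PosDef := hBh.posDef_iff_eigenvalues_pos.2 hBe
  have hdiv : ∀ t, 0 < t → 0 < f t / t := fun t ht => div_pos (hpos t ht) ht
  rw [← hAh.cfc_eq, ← hBh.cfc_eq]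
  have := (hB.posDef_cfc hdiv).inv_sub_inv_posSemidef (hA.posDef_cfc hdiv)
    (cfc_div_id_sub_posSemidef hpos (hf n) (hf (n + n)) hA hB hAB)
  simpa only [hA.inv_cfc hdiv, hB.inv_cfc hdiv, inv_div] using this

end
end

section
/- Let f : (0,∞) → ℝ be a non-constant operator monotone function. Then f'(1) > 0 and the function (Tf)(t) = (t/f'(1))·(f(t) − f(1))/(t − 1) for t ≠ 1, (Tf)(1) = 1, is a positive operator monotone function on (0,∞) with (Tf)(1) = 1, and f(t) = f(1) + f'(1)·((t−1)/t)·(Tf)(t) for all t > 0. -/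
open Matrix Set
open scoped ComplexOrder

noncomputable section

/-! ### Functional calculus of Hermitian matrices through an arbitrary diagonalization -/

section MatrixCalculus

variable {n : ℕ}

/-- The matrix `U * diagonal d * Uᴴ` with real diagonal `d`. -/
def conjDiag (U : Matrix (Fin n) (Fin n) ℂ) (d : Fin n → ℝ) : Matrix (Fin n) (Fin n) ℂ :=
  U * diagonal (fun i => (d i : ℂ)) * Uᴴ

lemma conjDiag_isHermitian (U : Matrix (Fin n) (Fin n) ℂ) (d : Fin n → ℝ) :
    (conjDiag U d).IsHermitian := by
  unfold conjDiag
  refine isHermitian_mul_mul_conjTranspose _ ?_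
  rw [IsHermitian, diagonal_conjTranspose]
  congr 1
  ext i
  simp

lemma conjDiag_quadForm (U : Matrix (Fin n) (Fin n) ℂ) (d : Fin n → ℝ) (x : Fin n → ℂ) :
    star x ⬝ᵥ (conjDiag U d *ᵥ x) = ((∑ i, d i * ‖(Uᴴ *ᵥ x) i‖ ^ 2 : ℝ) : ℂ) := by
  have h : conjDiag U d *ᵥ x = U *ᵥ (diagonal (fun i => (d i : ℂ)) *ᵥ (Uᴴ *ᵥ x)) := by
    simp [conjDiag, mulVec_mulVec, Matrix.mul_assoc]
  rw [h, dotProduct_mulVec, ← conjTranspose_conjTranspose U, ← star_mulVec,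
    conjTranspose_conjTranspose]
  simp only [dotProduct, mulVec_diagonal, Pi.star_apply, RCLike.star_def]
  push_cast
  refine Finset.sum_congr rfl fun i _ => ?_
  rw [← Complex.conj_mul']
  ring

lemma conjDiag_mul {U : Matrix (Fin n) (Fin n) ℂ} (hU : Uᴴ * U = 1) (d e : Fin n → ℝ) :
    conjDiag U d * conjDiag U e = conjDiag U (fun i => d i * e i) := by
  have h : conjDiag U d * conjDiag U e = U * diagonal (fun i => (d i : ℂ)) * (Uᴴ * U) *
      (diagonal (fun i => (e i : ℂ)) * Uᴴ) := by
    simp only [conjDiag, Matrix.mul_assoc]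
  rw [h, hU, Matrix.mul_one, Matrix.mul_assoc, ← Matrix.mul_assoc (diagonal _), diagonal_mul_diagonal]
  simp [conjDiag, Matrix.mul_assoc]

lemma conjDiag_add_const {U : Matrix (Fin n) (Fin n) ℂ} (hU : Uᴴ * U = 1) (d : Fin n → ℝ) (c : ℝ) :
    conjDiag U (fun i => d i + c) = conjDiag U d + (c : ℂ) • 1 := by
  have h : diagonal (fun i => ((d i + c : ℝ) : ℂ))
      = diagonal (fun i => (d i : ℂ)) + (c : ℂ) • (1 : Matrix (Fin n) (Fin n) ℂ) := by
    ext i j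
    by_cases hij : i = j
    · subst hij; simp
    · simp [hij]
  rw [conjDiag, h, Matrix.mul_add, Matrix.add_mul]
  simp [conjDiag, mul_eq_one_comm.mp hU]

lemma conjDiag_congr {U V : Matrix (Fin n) (Fin n) ℂ} (hU : Uᴴ * U = 1) (hV : Vᴴ * V = 1)
    {b e : Fin n → ℝ} (h : conjDiag V e = conjDiag U b) :
    (∀ i, ∃ j, e i = b j) ∧
      ∀ f : ℝ → ℝ, conjDiag V (fun i => f (e i)) = conjDiag U (fun i => f (b i)) := by
  have hU' : U * Uᴴ = 1 := mul_eq_one_comm.mp hU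
  have hV' : V * Vᴴ = 1 := mul_eq_one_comm.mp hV
  have key : ∀ {e b : Fin n → ℝ}, conjDiag V e = conjDiag U b ↔
      ∀ i j, (e i : ℂ) * (Vᴴ * U) i j = (Vᴴ * U) i j * (b j : ℂ) := by
    intro e b
    have : conjDiag V e = conjDiag U b ↔
        diagonal (fun i => (e i : ℂ)) * (Vᴴ * U) = (Vᴴ * U) * diagonal (fun i => (b i : ℂ)) := by
      unfold conjDiag
      constructor
      · intro h
        have h2 := congrArg (fun M => Vᴴ * M * U) h
        simp only [Matrix.mul_assoc] at h2
        rw [hU, Matrix.mul_one, ← Matrix.mul_assoc, hV, Matrix.one_mul] at h2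
        rw [h2, Matrix.mul_assoc]
      · intro h
        have h2 := congrArg (fun M => V * M * Uᴴ) h
        simp only [Matrix.mul_assoc] at h2
        rw [hU', Matrix.mul_one, ← Matrix.mul_assoc V Vᴴ, hV', Matrix.one_mul] at h2
        rw [Matrix.mul_assoc, h2, Matrix.mul_assoc]
    rw [this]
    constructor
    · intro h i j
      have := congrFun (congrFun h i) j
      simpa [diagonal_mul, mul_diagonal] using this
    · intro h
      ext i j
      simpa [diagonal_mul, mul_diagonal] using h i j
  rw [key] at h
  have h' : ∀ i j, (Vᴴ * U) i j = 0 ∨ e i = b j := by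
    intro i j
    by_cases h0 : (Vᴴ * U) i j = 0
    · exact Or.inl h0
    · right
      have := h i j
      rw [mul_comm] at this
      exact_mod_cast mul_left_cancel₀ h0 this
  refine ⟨fun i => ?_, fun f => key.2 fun i j => ?_⟩
  · by_contra! hne
    have h0 : ∀ j, (Vᴴ * U) i j = 0 := fun j => (h' i j).resolve_right (hne j)
    have h1 : (Vᴴ * U) * (Uᴴ * V) = 1 := by
      rw [Matrix.mul_assoc, ← Matrix.mul_assoc U, hU', Matrix.one_mul, hV]
    have := congrFun (congrFun h1 i) i
    rw [Matrix.mul_apply] at this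
    simp [h0] at this
  · rcases h' i j with h0 | h0
    · simp [h0]
    · rw [h0, mul_comm]

lemma exists_conjDiag {A : Matrix (Fin n) (Fin n) ℂ} (hA : A.IsHermitian) :
    ∃ V : Matrix (Fin n) (Fin n) ℂ, Vᴴ * V = 1 ∧ A = conjDiag V hA.eigenvalues ∧
      ∀ f : ℝ → ℝ, hA.cfc f = conjDiag V (fun i => f (hA.eigenvalues i)) := by
  refine ⟨hA.eigenvectorUnitary, ?_, ?_, fun f => ?_⟩
  · exact Unitary.coe_star_mul_self hA.eigenvectorUnitary
  · conv_lhs => rw [hA.spectral_theorem]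
    rfl
  · rfl

/-- Matrix monotonicity for matrices given in diagonalized form. -/
lemma MatMonoOn.conjDiag_sub {I : Set ℝ} {f : ℝ → ℝ} (hf : MatMonoOn n I f)
    {U V : Matrix (Fin n) (Fin n) ℂ} (hU : Uᴴ * U = 1) (hV : Vᴴ * V = 1)
    {a b : Fin n → ℝ} (ha : ∀ i, a i ∈ I) (hb : ∀ i, b i ∈ I)
    (h : (conjDiag V b - conjDiag U a).PosSemidef) :
    (conjDiag V (fun i => f (b i)) - conjDiag U (fun i => f (a i))).PosSemidef := by
  have main : ∀ {W : Matrix (Fin n) (Fin n) ℂ} (_ : Wᴴ * W = 1) {d : Fin n → ℝ}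
      (_ : ∀ i, d i ∈ I), (∀ i, (conjDiag_isHermitian W d).eigenvalues i ∈ I) ∧
        (conjDiag_isHermitian W d).cfc f = conjDiag W (fun i => f (d i)) := by
    intro W hW d hd
    obtain ⟨Z, hZ, hZ1, hZ2⟩ := exists_conjDiag (conjDiag_isHermitian W d)
    obtain ⟨h1, h2⟩ := conjDiag_congr hW hZ hZ1.symm
    refine ⟨fun i => ?_, ?_⟩
    · obtain ⟨j, hj⟩ := h1 i
      rw [hj]
      exact hd j
    · rw [hZ2, h2]
  have := hf _ _ (conjDiag_isHermitian U a) (conjDiag_isHermitian V b)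
    (main hU ha).1 (main hV hb).1 h
  rwa [(main hU ha).2, (main hV hb).2] at this

/-- Inversion is antitone on positive semidefinite matrices; the inverses are given by
explicit matrices. -/
lemma posSemidef_inverse_sub {A B A' B' : Matrix (Fin n) (Fin n) ℂ} (hA : A.PosSemidef)
    (hA' : A'.IsHermitian) (hB' : B'.IsHermitian) (hAA' : A * A' = 1) (hBB' : B * B' = 1)
    (h : (B - A).PosSemidef) : (A' - B').PosSemidef := by
  have hA'A : A' * A = 1 := mul_eq_one_comm.mp hAA'
  have hB'B : B' * B = 1 := mul_eq_one_comm.mp hBB'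
  have e : A' - B' = (A' - B')ᴴ * A * (A' - B') + B'ᴴ * (B - A) * B' := by
    rw [conjTranspose_sub, hA'.eq, hB'.eq]
    simp only [Matrix.sub_mul, Matrix.mul_sub, Matrix.mul_assoc, hAA', hBB', Matrix.mul_one]
    rw [← Matrix.mul_assoc A' A, hA'A, Matrix.one_mul]
    abel
  rw [e]
  exact (hA.conjTranspose_mul_mul_same _).add (h.conjTranspose_mul_mul_same _)

/-- The functions `t ↦ t / (t + l)` with `0 ≤ l` are operator monotone. -/
lemma sum_div_add_le_of_posSemidef_sub {U V : Matrix (Fin n) (Fin n) ℂ} (hU : Uᴴ * U = 1)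
    (hV : Vᴴ * V = 1) {a b : Fin n → ℝ} (ha : ∀ i, 0 < a i) (hb : ∀ i, 0 < b i)
    (h : (conjDiag V b - conjDiag U a).PosSemidef) {l : ℝ} (hl : 0 ≤ l) (x : Fin n → ℂ) :
    ∑ i, a i / (a i + l) * ‖(Uᴴ *ᵥ x) i‖ ^ 2 ≤ ∑ i, b i / (b i + l) * ‖(Vᴴ *ᵥ x) i‖ ^ 2 := by
  have hone : ∀ {W : Matrix (Fin n) (Fin n) ℂ}, Wᴴ * W = 1 →
      conjDiag W (fun _ => 1) = 1 := by
    intro W hW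
    simp [conjDiag, mul_eq_one_comm.mp hW]
  have hinv : ∀ {W : Matrix (Fin n) (Fin n) ℂ} (_ : Wᴴ * W = 1) {d : Fin n → ℝ}
      (_ : ∀ i, 0 < d i),
      conjDiag W (fun i => d i + l) * conjDiag W (fun i => (d i + l)⁻¹) = 1 := by
    intro W hW d hd
    rw [conjDiag_mul hW, ← hone hW]
    congr 1
    ext i
    have := hd i
    field_simp
  have hpos : (conjDiag U (fun i => a i + l)).PosSemidef := by
    refine PosSemidef.of_dotProduct_mulVec_nonneg (conjDiag_isHermitian _ _) fun x => ?_
    rw [conjDiag_quadForm]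
    have : 0 ≤ ∑ i, (a i + l) * ‖(Uᴴ *ᵥ x) i‖ ^ 2 :=
      Finset.sum_nonneg fun i _ => mul_nonneg (add_nonneg (ha i).le hl) (sq_nonneg _)
    exact_mod_cast this
  have h2 := posSemidef_inverse_sub hpos (conjDiag_isHermitian U _) (conjDiag_isHermitian V _)
    (hinv hU ha) (hinv hV hb)
    (by rwa [conjDiag_add_const hU, conjDiag_add_const hV, add_sub_add_right_eq_sub])
  have h3 := h2.dotProduct_mulVec_nonneg x
  rw [sub_mulVec, dotProduct_sub, conjDiag_quadForm, conjDiag_quadForm] at h3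
  have h4 : ∑ i, (b i + l)⁻¹ * ‖(Vᴴ *ᵥ x) i‖ ^ 2 ≤ ∑ i, (a i + l)⁻¹ * ‖(Uᴴ *ᵥ x) i‖ ^ 2 := by
    rw [← sub_nonneg]
    exact_mod_cast h3
  have h5 : ∑ i, 1 * ‖(Uᴴ *ᵥ x) i‖ ^ 2 = ∑ i, 1 * ‖(Vᴴ *ᵥ x) i‖ ^ 2 := by
    have := (conjDiag_quadForm U (fun _ => 1) x).symm.trans
      ((by rw [hone hU, hone hV] : _ = _).trans (conjDiag_quadForm V (fun _ => 1) x))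
    exact_mod_cast this
  have h6 : ∀ {d : Fin n → ℝ} (_ : ∀ i, 0 < d i) (y : Fin n → ℂ),
      ∑ i, d i / (d i + l) * ‖y i‖ ^ 2
        = ∑ i, 1 * ‖y i‖ ^ 2 - l * ∑ i, (d i + l)⁻¹ * ‖y i‖ ^ 2 := by
    intro d hd y
    rw [Finset.mul_sum, ← Finset.sum_sub_distrib]
    refine Finset.sum_congr rfl fun i _ => ?_
    have := hd i
    field_simp
    ring
  rw [h6 ha, h6 hb, h5]
  linarith [mul_le_mul_of_nonneg_left h4 hl]

end MatrixCalculus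

/-! ### Divided differences of operator monotone functions -/

section DividedDifference

open Polynomial Lagrange

lemma sum_nodalWeight_mul_eval (S : Finset ℝ) {P : ℝ[X]} (hP : P.degree < S.card) :
    ∑ p ∈ S, nodalWeight S id p * P.eval p = P.coeff (S.card - 1) := by
  rw [coeff_eq_sum (v := id) Function.injective_id.injOn hP]
  refine Finset.sum_congr rfl fun p _ => ?_
  simp [nodalWeight, div_eq_mul_inv, mul_comm]

/-- The number of nodes with weights of a given sign is at least half of the number of nodes. -/
lemma le_card_filter_nodalWeight {S : Finset ℝ} {m : ℕ} (hS : S.card = 2 * m) {s : ℝ}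
    (hs : s ≠ 0) : m ≤ (S.filter fun p => 0 < s * nodalWeight S id p).card := by
  set A := S.filter fun p => 0 < s * nodalWeight S id p with hA
  by_contra! hlt
  have hdeg : ((nodal A id) ^ 2).natDegree = 2 * A.card := by
    rw [natDegree_pow, natDegree_nodal]
  have h1 := sum_nodalWeight_mul_eval S (P := (nodal A id) ^ 2) (by
    refine degree_le_natDegree.trans_lt ?_
    rw [hdeg]
    exact_mod_cast (by omega))
  rw [coeff_eq_zero_of_natDegree_lt (by omega)] at h1
  have h2 : ∀ p ∈ S, s * (nodalWeight S id p * ((nodal A id) ^ 2).eval p) ≤ 0 := by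
    intro p hp
    by_cases hpA : p ∈ A
    · have : (nodal A id).eval p = 0 := eval_nodal_at_node (v := id) hpA
      simp [this]
    · have : s * nodalWeight S id p ≤ 0 := by
        by_contra! h
        exact hpA (Finset.mem_filter.2 ⟨hp, h⟩)
      rw [← mul_assoc, eval_pow]
      exact mul_nonpos_of_nonpos_of_nonneg this (sq_nonneg _)
  have h3 : ∑ p ∈ S, s * (nodalWeight S id p * ((nodal A id) ^ 2).eval p) = 0 := by
    rw [← Finset.mul_sum, h1, mul_zero]
  have h4 := (Finset.sum_eq_zero_iff_of_nonpos h2).1 h3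
  obtain ⟨p, hpS, hpA⟩ : ∃ p ∈ S, p ∉ A := by
    by_contra! h
    have := Finset.card_le_card (s := S) (t := A) h
    omega
  have h5 := h4 p hpS
  have h6 : (nodal A id).eval p ≠ 0 := by
    refine eval_nodal_not_at_node (v := id) fun i hi => ?_
    rintro rfl
    exact hpA hi
  have h7 := nodalWeight_ne_zero (v := id) Function.injective_id.injOn hpS
  rw [eval_pow] at h5
  exact mul_ne_zero hs (mul_ne_zero h7 (pow_ne_zero 2 h6)) h5

/-- If two weighted node systems have the same moments up to order `2 * m - 2` and the moments of
order `2 * m - 1` are ordered, then they are ordered after applying a matrix monotone function. -/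
lemma MatMonoOn.sum_sq_le {m : ℕ} {I : Set ℝ} {f : ℝ → ℝ} (hf : MatMonoOn m I f)
    {a b u v : Fin m → ℝ} (ha : ∀ i, a i ∈ I) (hb : ∀ i, b i ∈ I)
    (hinj : Function.Injective a) (hu : ∀ i, 0 < u i) (hv : ∀ i, 0 ≤ v i) {c : ℝ} (hc : 0 ≤ c)
    (hmom : ∀ k, k ≤ 2 * m - 2 → ∑ i, v i * b i ^ k = ∑ i, u i * a i ^ k)
    (htop : ∑ i, v i * b i ^ (2 * m - 1) = ∑ i, u i * a i ^ (2 * m - 1) + c)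
    {q : ℝ[X]} (hq : q.natDegree < m) :
    ∑ i, u i * q.eval (a i) ^ 2 * f (a i) ≤ ∑ i, v i * q.eval (b i) ^ 2 * f (b i) := by
  let mat : (Fin m → ℝ) → (Fin m → ℝ) → Matrix (Fin m) (Fin m) ℂ := fun w d =>
    Matrix.of fun i k => ((√(w i) * d i ^ (k : ℕ) : ℝ) : ℂ)
  set E := mat u a with hE
  set F := mat v b with hF
  have hgram : ∀ {w : Fin m → ℝ} (_ : ∀ i, 0 ≤ w i) (d e : Fin m → ℝ),
      (mat w d)ᴴ * diagonal (fun i => (e i : ℂ)) * mat w d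
        = Matrix.of fun k l : Fin m => ((∑ i, w i * d i ^ ((k : ℕ) + l) * e i : ℝ) : ℂ) := by
    intro w hw d e
    ext k l
    rw [Matrix.mul_apply]
    simp only [mul_diagonal, mat, conjTranspose_apply, Matrix.of_apply, RCLike.star_def,
      Complex.conj_ofReal]
    norm_cast
    refine Finset.sum_congr rfl fun i _ => ?_
    have := Real.mul_self_sqrt (hw i)
    calc √(w i) * d i ^ (k : ℕ) * e i * (√(w i) * d i ^ (l : ℕ))
        = (√(w i) * √(w i)) * d i ^ ((k : ℕ) + l) * e i := by rw [pow_add]; ring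
      _ = _ := by rw [this]
  have hgram1 : ∀ {w : Fin m → ℝ} (_ : ∀ i, 0 ≤ w i) (d : Fin m → ℝ),
      (mat w d)ᴴ * mat w d
        = Matrix.of fun k l : Fin m => ((∑ i, w i * d i ^ ((k : ℕ) + l) : ℝ) : ℂ) := by
    intro w hw d
    simpa using hgram hw d (fun _ => 1)
  have hu' : ∀ i, 0 ≤ u i := fun i => (hu i).le
  have hEunit : IsUnit E.det := by
    have : E = diagonal (fun i => ((√(u i) : ℝ) : ℂ)) * vandermonde (fun i => (a i : ℂ)) := by
      ext i k
      simp [hE, mat, diagonal_mul, vandermonde_apply]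
    rw [this, det_mul, det_diagonal, isUnit_iff_ne_zero]
    refine mul_ne_zero (Finset.prod_ne_zero_iff.2 fun i _ => ?_) ?_
    · exact_mod_cast (Real.sqrt_pos.2 (hu i)).ne'
    · rw [det_vandermonde_ne_zero_iff]
      exact fun i j hij => hinj (Complex.ofReal_injective hij)
  have hEF : Fᴴ * F = Eᴴ * E := by
    rw [hgram1 hu', hgram1 hv]
    ext k l
    simp only [Matrix.of_apply]
    rw [hmom _ (by omega)]
  set V := E * F⁻¹ with hVdef
  have hFunit : IsUnit F.det := by
    have h1 : (Fᴴ * F).det ≠ 0 := by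
      rw [hEF, det_mul, det_conjTranspose]
      exact mul_ne_zero (star_ne_zero.2 hEunit.ne_zero) hEunit.ne_zero
    rw [det_mul] at h1
    exact isUnit_iff_ne_zero.2 (right_ne_zero_of_mul h1)
  have hVF : V * F = E := by
    rw [hVdef, Matrix.mul_assoc, nonsing_inv_mul _ hFunit, Matrix.mul_one]
  have hFV : F = Vᴴ * E := by
    have h1 : Fᴴ * F = Fᴴ * (Vᴴ * E) := by
      rw [hEF, ← Matrix.mul_assoc, ← conjTranspose_mul, hVF]
    have h2 : IsUnit (Fᴴ).det := by
      rw [det_conjTranspose]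
      exact hFunit.star
    have h3 := congrArg (fun M => (Fᴴ)⁻¹ * M) h1
    simpa only [← Matrix.mul_assoc, nonsing_inv_mul _ h2, Matrix.one_mul] using h3
  have hVV : Vᴴ * V = 1 := by
    have h1 : Vᴴ * V * F = F := by rw [Matrix.mul_assoc, hVF, ← hFV]
    have h3 := congrArg (fun M => M * F⁻¹) h1
    simpa only [Matrix.mul_assoc, mul_nonsing_inv _ hFunit, Matrix.mul_one] using h3
  have hform : ∀ (d e : Fin m → ℝ), Eᴴ * (conjDiag V e - conjDiag 1 d) * E
      = Fᴴ * diagonal (fun i => (e i : ℂ)) * F - Eᴴ * diagonal (fun i => (d i : ℂ)) * E := by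
    intro d e
    rw [hFV, conjTranspose_mul, conjTranspose_conjTranspose]
    simp only [conjDiag, Matrix.mul_sub, Matrix.sub_mul, Matrix.mul_assoc, Matrix.one_mul,
      Matrix.mul_one, conjTranspose_one]
  have hpsd : (conjDiag V b - conjDiag 1 a).PosSemidef := by
    rw [← (E.isUnit_iff_isUnit_det.2 hEunit).posSemidef_star_left_conjugate_iff,
      star_eq_conjTranspose, hform, hgram hu', hgram hv]
    have : (Matrix.of fun k l : Fin m => ((∑ i, v i * b i ^ ((k : ℕ) + l) * b i : ℝ) : ℂ))
        - (Matrix.of fun k l : Fin m => ((∑ i, u i * a i ^ ((k : ℕ) + l) * a i : ℝ) : ℂ))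
        = diagonal fun k : Fin m => ((if (k : ℕ) = m - 1 then c else 0 : ℝ) : ℂ) := by
      ext k l
      simp only [Matrix.sub_apply, Matrix.of_apply, mul_assoc, ← pow_succ]
      have hk := k.2
      have hl := l.2
      by_cases h1 : (k : ℕ) = m - 1 ∧ (l : ℕ) = m - 1
      · have : k = l := Fin.ext (by omega)
        subst this
        have h2 : (k : ℕ) + k + 1 = 2 * m - 1 := by omega
        rw [h2, htop, diagonal_apply_eq, if_pos h1.1]
        push_cast
        ring
      · rw [hmom _ (by omega), sub_self]
        by_cases h2 : k = l
        · subst h2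
          rw [diagonal_apply_eq, if_neg (by tauto)]
          simp
        · rw [diagonal_apply_ne _ h2]
    rw [this]
    refine PosSemidef.diagonal fun k => ?_
    have : (0 : ℝ) ≤ if (k : ℕ) = m - 1 then c else 0 := by split_ifs <;> simp [hc]
    exact Complex.zero_le_real.2 this
  have hone : (1 : Matrix (Fin m) (Fin m) ℂ)ᴴ * 1 = 1 := by simp
  have hfin := (hf.conjDiag_sub hone hVV ha hb hpsd).conjTranspose_mul_mul_same E
  rw [hform] at hfin
  have hx := hfin.dotProduct_mulVec_nonneg (fun k => (q.coeff k : ℂ))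
  have heval : ∀ (w d : Fin m → ℝ) (i : Fin m),
      (mat w d *ᵥ fun k => (q.coeff k : ℂ)) i = ((√(w i) * q.eval (d i) : ℝ) : ℂ) := by
    intro w d i
    simp only [mulVec, dotProduct, mat, Matrix.of_apply]
    norm_cast
    rw [eval_eq_sum_range' hq, Finset.mul_sum, ← Fin.sum_univ_eq_sum_range
      (fun k => √(w i) * (q.coeff k * d i ^ k)) m]
    exact Finset.sum_congr rfl fun k _ => by ring
  have hquad : ∀ {w : Fin m → ℝ} (_ : ∀ i, 0 ≤ w i) (d e : Fin m → ℝ),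
      star (fun k : Fin m => (q.coeff k : ℂ)) ⬝ᵥ
        (((mat w d)ᴴ * diagonal (fun i => (e i : ℂ)) * mat w d) *ᵥ
          fun k : Fin m => (q.coeff k : ℂ))
      = ((∑ i, w i * q.eval (d i) ^ 2 * e i : ℝ) : ℂ) := by
    intro w hw d e
    rw [Matrix.mul_assoc, ← mulVec_mulVec, ← mulVec_mulVec, dotProduct_mulVec, ← star_mulVec]
    simp only [dotProduct, mulVec_diagonal, Pi.star_apply, heval, RCLike.star_def,
      Complex.conj_ofReal]
    norm_cast
    refine Finset.sum_congr rfl fun i _ => ?_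
    have := Real.mul_self_sqrt (hw i)
    calc √(w i) * q.eval (d i) * (e i * (√(w i) * q.eval (d i)))
        = (√(w i) * √(w i)) * q.eval (d i) ^ 2 * e i := by ring
      _ = _ := by rw [this]
  rw [sub_mulVec, dotProduct_sub, hquad hv b, hquad hu' a] at hx
  rw [← sub_nonneg]
  exact_mod_cast hx

/-- Divided differences of `q ^ 2 * f` of odd order are nonnegative. -/
lemma dividedDifference_sq_mul_nonneg {f : ℝ → ℝ} (hf : ∀ n, MatMonoOn n (Ioi 0) f)
    {S : Finset ℝ} {m : ℕ} (hS : S.card = 2 * m) (hpos : ∀ p ∈ S, 0 < p)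
    {q : ℝ[X]} (hq : q.natDegree < m) :
    0 ≤ ∑ p ∈ S, nodalWeight S id p * q.eval p ^ 2 * f p := by
  set w := nodalWeight S id with hw
  set B := S.filter fun p => 0 < w p with hB
  set A := S.filter fun p => ¬ 0 < w p with hA
  have hw0 : ∀ p ∈ S, w p ≠ 0 := fun p hp =>
    nodalWeight_ne_zero (v := id) Function.injective_id.injOn hp
  have hAB : B.card + A.card = 2 * m := by
    rw [hB, hA, Finset.card_filter_add_card_filter_not, hS]
  have hBm : m ≤ B.card := by
    simpa using le_card_filter_nodalWeight hS one_ne_zero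
  have hAm : m ≤ A.card := by
    have h1 := le_card_filter_nodalWeight hS (neg_ne_zero.2 (one_ne_zero (α := ℝ)))
    refine h1.trans (Finset.card_le_card fun p hp => ?_)
    rw [Finset.mem_filter] at hp ⊢
    exact ⟨hp.1, by rw [hw]; linarith [hp.2]⟩
  have hBc : B.card = m := by omega
  have hAc : A.card = m := by omega
  let a : Fin m → ℝ := fun i => (A.equivFinOfCardEq hAc).symm i
  let b : Fin m → ℝ := fun i => (B.equivFinOfCardEq hBc).symm i
  have haA : ∀ i, a i ∈ A := fun i => ((A.equivFinOfCardEq hAc).symm i).2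
  have hbB : ∀ i, b i ∈ B := fun i => ((B.equivFinOfCardEq hBc).symm i).2
  have hsum : ∀ {T : Finset ℝ} (hT : T.card = m) (g : ℝ → ℝ),
      ∑ i, g ((T.equivFinOfCardEq hT).symm i : ℝ) = ∑ p ∈ T, g p := by
    intro T hT g
    rw [← Finset.sum_coe_sort T g]
    exact Equiv.sum_comp (T.equivFinOfCardEq hT).symm (fun p : T => g p)
  have hsplit : ∀ g : ℝ → ℝ, ∑ p ∈ S, w p * g p
      = ∑ i, w (b i) * g (b i) - ∑ i, -w (a i) * g (a i) := by
    intro g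
    rw [hsum hBc (fun p => w p * g p), hsum hAc (fun p => -w p * g p),
      ← Finset.sum_filter_add_sum_filter_not S (fun p => 0 < w p)]
    simp only [neg_mul, Finset.sum_neg_distrib, sub_neg_eq_add]
    rfl
  have hmono := (hf m).sum_sq_le (a := a) (b := b) (u := fun i => -w (a i)) (v := fun i => w (b i))
    (fun i => hpos _ (Finset.mem_filter.1 (haA i)).1)
    (fun i => hpos _ (Finset.mem_filter.1 (hbB i)).1)
    (Subtype.val_injective.comp (A.equivFinOfCardEq hAc).symm.injective)
    (fun i => by
      have h1 := Finset.mem_filter.1 (haA i)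
      have h2 := hw0 _ h1.1
      have h3 := not_lt.1 h1.2
      exact neg_pos.2 (lt_of_le_of_ne h3 h2))
    (fun i => (Finset.mem_filter.1 (hbB i)).2.le) zero_le_one
    (fun k hk => by
      have h1 := sum_nodalWeight_mul_eval S (P := X ^ k)
        (by rw [degree_X_pow, hS]; exact_mod_cast (by omega))
      rw [coeff_X_pow, if_neg (by omega)] at h1
      simp only [eval_pow, eval_X] at h1
      rw [hsplit fun p => p ^ k] at h1
      exact sub_eq_zero.1 h1)
    (by
      have h1 := sum_nodalWeight_mul_eval S (P := X ^ (2 * m - 1))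
        (by rw [degree_X_pow, hS]; exact_mod_cast (by omega))
      rw [coeff_X_pow, if_pos (by omega)] at h1
      simp only [eval_pow, eval_X] at h1
      rw [hsplit fun p => p ^ (2 * m - 1)] at h1
      linarith)
    hq
  have := hsplit fun p => q.eval p ^ 2 * f p
  simp only [← mul_assoc] at this
  rw [this]
  linarith

end DividedDifference

/-! ### Linear functionals on polynomials nonnegative on a half-line -/

section HalfLine

open Polynomial Lagrange Filter Topology

lemma eval_nonneg_of_forall_ne {P : ℝ[X]} {r : ℝ} (h : ∀ x, 0 ≤ x → x ≠ r → 0 ≤ P.eval x)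
    {x : ℝ} (hx : 0 ≤ x) : 0 ≤ P.eval x := by
  by_cases hxr : x = r
  · subst hxr
    have h1 : Tendsto (fun y => P.eval y) (𝓝[>] x) (𝓝 (P.eval x)) :=
      P.continuous.continuousWithinAt
    refine ge_of_tendsto h1 ?_
    filter_upwards [self_mem_nhdsWithin] with y hy
    exact h y (hx.trans (le_of_lt hy)) (ne_of_gt hy)
  · exact h x hx hxr

/-- A positive zero of a polynomial which is nonnegative on `[0, ∞)` has even order. -/
lemma sq_dvd_of_isRoot_of_nonneg {Q : ℝ[X]} (hQ : ∀ x, 0 ≤ x → 0 ≤ Q.eval x) {r : ℝ} (hr : 0 < r)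
    (h0 : Q.IsRoot r) : (X - C r) ^ 2 ∣ Q := by
  obtain ⟨P, rfl⟩ := dvd_iff_isRoot.2 h0
  have h1 : ∀ x, 0 ≤ x → 0 ≤ (x - r) * P.eval x := fun x hx => by simpa using hQ x hx
  have hge : 0 ≤ P.eval r := by
    have h2 : Tendsto (fun y => P.eval y) (𝓝[>] r) (𝓝 (P.eval r)) :=
      P.continuous.continuousWithinAt
    refine ge_of_tendsto h2 ?_
    filter_upwards [self_mem_nhdsWithin] with y hy
    have hy' : r < y := hy
    exact nonneg_of_mul_nonneg_right (h1 y (by linarith)) (by linarith)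
  have hle : P.eval r ≤ 0 := by
    have h2 : Tendsto (fun y => P.eval y) (𝓝[<] r) (𝓝 (P.eval r)) :=
      P.continuous.continuousWithinAt
    refine le_of_tendsto h2 ?_
    filter_upwards [Ioo_mem_nhdsLT hr] with y hy
    have h3 := h1 y hy.1.le
    have h4 : y - r < 0 := by linarith [hy.2]
    nlinarith
  obtain ⟨P₂, rfl⟩ := dvd_iff_isRoot.2 (show P.IsRoot r from le_antisymm hle hge)
  exact ⟨P₂, by ring⟩

/-- A linear functional which is nonnegative on the polynomials `q ^ 2` and `X * q ^ 2` of degree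
at most `D` is nonnegative on all polynomials of degree at most `D` that are nonnegative
on `[0, ∞)`. -/
lemma functional_nonneg_of_nonneg_on_halfLine (D : ℕ) : ∀ (Λ : ℝ[X] →ₗ[ℝ] ℝ)
    (_ : ∀ q : ℝ[X], 2 * q.natDegree ≤ D → 0 ≤ Λ (q ^ 2))
    (_ : ∀ q : ℝ[X], 2 * q.natDegree + 1 ≤ D → 0 ≤ Λ (X * q ^ 2))
    (Q : ℝ[X]) (_ : Q.natDegree ≤ D) (_ : ∀ x, 0 ≤ x → 0 ≤ Q.eval x), 0 ≤ Λ Q := by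
  induction D using Nat.strong_induction_on with
  | _ D ih =>
  intro Λ h1 h2 Q hdeg hQ
  rcases Nat.eq_zero_or_pos Q.natDegree with hd | hd
  · rw [eq_C_of_natDegree_eq_zero hd]
    have hc : 0 ≤ Q.coeff 0 := by
      have := hQ 0 le_rfl
      rwa [← coeff_zero_eq_eval_zero] at this
    have : Λ (C (Q.coeff 0)) = Q.coeff 0 * Λ (1 ^ 2) := by
      rw [← smul_eq_mul, ← map_smul, smul_eq_C_mul, one_pow, mul_one]
    rw [this]
    exact mul_nonneg hc (h1 1 (by simp))
  have hQ0 : Q ≠ 0 := by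
    rintro rfl
    simp at hd
  have hquad : ∀ a b : ℝ, 0 < a ∨ b ≠ 0 → (X - C a) ^ 2 + C (b ^ 2) ∣ Q → 0 ≤ Λ Q := by
    rintro a b - ⟨P, rfl⟩
    have hGdeg : ((X - C a) ^ 2 + C (b ^ 2) : ℝ[X]).natDegree = 2 := by
      rw [natDegree_add_C, natDegree_pow, natDegree_X_sub_C]
    rw [natDegree_mul (left_ne_zero_of_mul hQ0) (right_ne_zero_of_mul hQ0), hGdeg] at hdeg
    have hP : ∀ x, 0 ≤ x → 0 ≤ P.eval x := by
      intro x hx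
      refine eval_nonneg_of_forall_ne (r := a) (fun x hx hxa => ?_) hx
      have h3 := hQ x hx
      simp only [eval_mul, eval_add, eval_pow, eval_sub, eval_X, eval_C] at h3
      have h4 : 0 < (x - a) ^ 2 := by
        have := sub_ne_zero.2 hxa
        positivity
      exact nonneg_of_mul_nonneg_right h3 (by positivity)
    have hlin : ∀ q : ℝ[X], ((X - C a) * q).natDegree ≤ q.natDegree + 1 := fun q => by
      refine natDegree_mul_le.trans ?_
      rw [natDegree_X_sub_C, add_comm]
    have := ih (D - 2) (by omega)
      (Λ.comp (LinearMap.mulLeft ℝ ((X - C a) ^ 2 + C (b ^ 2)))) (fun q hq => ?_)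
      (fun q hq => ?_) P (by omega) hP
    · simpa using this
    · have e : ((X - C a) ^ 2 + C (b ^ 2)) * q ^ 2 = ((X - C a) * q) ^ 2 + b ^ 2 • q ^ 2 := by
        rw [smul_eq_C_mul]; ring
      rw [LinearMap.comp_apply, LinearMap.mulLeft_apply, e, map_add, map_smul, smul_eq_mul]
      have := hlin q
      exact add_nonneg (h1 _ (by omega)) (mul_nonneg (sq_nonneg b) (h1 q (by omega)))
    · have e : ((X - C a) ^ 2 + C (b ^ 2)) * (X * q ^ 2)
          = X * ((X - C a) * q) ^ 2 + b ^ 2 • (X * q ^ 2) := by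
        rw [smul_eq_C_mul]; ring
      rw [LinearMap.comp_apply, LinearMap.mulLeft_apply, e, map_add, map_smul, smul_eq_mul]
      have := hlin q
      exact add_nonneg (h2 _ (by omega)) (mul_nonneg (sq_nonneg b) (h2 q (by omega)))
  obtain ⟨z, hz⟩ := Complex.exists_root (f := Q.map (algebraMap ℝ ℂ))
    (by rw [degree_map]; exact natDegree_pos_iff_degree_pos.1 hd)
  have hz' : aeval z Q = 0 := by
    rw [IsRoot, eval_map_algebraMap] at hz
    exact hz
  by_cases him : z.im = 0
  · have hroot : Q.IsRoot z.re := by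
      have : z = algebraMap ℝ ℂ z.re := Complex.ext rfl (by simpa using him)
      rw [this, aeval_algebraMap_apply] at hz'
      have := (algebraMap ℝ ℂ).injective (hz'.trans (map_zero _).symm)
      simpa using this
    rcases le_or_gt z.re 0 with hr | hr
    · obtain ⟨P, rfl⟩ := dvd_iff_isRoot.2 hroot
      rw [natDegree_mul (left_ne_zero_of_mul hQ0) (right_ne_zero_of_mul hQ0),
        natDegree_X_sub_C] at hdeg
      have hP : ∀ x, 0 ≤ x → 0 ≤ P.eval x := by
        intro x hx
        refine eval_nonneg_of_forall_ne (r := z.re) (fun x hx hxa => ?_) hx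
        have h3 := hQ x hx
        simp only [eval_mul, eval_sub, eval_X, eval_C] at h3
        have h4 : z.re < x := lt_of_le_of_ne (hr.trans hx) (Ne.symm hxa)
        exact nonneg_of_mul_nonneg_right h3 (by linarith)
      have hX : ∀ q : ℝ[X], (X * q).natDegree ≤ q.natDegree + 1 := fun q => by
        refine natDegree_mul_le.trans ?_
        rw [natDegree_X, add_comm]
      have := ih (D - 1) (by omega) (Λ.comp (LinearMap.mulLeft ℝ (X - C z.re)))
        (fun q hq => ?_) (fun q hq => ?_) P (by omega) hP
      · simpa using this
      · have e : (X - C z.re) * q ^ 2 = X * q ^ 2 + (-z.re) • q ^ 2 := by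
          rw [smul_eq_C_mul, C_neg]; ring
        rw [LinearMap.comp_apply, LinearMap.mulLeft_apply, e, map_add, map_smul, smul_eq_mul]
        exact add_nonneg (h2 _ (by omega)) (mul_nonneg (by linarith) (h1 q (by omega)))
      · have e : (X - C z.re) * (X * q ^ 2) = (X * q) ^ 2 + (-z.re) • (X * q ^ 2) := by
          rw [smul_eq_C_mul, C_neg]; ring
        rw [LinearMap.comp_apply, LinearMap.mulLeft_apply, e, map_add, map_smul, smul_eq_mul]
        have := hX q
        exact add_nonneg (h1 _ (by omega)) (mul_nonneg (by linarith) (h2 q (by omega)))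
    · refine hquad z.re 0 (Or.inl hr) ?_
      simpa using sq_dvd_of_isRoot_of_nonneg hQ hr hroot
  · refine hquad z.re z.im (Or.inr him) ?_
    convert quadratic_dvd_of_aeval_eq_zero_im_ne_zero Q hz' him using 1
    rw [← Complex.normSq_eq_norm_sq, Complex.normSq_apply]
    simp only [C_add, C_mul, C_pow, map_ofNat]
    ring

/-- Divided differences of odd order of `-p * q ^ 2 * f` are nonnegative. -/
lemma dividedDifference_neg_mul_sq_mul_nonneg {f : ℝ → ℝ} (hf : ∀ n, MatMonoOn n (Ioi 0) f)
    {S : Finset ℝ} {m : ℕ} (hS : S.card = 2 * m) (hpos : ∀ p ∈ S, 0 < p)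
    {q : ℝ[X]} (hq : q.natDegree + 1 < m) :
    0 ≤ ∑ p ∈ S, nodalWeight S id p * (-p * q.eval p ^ 2) * f p := by
  have hlim : Tendsto (fun δ : ℝ => ∑ p ∈ S,
      nodalWeight S id p * ((p - δ) * (p * δ - 1) * q.eval p ^ 2) * f p) (𝓝[>] 0)
      (𝓝 (∑ p ∈ S, nodalWeight S id p * (-p * q.eval p ^ 2) * f p)) := by
    have hc : Continuous (fun δ : ℝ => ∑ p ∈ S,
        nodalWeight S id p * ((p - δ) * (p * δ - 1) * q.eval p ^ 2) * f p) := by fun_prop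
    have h0 : Tendsto _ _ _ := hc.continuousWithinAt (s := Ioi (0 : ℝ)) (x := 0)
    simpa using h0
  have hsmall : ∀ p, 0 < p → ∀ᶠ δ in 𝓝[>] (0 : ℝ), δ < p := fun p hp =>
    Filter.mem_of_superset (Ioo_mem_nhdsGT hp) fun _ h => h.2
  refine ge_of_tendsto hlim ?_
  have hS1 : ∀ᶠ δ in 𝓝[>] (0 : ℝ), ∀ p ∈ S, δ < p ∧ δ < p⁻¹ := by
    rw [Filter.eventually_all_finset]
    exact fun p hp => (hsmall p (hpos p hp)).and (hsmall _ (inv_pos.2 (hpos p hp)))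
  filter_upwards [hS1, hsmall 1 one_pos, self_mem_nhdsWithin] with δ h1 hδ1 hδ0
  have hδ0 : 0 < δ := hδ0
  have hM : 1 < δ⁻¹ := (one_lt_inv₀ hδ0).2 hδ1
  have hlt : ∀ p ∈ S, p < δ⁻¹ := fun p hp => (lt_inv_comm₀ hδ0 (hpos p hp)).1 (h1 p hp).2
  have hMS : δ⁻¹ ∉ S := fun h => lt_irrefl _ (hlt _ h)
  have hδS : δ ∉ insert δ⁻¹ S := by
    rw [Finset.mem_insert, not_or]
    exact ⟨by linarith, fun h => lt_irrefl _ (h1 _ h).1⟩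
  set T := insert δ (insert δ⁻¹ S) with hT
  have hTc : T.card = 2 * (m + 1) := by
    rw [hT, Finset.card_insert_of_notMem hδS, Finset.card_insert_of_notMem hMS, hS]
    ring
  have hTpos : ∀ p ∈ T, 0 < p := by
    intro p hp
    rw [hT, Finset.mem_insert, Finset.mem_insert] at hp
    rcases hp with rfl | rfl | hp
    · exact hδ0
    · positivity
    · exact hpos p hp
  have hdeg : ((X - C δ) * (X - C δ⁻¹) * q).natDegree < m + 1 := by
    have h2 : ((X - C δ) * (X - C δ⁻¹) * q).natDegree ≤ 1 + 1 + q.natDegree := by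
      refine natDegree_mul_le.trans (Nat.add_le_add_right (natDegree_mul_le.trans ?_) _)
      rw [natDegree_X_sub_C, natDegree_X_sub_C]
    omega
  have hmain := dividedDifference_sq_mul_nonneg hf hTc hTpos hdeg
  rw [hT, Finset.sum_insert hδS, Finset.sum_insert hMS, ← hT] at hmain
  simp only [eval_mul, eval_sub, eval_X, eval_C, sub_self, zero_mul, mul_zero, zero_add, ne_eq,
    OfNat.ofNat_ne_zero, not_false_eq_true, zero_pow] at hmain
  have hw : ∀ p ∈ S, nodalWeight S id p = nodalWeight T id p * ((p - δ) * (p - δ⁻¹)) := by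
    intro p hp
    have hpM : p ≠ δ⁻¹ := (hlt p hp).ne
    have hpδ : p ≠ δ := (h1 p hp).1.ne'
    simp only [nodalWeight, id]
    rw [hT, Finset.erase_insert_of_ne hpδ.symm, Finset.erase_insert_of_ne hpM.symm,
      Finset.prod_insert, Finset.prod_insert]
    · have := sub_ne_zero.2 hpM
      have := sub_ne_zero.2 hpδ
      generalize (∏ x ∈ S.erase p, (p - x)⁻¹) = W
      calc W = ((p - δ)⁻¹ * (p - δ)) * ((p - δ⁻¹)⁻¹ * (p - δ⁻¹)) * W := by
            rw [inv_mul_cancel₀ ‹_›, inv_mul_cancel₀ ‹_›]; ring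
        _ = _ := by ring
    · exact fun h => hMS (Finset.mem_of_mem_erase h)
    · refine fun h => hδS ?_
      rw [Finset.mem_insert] at h ⊢
      exact h.imp_right Finset.mem_of_mem_erase
  have hfin : ∑ p ∈ S, nodalWeight S id p * ((p - δ) * (p * δ - 1) * q.eval p ^ 2) * f p
      = δ * ∑ p ∈ S, nodalWeight T id p * ((p - δ) * (p - δ⁻¹) * q.eval p) ^ 2 * f p := by
    rw [Finset.mul_sum]
    refine Finset.sum_congr rfl fun p hp => ?_
    have : p * δ - 1 = δ * (p - δ⁻¹) := by field_simp
    rw [hw p hp, this]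
    ring
  rw [hfin]
  exact mul_nonneg hδ0.le hmain

/-- A finite combination of values of an operator monotone function is nonnegative as soon as the
corresponding combination is nonnegative for the constants `±1` and for all the functions
`t ↦ -(t + l)⁻¹`. -/
lemma sum_mul_nonneg_of_resolvent {f : ℝ → ℝ} (hf : ∀ n, MatMonoOn n (Ioi 0) f)
    {S : Finset ℝ} (hpos : ∀ p ∈ S, 0 < p) {d : ℝ → ℝ} (hd : ∑ p ∈ S, d p = 0)
    (hres : ∀ l, 0 ≤ l → ∑ p ∈ S, d p / (p + l) ≤ 0) : 0 ≤ ∑ p ∈ S, d p * f p := by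
  wlog hS : Even S.card generalizing S d
  · obtain ⟨x, hx⟩ := exists_gt (S.sup' (Finset.card_pos.1
      (Nat.pos_of_ne_zero fun h => hS (by rw [h]; exact Even.zero))) id)
    have hlt : ∀ p ∈ S, p < x := fun p hp => (Finset.le_sup' id hp).trans_lt hx
    have hxS : x ∉ S := fun h => lt_irrefl _ (hlt x h)
    have hsum : ∀ g : ℝ → ℝ, ∑ p ∈ insert x S, (if p = x then 0 else d p) * g p
        = ∑ p ∈ S, d p * g p := by
      intro g
      rw [Finset.sum_insert hxS, if_pos rfl, zero_mul, zero_add]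
      exact Finset.sum_congr rfl fun p hp => by rw [if_neg (hlt p hp).ne]
    have := this (S := insert x S) (d := fun p => if p = x then 0 else d p) ?_ ?_ ?_ ?_
    · rwa [hsum f] at this
    · intro p hp
      obtain ⟨p₀, hp₀⟩ : S.Nonempty := Finset.card_pos.1
        (Nat.pos_of_ne_zero fun h => hS (by rw [h]; exact Even.zero))
      rcases Finset.mem_insert.1 hp with rfl | hp
      · exact (hpos p₀ hp₀).trans (hlt p₀ hp₀)
      · exact hpos p hp
    · have := hsum fun _ => 1
      simpa [hd] using this
    · intro l hl
      simp only [div_eq_mul_inv]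
      rw [hsum fun p => (p + l)⁻¹]
      simpa only [div_eq_mul_inv] using hres l hl
    · rw [Finset.card_insert_of_notMem hxS]
      exact (Nat.not_even_iff_odd.1 hS).add_one
  obtain ⟨m, hm⟩ := hS
  replace hm : S.card = 2 * m := by omega
  rcases Nat.eq_zero_or_pos m with rfl | hm0
  · simp [Finset.card_eq_zero.1 (hm.trans (by simp))]
  let Λ : ℝ[X] →ₗ[ℝ] ℝ :=
    ∑ p ∈ S, (nodalWeight S id p * f p) • (leval (-p) : ℝ[X] →ₗ[ℝ] ℝ)
  have hΛ : ∀ P : ℝ[X], Λ P = ∑ p ∈ S, nodalWeight S id p * P.eval (-p) * f p := by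
    intro P
    simp only [Λ, LinearMap.sum_apply, LinearMap.smul_apply, leval_apply, smul_eq_mul]
    exact Finset.sum_congr rfl fun p _ => by ring
  let Q : ℝ[X] := -∑ p ∈ S, C (d p) * nodal (S.erase p) (fun x => -x)
  have hcard : ∀ p ∈ S, (S.erase p).card = 2 * m - 1 := fun p hp => by
    rw [Finset.card_erase_of_mem hp, hm]
  have hQle : Q.natDegree ≤ 2 * m - 1 := by
    simp only [Q, natDegree_neg]
    refine natDegree_sum_le_of_forall_le _ _ fun p hp => ?_
    refine (natDegree_C_mul_le _ _).trans ?_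
    rw [natDegree_nodal, hcard p hp]
  have hQcoeff : Q.coeff (2 * m - 1) = 0 := by
    simp only [Q, coeff_neg, finsetSum_coeff, coeff_C_mul]
    rw [neg_eq_zero, ← hd]
    refine Finset.sum_congr rfl fun p hp => ?_
    have h1 : (nodal (S.erase p) (fun x => -x)).coeff (2 * m - 1) = 1 := by
      have h2 := (nodal_monic (s := S.erase p) (v := fun x : ℝ => -x)).coeff_natDegree
      rwa [natDegree_nodal, hcard p hp] at h2
    rw [h1, mul_one]
  have hQdeg : Q.natDegree ≤ 2 * m - 2 := by
    by_contra! h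
    have h1 : Q.natDegree = 2 * m - 1 := by omega
    have h2 : Q.leadingCoeff = 0 := by rw [leadingCoeff, h1, hQcoeff]
    rw [leadingCoeff_eq_zero.1 h2, natDegree_zero] at h
    omega
  have hQeval : ∀ x, Q.eval x = -∑ p ∈ S, d p * ∏ r ∈ S.erase p, (x + r) := by
    intro x
    simp [Q, eval_finsetSum, eval_nodal]
  have hQpos : ∀ x, 0 ≤ x → 0 ≤ Q.eval x := by
    intro x hx
    have h1 : ∑ p ∈ S, d p * ∏ r ∈ S.erase p, (x + r)
        = (∏ r ∈ S, (x + r)) * ∑ p ∈ S, d p / (p + x) := by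
      rw [Finset.mul_sum]
      refine Finset.sum_congr rfl fun p hp => ?_
      rw [← Finset.mul_prod_erase S _ hp]
      have := hpos p hp
      have : p + x ≠ 0 := by positivity
      field_simp
      ring
    rw [hQeval, h1, neg_nonneg]
    exact mul_nonpos_of_nonneg_of_nonpos
      (Finset.prod_nonneg fun r hr => add_nonneg hx (hpos r hr).le) (hres x hx)
  have hQnode : ∀ p ∈ S, nodalWeight S id p * Q.eval (-p) = d p := by
    intro p hp
    have h1 : ∑ p' ∈ S, d p' * ∏ r ∈ S.erase p', (-p + r) = d p * ∏ r ∈ S.erase p, (-p + r) := by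
      refine Finset.sum_eq_single_of_mem p hp fun p' _ hne => ?_
      rw [Finset.prod_eq_zero (Finset.mem_erase.2 ⟨hne.symm, hp⟩) (by ring), mul_zero]
    have h2 : ∏ r ∈ S.erase p, (-p + r) = -∏ r ∈ S.erase p, (p - r) := by
      have : ∀ r ∈ S.erase p, -p + r = -1 * (p - r) := fun r _ => by ring
      rw [Finset.prod_congr rfl this, Finset.prod_mul_distrib, Finset.prod_const, hcard p hp,
        Odd.neg_one_pow ⟨m - 1, by omega⟩]
      ring
    have h3 : ∏ r ∈ S.erase p, (p - r) ≠ 0 := Finset.prod_ne_zero_iff.2 fun r hr =>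
      sub_ne_zero.2 (Finset.ne_of_mem_erase hr).symm
    rw [hQeval, h1, h2, nodalWeight, Finset.prod_inv_distrib]
    simp only [id]
    field_simp
  have hcomp : ∀ q : ℝ[X], (q.comp (-X)).natDegree = q.natDegree := fun q => by
    rw [natDegree_comp, natDegree_neg, natDegree_X, mul_one]
  have hcompeval : ∀ (q : ℝ[X]) (p : ℝ), (q.comp (-X)).eval p = q.eval (-p) := fun q p => by
    simp
  have := functional_nonneg_of_nonneg_on_halfLine (2 * m - 2) Λ (fun q hq => ?_) (fun q hq => ?_)
    Q hQdeg hQpos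
  · rw [hΛ, Finset.sum_congr rfl fun p hp => by rw [hQnode p hp]] at this
    exact this
  · rw [hΛ]
    have h1 := dividedDifference_sq_mul_nonneg hf hm hpos (q := q.comp (-X))
      (by rw [hcomp]; omega)
    simpa only [hcompeval, eval_pow] using h1
  · rw [hΛ]
    have h1 := dividedDifference_neg_mul_sq_mul_nonneg hf hm hpos (q := q.comp (-X))
      (by rw [hcomp]; omega)
    simpa only [hcompeval, eval_pow, eval_mul, eval_X] using h1

end HalfLine

/-! ### The difference quotient at `1` -/

section DifferenceQuotient

open Filter Topology

variable {f : ℝ → ℝ}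

lemma sum_mul_slope_nonneg (hf : ∀ n, MatMonoOn n (Ioi 0) f) {S : Finset ℝ}
    (hpos : ∀ p ∈ S, 0 < p) (h1 : 1 ∉ S) {c : ℝ → ℝ}
    (hres : ∀ l, 0 ≤ l → 0 ≤ ∑ p ∈ S, c p / (p + l)) : 0 ≤ ∑ p ∈ S, c p * slope f 1 p := by
  have hne : ∀ p ∈ S, p ≠ 1 := fun p hp h => h1 (h ▸ hp)
  have hsum : ∀ g : ℝ → ℝ, ∑ p ∈ insert 1 S,
      (if p = 1 then -∑ r ∈ S, c r / (r - 1) else c p / (p - 1)) * g p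
        = ∑ p ∈ S, c p / (p - 1) * (g p - g 1) := by
    intro g
    rw [Finset.sum_insert h1, if_pos rfl]
    have : ∑ p ∈ S, (if p = 1 then -∑ r ∈ S, c r / (r - 1) else c p / (p - 1)) * g p
        = ∑ p ∈ S, c p / (p - 1) * g p :=
      Finset.sum_congr rfl fun p hp => by rw [if_neg (hne p hp)]
    rw [this]
    simp only [mul_sub, Finset.sum_sub_distrib, Finset.sum_mul, neg_mul]
    ring
  have := sum_mul_nonneg_of_resolvent hf (S := insert 1 S)
    (d := fun p => if p = 1 then -∑ r ∈ S, c r / (r - 1) else c p / (p - 1)) ?_ ?_ ?_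
  · rw [hsum f] at this
    refine this.trans_eq (Finset.sum_congr rfl fun p _ => ?_)
    rw [slope_def_field]
    ring
  · intro p hp
    rcases Finset.mem_insert.1 hp with rfl | hp
    · exact one_pos
    · exact hpos p hp
  · simpa using hsum fun _ => 1
  · intro l hl
    have h2 := hsum fun p => (p + l)⁻¹
    simp only [← div_eq_mul_inv] at h2
    rw [h2]
    have h3 : ∑ p ∈ S, c p / (p - 1) * ((p + l)⁻¹ - (1 + l)⁻¹)
        = -((1 + l)⁻¹ * ∑ p ∈ S, c p / (p + l)) := by
      rw [Finset.mul_sum, ← Finset.sum_neg_distrib]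
      refine Finset.sum_congr rfl fun p hp => ?_
      have h4 : p - 1 ≠ 0 := sub_ne_zero.2 (hne p hp)
      have h5 : p + l ≠ 0 := (add_pos_of_pos_of_nonneg (hpos p hp) hl).ne'
      have h6 : 1 + l ≠ 0 := (add_pos_of_pos_of_nonneg one_pos hl).ne'
      field_simp
      ring
    rw [h3, neg_nonpos]
    exact mul_nonneg (inv_nonneg.2 (by linarith)) (hres l hl)

lemma slope_add_slope_nonneg (hf : ∀ n, MatMonoOn n (Ioi 0) f) {s t : ℝ} (hs : 0 < s)
    (ht : 0 < t) (hst : s < t) (hs1 : s ≠ 1) (ht1 : t ≠ 1) {α β : ℝ}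
    (h : ∀ l, 0 ≤ l → 0 ≤ α / (s + l) + β / (t + l)) : 0 ≤ α * slope f 1 s + β * slope f 1 t := by
  have := sum_mul_slope_nonneg hf (S := {s, t}) (c := fun p => if p = s then α else β)
    (by simp [hs, ht]) (by simp [hs1.symm, ht1.symm])
    (fun l hl => by simpa [Finset.sum_pair hst.ne, hst.ne'] using h l hl)
  simpa [Finset.sum_pair hst.ne, hst.ne'] using this

lemma slope_nonneg (hf : ∀ n, MatMonoOn n (Ioi 0) f) {t : ℝ} (ht : 0 < t) (ht1 : t ≠ 1) :
    0 ≤ slope f 1 t := by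
  have := sum_mul_slope_nonneg hf (S := {t}) (c := fun _ => 1) (by simp [ht]) (by simp [ht1.symm])
    (fun l hl => by simpa using (add_pos_of_pos_of_nonneg ht hl).le)
  simpa using this

lemma slope_anti (hf : ∀ n, MatMonoOn n (Ioi 0) f) {s t : ℝ} (hs : 0 < s)
    (hst : s < t) (hs1 : s ≠ 1) (ht1 : t ≠ 1) : slope f 1 t ≤ slope f 1 s := by
  have := slope_add_slope_nonneg hf hs (hs.trans hst) hst hs1 ht1 (α := 1) (β := -1) fun l hl => by
    have h1 : 1 / (t + l) ≤ 1 / (s + l) :=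
      one_div_le_one_div_of_le (by linarith) (by linarith)
    rw [neg_div]
    linarith
  linarith

lemma mul_slope_mono (hf : ∀ n, MatMonoOn n (Ioi 0) f) {s t : ℝ} (hs : 0 < s)
    (hst : s < t) (hs1 : s ≠ 1) (ht1 : t ≠ 1) : s * slope f 1 s ≤ t * slope f 1 t := by
  have := slope_add_slope_nonneg hf hs (hs.trans hst) hst hs1 ht1 (α := -s) (β := t) fun l hl => by
    have h1 : s / (s + l) ≤ t / (t + l) := by
      rw [div_le_div_iff₀ (by linarith) (by linarith)]
      nlinarith
    rw [neg_div]
    linarith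
  linarith

/-- An operator monotone function on `(0, ∞)` is differentiable at `1`, with bounds for its
difference quotients. -/
lemma exists_hasDerivAt_one (hf : ∀ n, MatMonoOn n (Ioi 0) f) :
    ∃ L, 0 ≤ L ∧ HasDerivAt f L 1 ∧
      ∀ t, 0 < t → t ≠ 1 → min L (L / t) ≤ slope f 1 t ∧ slope f 1 t ≤ max L (L / t) := by
  set L := sSup (slope f 1 '' Ioi 1) with hL
  have hne : (slope f 1 '' Ioi 1).Nonempty := ⟨_, 2, by norm_num, rfl⟩
  have hlt : ∀ s, 0 < s → s < 1 → ∀ y ∈ slope f 1 '' Ioi 1, y ≤ slope f 1 s := by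
    rintro s hs hs1 _ ⟨t, ht, rfl⟩
    exact slope_anti hf hs (hs1.trans ht) hs1.ne (ne_of_gt ht)
  have hbdd : BddAbove (slope f 1 '' Ioi 1) := ⟨_, hlt (1 / 2) (by norm_num) (by norm_num)⟩
  have hle : ∀ t, 1 < t → slope f 1 t ≤ L := fun t ht => le_csSup hbdd ⟨t, ht, rfl⟩
  have hge : ∀ t, 1 < t → L ≤ t * slope f 1 t := by
    intro t ht
    refine csSup_le hne ?_
    rintro _ ⟨s, hs, rfl⟩
    have hs : 1 < s := hs
    have h0 := slope_nonneg hf (one_pos.trans hs) hs.ne'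
    have h0' := slope_nonneg hf (one_pos.trans ht) ht.ne'
    rcases lt_trichotomy s t with h | h | h
    · nlinarith [mul_slope_mono hf (one_pos.trans hs) h hs.ne' ht.ne']
    · subst h
      nlinarith
    · nlinarith [slope_anti hf (one_pos.trans ht) h ht.ne' hs.ne']
  have hL0 : 0 ≤ L := (slope_nonneg hf two_pos (by norm_num)).trans (hle 2 (by norm_num))
  have hleft : ∀ s, 0 < s → s < 1 → s * slope f 1 s ≤ L := by
    intro s hs hs1
    have h1 : Tendsto (fun t : ℝ => t * L) (𝓝[>] 1) (𝓝 (1 * L)) :=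
      (by fun_prop : Continuous fun t : ℝ => t * L).continuousWithinAt
    rw [one_mul] at h1
    refine ge_of_tendsto h1 ?_
    filter_upwards [self_mem_nhdsWithin] with t ht
    have ht : 1 < t := ht
    refine (mul_slope_mono hf hs (hs1.trans ht) hs1.ne ht.ne').trans ?_
    exact mul_le_mul_of_nonneg_left (hle t ht) (by linarith)
  have hbounds : ∀ t, 0 < t → t ≠ 1 →
      min L (L / t) ≤ slope f 1 t ∧ slope f 1 t ≤ max L (L / t) := by
    intro t ht ht1
    rcases lt_or_gt_of_ne ht1 with h | h
    · exact ⟨(min_le_left _ _).trans (csSup_le hne (hlt t ht h)),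
        le_max_of_le_right ((le_div_iff₀' ht).2 (hleft t ht h))⟩
    · exact ⟨(min_le_right _ _).trans ((div_le_iff₀' ht).2 (hge t h)), le_max_of_le_left (hle t h)⟩
  refine ⟨L, hL0, ?_, hbounds⟩
  rw [hasDerivAt_iff_tendsto_slope]
  have hdiv : Tendsto (fun t : ℝ => L / t) (𝓝[≠] 1) (𝓝 L) := by
    have : ContinuousAt (fun t : ℝ => L / t) 1 := continuousAt_const.div continuousAt_id one_ne_zero
    simpa using this.tendsto.mono_left nhdsWithin_le_nhds
  have hmin := (tendsto_const_nhds (x := L)).min hdiv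
  have hmax := (tendsto_const_nhds (x := L)).max hdiv
  rw [min_self] at hmin
  rw [max_self] at hmax
  have hev : ∀ᶠ t in 𝓝[≠] (1 : ℝ), 0 < t ∧ t ≠ 1 :=
    (eventually_nhdsWithin_of_eventually_nhds (lt_mem_nhds one_pos)).and self_mem_nhdsWithin
  exact tendsto_of_tendsto_of_tendsto_of_le_of_le' hmin hmax
    (hev.mono fun t ht => (hbounds t ht.1 ht.2).1) (hev.mono fun t ht => (hbounds t ht.1 ht.2).2)

lemma sum_mul_dslope_nonneg (hf : ∀ n, MatMonoOn n (Ioi 0) f) {S : Finset ℝ}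
    (hpos : ∀ p ∈ S, 0 < p) {c : ℝ → ℝ}
    (hres : ∀ l, 0 ≤ l → 0 ≤ ∑ p ∈ S, c p / (p + l)) : 0 ≤ ∑ p ∈ S, c p * dslope f 1 p := by
  by_cases h1 : 1 ∈ S
  swap
  · refine (sum_mul_slope_nonneg hf hpos h1 hres).trans_eq (Finset.sum_congr rfl fun p hp => ?_)
    rw [dslope_of_ne f (show p ≠ 1 from fun h => h1 (h ▸ hp))]
  obtain ⟨L, -, hderiv, -⟩ := exists_hasDerivAt_one hf
  have hcont : ContinuousAt (dslope f 1) 1 := continuousAt_dslope_same.2 hderiv.differentiableAt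
  have hshift : Tendsto (fun ε : ℝ => 1 + ε) (𝓝[>] 0) (𝓝 1) := by
    have h0 : Tendsto _ _ _ := (by fun_prop : Continuous fun ε : ℝ => 1 + ε).continuousWithinAt
      (s := Ioi (0 : ℝ)) (x := 0)
    simpa using h0
  have hcoef : Tendsto (fun ε : ℝ => c 1 + |c 1| * ε) (𝓝[>] 0) (𝓝 (c 1)) := by
    have h0 : Tendsto _ _ _ :=
      (by fun_prop : Continuous fun ε : ℝ => c 1 + |c 1| * ε).continuousWithinAt
        (s := Ioi (0 : ℝ)) (x := 0)
    simpa using h0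
  have hlim := (hcoef.mul (hcont.tendsto.comp hshift)).add_const
    (∑ p ∈ S.erase 1, c p * dslope f 1 p)
  rw [Finset.add_sum_erase S (fun p => c p * dslope f 1 p) h1] at hlim
  refine ge_of_tendsto hlim ?_
  have hnotin : ∀ᶠ ε in 𝓝[>] (0 : ℝ), ∀ p ∈ S.erase 1, 1 + ε ≠ p := by
    rw [Filter.eventually_all_finset]
    exact fun p hp => hshift.eventually_ne (Finset.ne_of_mem_erase hp).symm
  filter_upwards [hnotin, self_mem_nhdsWithin] with ε hε hε0
  have hε0 : 0 < ε := hε0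
  have hεS : 1 + ε ∉ S.erase 1 := fun h => hε _ h rfl
  have hsum : ∀ g : ℝ → ℝ, ∑ p ∈ insert (1 + ε) (S.erase 1),
      (if p = 1 + ε then c 1 + |c 1| * ε else c p) * g p
        = (c 1 + |c 1| * ε) * g (1 + ε) + ∑ p ∈ S.erase 1, c p * g p := by
    intro g
    rw [Finset.sum_insert hεS, if_pos rfl]
    congr 1
    exact Finset.sum_congr rfl fun p hp => by rw [if_neg (hε p hp).symm]
  have := sum_mul_slope_nonneg hf (S := insert (1 + ε) (S.erase 1))
    (c := fun p => if p = 1 + ε then c 1 + |c 1| * ε else c p) ?_ ?_ ?_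
  · rw [hsum] at this
    refine this.trans_eq ?_
    rw [Function.comp_apply, dslope_of_ne f (by linarith : 1 + ε ≠ 1)]
    congr 1
    exact Finset.sum_congr rfl fun p hp => by rw [dslope_of_ne f (Finset.ne_of_mem_erase hp)]
  · intro p hp
    rcases Finset.mem_insert.1 hp with rfl | hp
    · linarith
    · exact hpos p (Finset.mem_of_mem_erase hp)
  · simp [hε0.ne']
  · intro l hl
    have h2 := hsum fun p => (p + l)⁻¹
    simp only [← div_eq_mul_inv] at h2
    rw [h2]
    have h3 := hres l hl
    rw [← Finset.add_sum_erase S (fun p => c p / (p + l)) h1] at h3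
    refine h3.trans (add_le_add_left ?_ _)
    rw [div_le_div_iff₀ (by linarith) (by linarith)]
    have h4 : 0 ≤ ε * (|c 1| - c 1) := mul_nonneg hε0.le (sub_nonneg.2 (le_abs_self _))
    have h5 : 0 ≤ |c 1| * ε * l := by positivity
    linarith

/-- If `f` is operator monotone on `(0, ∞)`, then so is `t ↦ t * (f t - f 1) / (t - 1)`. -/
lemma matMonoOn_mul_dslope (hf : ∀ n, MatMonoOn n (Ioi 0) f) {r : ℝ} (hr : 0 ≤ r) (n : ℕ) :
    MatMonoOn n (Ioi 0) fun t => r * (t * dslope f 1 t) := by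
  intro A B hA hB hAI hBI hAB
  obtain ⟨U, hU, hAU, hfA⟩ := exists_conjDiag hA
  obtain ⟨V, hV, hBV, hfB⟩ := exists_conjDiag hB
  rw [hfA, hfB]
  set a := hA.eigenvalues
  set b := hB.eigenvalues
  have hdiff : (conjDiag V b - conjDiag U a).PosSemidef := by rwa [← hAU, ← hBV]
  refine PosSemidef.of_dotProduct_mulVec_nonneg
    ((conjDiag_isHermitian _ _).sub (conjDiag_isHermitian _ _)) fun x => ?_
  rw [sub_mulVec, dotProduct_sub, conjDiag_quadForm, conjDiag_quadForm]
  let S : Finset ℝ := Finset.univ.image a ∪ Finset.univ.image b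
  let c : ℝ → ℝ := fun p => (∑ i, if b i = p then b i * ‖(Vᴴ *ᵥ x) i‖ ^ 2 else 0)
    - ∑ i, if a i = p then a i * ‖(Uᴴ *ᵥ x) i‖ ^ 2 else 0
  have hcollect : ∀ (d w : Fin n → ℝ) (_ : ∀ i, d i ∈ S) (h : ℝ → ℝ),
      ∑ p ∈ S, (∑ i, if d i = p then w i else 0) * h p = ∑ i, w i * h (d i) := by
    intro d w hd h
    simp only [Finset.sum_mul, ite_mul, zero_mul]
    rw [Finset.sum_comm]
    exact Finset.sum_congr rfl fun i _ => by rw [Finset.sum_ite_eq, if_pos (hd i)]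
  have haS : ∀ i, a i ∈ S := fun i =>
    Finset.mem_union_left _ (Finset.mem_image_of_mem a (Finset.mem_univ i))
  have hbS : ∀ i, b i ∈ S := fun i =>
    Finset.mem_union_right _ (Finset.mem_image_of_mem b (Finset.mem_univ i))
  have hsum : ∀ h : ℝ → ℝ, ∑ p ∈ S, c p * h p = ∑ i, b i * ‖(Vᴴ *ᵥ x) i‖ ^ 2 * h (b i)
      - ∑ i, a i * ‖(Uᴴ *ᵥ x) i‖ ^ 2 * h (a i) := by
    intro h
    simp only [c, sub_mul, Finset.sum_sub_distrib]
    rw [hcollect b _ hbS, hcollect a _ haS]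
  have hmain := sum_mul_dslope_nonneg hf (S := S) (c := c) ?_ ?_
  · rw [hsum] at hmain
    have h1 : ∀ (d w : Fin n → ℝ), ∑ i, r * (d i * dslope f 1 (d i)) * w i
        = r * ∑ i, d i * w i * dslope f 1 (d i) := by
      intro d w
      rw [Finset.mul_sum]
      exact Finset.sum_congr rfl fun i _ => by ring
    rw [h1, h1, ← Complex.ofReal_sub, ← mul_sub]
    exact Complex.zero_le_real.2 (mul_nonneg hr hmain)
  · intro p hp
    rcases Finset.mem_union.1 hp with hp | hp
    · obtain ⟨i, -, rfl⟩ := Finset.mem_image.1 hp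
      exact hAI i
    · obtain ⟨i, -, rfl⟩ := Finset.mem_image.1 hp
      exact hBI i
  · intro l hl
    simp only [div_eq_mul_inv]
    rw [hsum fun p => (p + l)⁻¹, sub_nonneg]
    have h1 := sum_div_add_le_of_posSemidef_sub hU hV hAI hBI hdiff hl x
    simpa only [div_eq_mul_inv, mul_right_comm] using h1

end DifferenceQuotient

theorem stmt16 (f : ℝ → ℝ) (hf : ∀ n, MatMonoOn n (Ioi 0) f)
    (hnc : ∃ s ∈ Ioi (0:ℝ), ∃ u ∈ Ioi (0:ℝ), f s ≠ f u) :
    0 < deriv f 1 ∧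
    ∀ Tf : ℝ → ℝ,
      (∀ t, Tf t = if t = 1 then 1 else (t / deriv f 1) * ((f t - f 1) / (t - 1))) →
      (∀ t ∈ Ioi (0:ℝ), 0 < Tf t) ∧ (∀ n, MatMonoOn n (Ioi 0) Tf) ∧ Tf 1 = 1 ∧
      ∀ t ∈ Ioi (0:ℝ), f t = f 1 + deriv f 1 * ((t - 1) / t) * Tf t := by
  obtain ⟨L, hL0, hderiv, hbounds⟩ := exists_hasDerivAt_one hf
  have hLpos : 0 < L := by
    refine lt_of_le_of_ne hL0 fun h => ?_
    subst h
    have hconst : ∀ t ∈ Ioi (0 : ℝ), f t = f 1 := by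
      intro t ht
      by_cases ht1 : t = 1
      · rw [ht1]
      · have hb := hbounds t ht ht1
        simp only [zero_div, min_self, max_self] at hb
        have h0 : slope f 1 t = 0 := le_antisymm hb.2 hb.1
        rw [slope_def_field, div_eq_zero_iff] at h0
        exact sub_eq_zero.1 (h0.resolve_right (sub_ne_zero.2 ht1))
    obtain ⟨s, hs, u, hu, hne⟩ := hnc
    exact hne ((hconst s hs).trans (hconst u hu).symm)
  have hd : deriv f 1 = L := hderiv.deriv
  rw [hd]
  refine ⟨hLpos, fun Tf hTf => ?_⟩
  have hT : Tf = fun t => L⁻¹ * (t * dslope f 1 t) := by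
    ext t
    rw [hTf]
    split_ifs with ht
    · rw [ht, dslope_same, hd]
      field_simp
    · rw [dslope_of_ne f ht, slope_def_field]
      ring
  refine ⟨fun t ht => ?_, fun n => ?_, by rw [hTf, if_pos rfl], fun t ht => ?_⟩
  · have ht : 0 < t := ht
    rw [hTf]
    split_ifs with ht1
    · exact one_pos
    · have h1 := (hbounds t ht ht1).1
      rw [slope_def_field] at h1
      exact mul_pos (div_pos ht hLpos) ((lt_min hLpos (div_pos hLpos ht)).trans_le h1)
  · rw [hT]
    exact matMonoOn_mul_dslope hf (inv_nonneg.2 hL0) n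
  · have ht : 0 < t := ht
    rw [hTf]
    split_ifs with ht1
    · rw [ht1]
      simp
    · have h1 := sub_ne_zero.2 ht1
      field_simp
      ring

end
end

section
/- For every operator monotone function f : (0,∞) → (0,∞) with f(1) = 1, the derivatives at 1 of f and of its adjoint f*(t) = t·f(1/t) satisfy f'(1) + (f*)'(1) = 1. Consequently 0 < f'(1) < 1 unless f is the constant function 1 or the identity. -/
open Matrix Set
open scoped ComplexOrder

noncomputable section

lemma eigenvalues_eq_or_eq {n : ℕ} {A : Matrix (Fin n) (Fin n) ℂ} (hA : A.IsHermitian) {a b : ℝ}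
    (h : (A - (a : ℂ) • 1) * (A - (b : ℂ) • 1) = 0) (i : Fin n) :
    hA.eigenvalues i = a ∨ hA.eigenvalues i = b := by
  set v : Fin n → ℂ := ⇑(hA.eigenvectorBasis i) with hv
  have hv0 : v ≠ 0 := by
    intro h0
    apply (hA.eigenvectorBasis.orthonormal.ne_zero i)
    ext j
    exact congrFun h0 j
  have hm : A *ᵥ v = (hA.eigenvalues i : ℂ) • v := by
    have := hA.mulVec_eigenvectorBasis i
    simpa using this
  have h2 := congrArg (· *ᵥ v) h
  simp only [← mulVec_mulVec, sub_mulVec, smul_mulVec, one_mulVec, hm, zero_mulVec, mulVec_sub,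
    mulVec_smul] at h2
  have h3 : (((hA.eigenvalues i : ℂ) - a) * ((hA.eigenvalues i : ℂ) - b)) • v = 0 := by
    rw [← h2]
    module
  rcases smul_eq_zero.1 h3 with h4 | h4
  · rcases mul_eq_zero.1 h4 with h5 | h5
    · left; exact_mod_cast sub_eq_zero.1 h5
    · right; exact_mod_cast sub_eq_zero.1 h5
  · exact absurd h4 hv0

lemma cfc_eq_affine {n : ℕ} {A : Matrix (Fin n) (Fin n) ℂ} (hA : A.IsHermitian) {a b s : ℝ}
    {f : ℝ → ℝ} (h : (A - (a : ℂ) • 1) * (A - (b : ℂ) • 1) = 0) (hs : f b = f a + s * (b - a)) :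
    hA.cfc f = (f a : ℂ) • 1 + (s : ℂ) • (A - (a : ℂ) • 1) := by
  have hsa : IsSelfAdjoint A := hA
  have h1 : cfc f A = cfc (fun t : ℝ => (f a - s * a) + s * t) A := by
    apply cfc_congr
    intro t ht
    rw [hA.spectrum_real_eq_range_eigenvalues] at ht
    obtain ⟨i, rfl⟩ := ht
    rcases eigenvalues_eq_or_eq hA h i with h | h
    · simp [h]
    · simp [h, hs]; ring
  rw [← hA.cfc_eq, h1, cfc_const_add _ _ A, cfc_const_mul_id _ A, Algebra.algebraMap_eq_smul_one]
  ext i j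
  simp only [Matrix.add_apply, Matrix.smul_apply, Matrix.sub_apply, Complex.real_smul, smul_eq_mul]
  push_cast
  ring

/-- Matrix monotonicity tested on `A ≤ B` with spectra `{a₁, a₂}` and `{b₁, b₂}` and `B - A` of
rank one: a diagonal entry and the determinant of `f(B) - f(A)` are nonnegative. -/
lemma MatMonoOn.interlacing_ineq {f : ℝ → ℝ} (hf : MatMonoOn 2 (Ioi 0) f) {a₁ b₁ a₂ b₂ : ℝ}
    (h0 : 0 < a₁) (h₁ : a₁ < b₁) (h₂ : b₁ < a₂) (h₃ : a₂ < b₂) :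
    (f a₂ - f a₁) * (b₁ - a₁) * (b₂ - a₂) ≤ (f b₁ - f a₁) * (a₂ - a₁) * (b₂ - b₁) ∧
    (f b₂ - f a₁) * (f a₂ - f b₁) * (b₁ - a₁) * (b₂ - a₂) ≤
      (f b₁ - f a₁) * (f b₂ - f a₂) * (b₂ - a₁) * (a₂ - b₁) := by
  obtain ⟨x, hx⟩ : ∃ x, x = (b₁ - a₁) * (a₂ - b₁) / (b₂ - b₁) := ⟨_, rfl⟩
  obtain ⟨y, hy⟩ : ∃ y, y = (b₂ - a₁) * (b₂ - a₂) / (b₂ - b₁) := ⟨_, rfl⟩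
  obtain ⟨p, hp⟩ : ∃ p, p = (f a₂ - f a₁) / (a₂ - a₁) := ⟨_, rfl⟩
  have e1 : a₂ - a₁ ≠ 0 := by linarith
  have e2 : b₂ - b₁ ≠ 0 := by linarith
  have hx0 : 0 ≤ x := by
    rw [hx]; apply div_nonneg (mul_nonneg _ _) <;> linarith
  have hy0 : 0 ≤ y := by
    rw [hy]; apply div_nonneg (mul_nonneg _ _) <;> linarith
  obtain ⟨u, hu⟩ : ∃ u, u * u = x := ⟨√x, Real.mul_self_sqrt hx0⟩
  obtain ⟨w, hw⟩ : ∃ w, w * w = y := ⟨√y, Real.mul_self_sqrt hy0⟩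
  have huw : (u * w) * (u * w) = x * y := by rw [← hu, ← hw]; ring
  have hsum : x + y = b₁ + b₂ - a₁ - a₂ := by rw [hx, hy]; field_simp; ring
  have hdet : b₁ * b₂ - x * b₂ - y * b₁ = a₁ * a₂ := by rw [hx, hy]; field_simp; ring
  let A : Matrix (Fin 2) (Fin 2) ℂ := !![(b₁ - x : ℝ), (-(u * w) : ℝ); (-(u * w) : ℝ), (b₂ - y : ℝ)]
  let B : Matrix (Fin 2) (Fin 2) ℂ := !![(b₁ : ℝ), 0; 0, (b₂ : ℝ)]
  have hA : A.IsHermitian := by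
    ext i j
    fin_cases i <;> fin_cases j <;> simp [A]
  have hB : B.IsHermitian := by
    ext i j
    fin_cases i <;> fin_cases j <;> simp [B]
  have hA2 : (A - (a₁ : ℂ) • 1) * (A - (a₂ : ℂ) • 1) = 0 := by
    ext i j
    fin_cases i <;> fin_cases j <;>
      simp [A, Matrix.mul_apply, Fin.sum_univ_two] <;> norm_cast
    · linear_combination huw + (x - b₁) * hsum - hdet
    · linear_combination (u * w) * hsum
    · linear_combination (u * w) * hsum
    · linear_combination huw + (y - b₂) * hsum - hdet
  have hB2 : (B - (b₁ : ℂ) • 1) * (B - (b₂ : ℂ) • 1) = 0 := by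
    ext i j
    fin_cases i <;> fin_cases j <;>
      simp [B, Matrix.mul_apply, Fin.sum_univ_two]
  have hBA : (B - A).PosSemidef := by
    have := posSemidef_vecMulVec_self_star (![(u : ℂ), (w : ℂ)])
    convert this using 1
    ext i j
    fin_cases i <;> fin_cases j <;> simp [A, B, vecMulVec_apply] <;> norm_cast <;> linarith
  have key := hf A B hA hB
    (fun i => by rcases eigenvalues_eq_or_eq hA hA2 i with h | h <;> rw [h, mem_Ioi] <;> linarith)
    (fun i => by rcases eigenvalues_eq_or_eq hB hB2 i with h | h <;> rw [h, mem_Ioi] <;> linarith)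
    hBA
  rw [cfc_eq_affine hA (s := p) (f := f) hA2 (by rw [hp]; field_simp; ring),
    cfc_eq_affine hB (s := (f b₂ - f b₁) / (b₂ - b₁)) (f := f) hB2 (by field_simp; ring)] at key
  have k1 := key.diag_nonneg (i := 0)
  have k2 := key.det_nonneg
  have hq : (f b₂ - f b₁) / (b₂ - b₁) * (b₂ - b₁) = f b₂ - f b₁ := by field_simp
  simp [A, B, Matrix.det_fin_two] at k1 k2
  norm_cast at k1 k2
  have hpos : 0 < (a₂ - a₁) * (b₂ - b₁) := by apply mul_pos <;> linarith
  constructor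
  · have k3 : 0 ≤ ((f b₁ - f a₁) * (a₂ - a₁) * (b₂ - b₁) -
        (f a₂ - f a₁) * (b₁ - a₁) * (b₂ - a₂)) / ((a₂ - a₁) * (b₂ - b₁)) := by
      refine (sub_nonneg.2 k1).trans_eq ?_
      rw [hp, hx]
      field_simp
      ring
    have := (le_div_iff₀ hpos).1 k3
    linarith
  · rw [hq] at k2
    have k3 : 0 ≤ ((f b₁ - f a₁) * (f b₂ - f a₂) * (b₂ - a₁) * (a₂ - b₁) -
        (f b₂ - f a₁) * (f a₂ - f b₁) * (b₁ - a₁) * (b₂ - a₂)) / ((a₂ - a₁) * (b₂ - b₁)) := by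
      refine (sub_nonneg.2 k2).trans_eq ?_
      trans (f b₁ - f a₁ - p * (b₁ - x - a₁)) * (f b₂ - f a₁ - p * (b₂ - y - a₁)) - p ^ 2 * (x * y)
      · linear_combination (-p ^ 2) * huw
      · rw [hp, hx, hy]
        field_simp
        ring
    have := (le_div_iff₀ hpos).1 k3
    linarith

open Filter Topology

lemma MatMonoOn.concaveOn {f : ℝ → ℝ} (hf : MatMonoOn 2 (Ioi 0) f) : ConcaveOn ℝ (Ioi 0) f := by
  refine concaveOn_of_slope_anti_adjacent (convex_Ioi 0) ?_
  intro a b c ha hc hab hbc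
  rw [mem_Ioi] at ha
  have hchord : (f c - f a) * (b - a) ≤ (f b - f a) * (c - a) := by
    by_contra! hlt
    obtain ⟨u, hu⟩ : ∃ u, u = (f c - f a) * (b - a) := ⟨_, rfl⟩
    obtain ⟨v, hv⟩ : ∃ v, v = (f b - f a) * (c - a) := ⟨_, rfl⟩
    rw [← hu, ← hv] at hlt
    have hd : 0 < u - v := by linarith
    have hr : 0 ≤ |u * c - v * b| / (u - v) := by positivity
    have h := (hf.interlacing_ineq (b₂ := c + 1 + |u * c - v * b| / (u - v))
      ha hab hbc (by linarith)).1
    rw [← hu, ← hv] at h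
    have h2 : (u - v) * (|u * c - v * b| / (u - v)) = |u * c - v * b| := by field_simp
    have h3 := le_abs_self (u * c - v * b)
    have h4 : 0 < (u - v) * (c + 1) := mul_pos hd (by linarith)
    linarith
  rw [div_le_div_iff₀ (by linarith) (by linarith)]
  linarith

lemma ConcaveOn.monotoneOn_of_pos {f : ℝ → ℝ} (hf : ConcaveOn ℝ (Ioi 0) f)
    (hpos : ∀ t ∈ Ioi (0 : ℝ), 0 < f t) : MonotoneOn f (Ioi 0) := by
  intro s hs t ht hst
  by_contra! hlt
  have hst' : s < t := hst.lt_of_ne (by rintro rfl; exact lt_irrefl _ hlt)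
  rw [mem_Ioi] at hs ht
  have hd : 0 < f s - f t := by linarith
  have hft := hpos t ht
  set r := t + (t - s) * f t / (f s - f t) with hr
  have htr : t < r := by
    have : 0 < (t - s) * f t / (f s - f t) := by
      have : 0 < t - s := by linarith
      positivity
    linarith
  have h := hf.slope_anti_adjacent (mem_Ioi.2 hs) (mem_Ioi.2 (ht.trans htr)) hst' htr
  rw [div_le_div_iff₀ (by linarith) (by linarith)] at h
  have h2 : (r - t) * (f s - f t) = (t - s) * f t := by rw [hr]; field_simp; ring
  have h3 : 0 < f r * (t - s) := mul_pos (hpos r (mem_Ioi.2 (ht.trans htr))) (by linarith)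
  linarith

/-- The interlacing inequality at `a < b < x < c`, in the limit `b → x` from the left. -/
lemma MatMonoOn.leftDeriv_ineq {f : ℝ → ℝ} (hf : MatMonoOn 2 (Ioi 0) f) {a x c p : ℝ}
    (h0 : 0 < a) (hax : a < x) (hxc : x < c) (hp : HasDerivWithinAt f p (Iio x) x) :
    (f c - f a) * p * (x - a) * (c - x) ≤ (f x - f a) * (f c - f x) * (c - a) := by
  have hs := (hasDerivWithinAt_iff_tendsto_slope' self_notMem_Iio).1 hp
  have hc : Tendsto f (𝓝[<] x) (𝓝 (f x)) := hp.continuousWithinAt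
  have hid : Tendsto (fun b : ℝ => b) (𝓝[<] x) (𝓝 x) := tendsto_nhdsWithin_of_tendsto_nhds tendsto_id
  refine le_of_tendsto_of_tendsto (((hs.const_mul (f c - f a)).mul (hid.sub_const a)).mul_const _)
    (((hc.sub_const (f a)).mul_const (f c - f x)).mul_const (c - a)) ?_
  filter_upwards [Ioo_mem_nhdsLT hax] with b hb
  have h := (hf.interlacing_ineq h0 hb.1 hb.2 hxc).2
  have hbx : 0 < x - b := by linarith [hb.2]
  have hsl : slope f x b * (x - b) = f x - f b := by
    rw [slope_def_field]
    have : b - x ≠ 0 := by linarith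
    field_simp
    ring
  rw [← hsl] at h
  nlinarith

/-- The interlacing inequality at `a < b < t < x`, in the limit `t → x` from the left. -/
lemma MatMonoOn.left_ineq {f : ℝ → ℝ} (hf : MatMonoOn 2 (Ioi 0) f) {a b x d : ℝ}
    (h0 : 0 < a) (hab : a < b) (hbx : b < x) (hd : HasDerivAt f d x) :
    (f x - f a) * (f x - f b) * (b - a) ≤ (f b - f a) * d * (x - a) * (x - b) := by
  have hs := (hasDerivWithinAt_iff_tendsto_slope' self_notMem_Iio).1 (hd.hasDerivWithinAt (s := Iio x))
  have hc : Tendsto f (𝓝[<] x) (𝓝 (f x)) := hd.continuousAt.continuousWithinAt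
  have hid : Tendsto (fun b : ℝ => b) (𝓝[<] x) (𝓝 x) := tendsto_nhdsWithin_of_tendsto_nhds tendsto_id
  refine le_of_tendsto_of_tendsto (((hc.sub_const (f b)).const_mul (f x - f a)).mul_const (b - a))
    (((hs.const_mul (f b - f a)).mul_const (x - a)).mul (hid.sub_const b)) ?_
  filter_upwards [Ioo_mem_nhdsLT hbx] with t ht
  have h := (hf.interlacing_ineq h0 hab ht.1 ht.2).2
  have htx : 0 < x - t := by linarith [ht.2]
  have hsl : slope f x t * (x - t) = f x - f t := by
    rw [slope_def_field]
    have : t - x ≠ 0 := by linarith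
    field_simp
    ring
  rw [← hsl] at h
  nlinarith

lemma MatMonoOn.differentiableAt {f : ℝ → ℝ} (hf : MatMonoOn 2 (Ioi 0) f)
    (hpos : ∀ t ∈ Ioi (0 : ℝ), 0 < f t) {x : ℝ} (hx : 0 < x) : DifferentiableAt ℝ f x := by
  have hconc := hf.concaveOn
  have hmono := hconc.monotoneOn_of_pos hpos
  have hint : x ∈ interior (Ioi (0 : ℝ)) := by rw [interior_Ioi]; exact hx
  obtain ⟨p, hp⟩ : ∃ p, HasDerivWithinAt f p (Iio x) x :=
    ⟨_, by simpa using (hconc.neg.hasDerivWithinAt_leftDeriv_of_mem_interior hint).neg⟩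
  obtain ⟨q, hq⟩ : ∃ q, HasDerivWithinAt f q (Ioi x) x :=
    ⟨_, by simpa using (hconc.neg.hasDerivWithinAt_rightDeriv_of_mem_interior hint).neg⟩
  have hqp : q ≤ p := by
    have := hconc.neg.leftDeriv_le_rightDeriv_of_mem_interior hint
    rw [(hp.neg).derivWithin (uniqueDiffWithinAt_Iio x),
      (hq.neg).derivWithin (uniqueDiffWithinAt_Ioi x)] at this
    linarith
  have hsp := (hasDerivWithinAt_iff_tendsto_slope' self_notMem_Iio).1 hp
  have hsq := (hasDerivWithinAt_iff_tendsto_slope' self_notMem_Ioi).1 hq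
  have hq0 : 0 ≤ q := by
    refine ge_of_tendsto hsq ?_
    filter_upwards [self_mem_nhdsWithin] with t ht
    rw [mem_Ioi] at ht
    rw [slope_def_field]
    exact div_nonneg (sub_nonneg.2 (hmono hx (hx.trans ht) ht.le)) (sub_nonneg.2 ht.le)
  have hle : ∀ a ∈ Ioo 0 x, (f x - f a) * p ≤ (f x - f a) * q := by
    intro a ha
    have hlim : (f x - f a) * p * (x - a) ≤ (f x - f a) * q * (x - a) := by
      have hc : Tendsto f (𝓝[>] x) (𝓝 (f x)) := hq.continuousWithinAt
      have hid : Tendsto (fun b : ℝ => b) (𝓝[>] x) (𝓝 x) :=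
        tendsto_nhdsWithin_of_tendsto_nhds tendsto_id
      refine le_of_tendsto_of_tendsto (((hc.sub_const (f a)).mul_const p).mul_const (x - a))
        ((hsq.const_mul (f x - f a)).mul (hid.sub_const a)) ?_
      filter_upwards [self_mem_nhdsWithin] with c hc
      rw [mem_Ioi] at hc
      have h := hf.leftDeriv_ineq ha.1 ha.2 hc hp
      have hcx : 0 < c - x := by linarith
      have hsl : slope f x c * (c - x) = f c - f x := by
        rw [slope_def_field]
        field_simp
      rw [← hsl] at h
      nlinarith
    exact le_of_mul_le_mul_right hlim (sub_pos.2 ha.2)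
  have hpq : p ≤ q := by
    by_cases h : ∃ a ∈ Ioo 0 x, f a ≠ f x
    · obtain ⟨a, ha, hne⟩ := h
      have hlt : 0 < f x - f a :=
        sub_pos.2 ((hmono ha.1 hx ha.2.le).lt_of_ne hne)
      exact le_of_mul_le_mul_left (hle a ha) hlt
    · push Not at h
      refine le_trans (le_of_tendsto hsp ?_) hq0
      filter_upwards [Ioo_mem_nhdsLT hx] with t ht
      rw [slope_def_field, h t ht]
      simp
  obtain rfl := le_antisymm hpq hqp
  have h := hp.Iic_of_Iio.union hq.Ici_of_Ioi
  rw [Iic_union_Ici, hasDerivWithinAt_univ] at h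
  exact h.differentiableAt

theorem stmt17 (f : ℝ → ℝ) (hpos : ∀ t ∈ Ioi (0:ℝ), 0 < f t)
    (hf : ∀ n, MatMonoOn n (Ioi 0) f) (h1 : f 1 = 1) :
    deriv f 1 + deriv (fun t => t * f t⁻¹) 1 = 1 ∧
    ((¬ ∀ t ∈ Ioi (0:ℝ), f t = 1) → (¬ ∀ t ∈ Ioi (0:ℝ), f t = t) →
      0 < deriv f 1 ∧ deriv f 1 < 1) := by
  have hf2 := hf 2
  have hconc := hf2.concaveOn
  have hmono := hconc.monotoneOn_of_pos hpos
  have hd := (hf2.differentiableAt hpos one_pos).hasDerivAt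
  obtain ⟨d, hdd⟩ : ∃ d, d = deriv f 1 := ⟨_, rfl⟩
  rw [← hdd] at hd ⊢
  have hone : (1 : ℝ) ∈ Ioi (0 : ℝ) := mem_Ioi.2 one_pos
  have hadj : HasDerivAt (fun t : ℝ => t * f t⁻¹) (1 - d) 1 := by
    have hinv : HasDerivAt (fun t : ℝ => t⁻¹) (-1) 1 := by
      simpa using hasDerivAt_inv (one_ne_zero (α := ℝ))
    have hd' : HasDerivAt f d ((1 : ℝ)⁻¹) := by simpa using hd
    have h := (hasDerivAt_id (1 : ℝ)).mul (hd'.comp (1 : ℝ) hinv)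
    simp only [id] at h
    refine h.congr_deriv ?_
    simp [h1]
    ring
  refine ⟨by rw [hadj.deriv]; ring, fun hne1 hneid => ?_⟩
  have htan : ∀ t ∈ Ioi (0 : ℝ), f t ≤ 1 + d * (t - 1) := by
    intro t ht
    rcases lt_trichotomy t 1 with h | rfl | h
    · have := hconc.le_slope_of_hasDerivAt ht hone h hd
      rw [slope_def_field, h1, le_div_iff₀ (by linarith)] at this
      linarith
    · simp [h1]
    · have := hconc.slope_le_of_hasDerivAt hone ht h hd
      rw [slope_def_field, h1, div_le_iff₀ (by linarith)] at this
      linarith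
  have hd0 : 0 ≤ d := by
    have h2 := htan 2 (by norm_num)
    have h3 := hmono hone (show (2 : ℝ) ∈ Ioi 0 by norm_num) (by norm_num)
    linarith
  have hd1 : d ≤ 1 := by
    by_contra! hlt
    have hp : (0 : ℝ) < 1 - 1 / d := by
      rw [sub_pos, div_lt_one (by linarith)]
      exact hlt
    have h2 := htan _ hp
    have h3 := hpos _ hp
    have h4 : d * (1 - 1 / d - 1) = -1 := by field_simp; ring
    linarith
  refine ⟨hd0.lt_of_ne ?_, hd1.lt_of_ne ?_⟩
  · rintro rfl
    apply hne1
    intro t ht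
    rw [mem_Ioi] at ht
    refine le_antisymm (by simpa using htan t ht) ?_
    by_contra! hlt
    rcases le_or_gt 1 t with h | h
    · linarith [hmono hone ht h]
    · have h2 := hf2.left_ineq (a := t / 2) (by linarith) (by linarith) h hd
      have h3 := hmono (show t / 2 ∈ Ioi 0 by simpa using ht) ht (by linarith)
      rw [h1] at h2
      have h4 : 0 < (1 - f (t / 2)) * (1 - f t) * (t - t / 2) :=
        mul_pos (mul_pos (by linarith) (by linarith)) (by linarith)
      linarith
  · rintro rfl
    apply hneid
    have hle : ∀ t ∈ Ioi (0 : ℝ), f t ≤ t := fun t ht => by linarith [htan t ht]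
    have hlow : ∀ t ∈ Ioo (0 : ℝ) 1, f t = t := by
      intro t ht
      refine le_antisymm (hle t ht.1) ?_
      have hid : Tendsto (fun a : ℝ => a) (𝓝[>] 0) (𝓝 0) :=
        tendsto_nhdsWithin_of_tendsto_nhds tendsto_id
      have hf0 : Tendsto f (𝓝[>] 0) (𝓝 0) :=
        tendsto_of_tendsto_of_tendsto_of_le_of_le' tendsto_const_nhds hid
          (by filter_upwards [self_mem_nhdsWithin] with a ha using (hpos a ha).le)
          (by filter_upwards [self_mem_nhdsWithin] with a ha using hle a ha)
      have h := le_of_tendsto_of_tendsto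
        (((hf0.const_sub 1).mul_const (1 - f t)).mul (hid.const_sub t))
        ((((hf0.const_sub (f t)).mul_const 1).mul (hid.const_sub 1)).mul_const (1 - t)) (by
          filter_upwards [Ioo_mem_nhdsGT ht.1] with a ha
          have := hf2.left_ineq ha.1 ha.2 ht.2 hd
          rwa [h1] at this)
      linarith
    intro t ht
    rcases lt_trichotomy t 1 with h | rfl | h
    · exact hlow t ⟨ht, h⟩
    · exact h1
    · refine le_antisymm (hle t ht) ?_
      have h2 := hf2.leftDeriv_ineq (a := 1 / 2) (by norm_num) (by norm_num) h
        hd.hasDerivWithinAt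
      rw [h1, hlow (1 / 2) (by norm_num)] at h2
      linarith

end
end

section
/- Every positive operator monotone function f : (0,∞) → (0,∞) admits a bounded positive Borel measure μ on [0,1] such that f(t) = ∫₀¹ t/(λ + (1−λ)t) dμ(λ) for all t > 0; moreover μ is a probability measure if and only if f(1) = 1. -/
open Matrix Set
open scoped ComplexOrder

noncomputable section

open Polynomial Lagrange Filter Topology

/-- The functional calculus acts on an eigenvector through the value at its eigenvalue. -/
lemma cfc_mulVec_of_mulVec_eq_smul {n : ℕ} {B : Matrix (Fin n) (Fin n) ℂ} (hB : B.IsHermitian)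
    (f : ℝ → ℝ) {u : Fin n → ℂ} {s : ℝ} (hu : B *ᵥ u = (s : ℂ) • u) :
    hB.cfc f *ᵥ u = (f s : ℂ) • u := by
  set U : Matrix (Fin n) (Fin n) ℂ := hB.eigenvectorUnitary.val with hU
  have hUU : star U * U = 1 := Unitary.coe_star_mul_self hB.eigenvectorUnitary
  have hUU' : U * star U = 1 := Unitary.coe_mul_star_self hB.eigenvectorUnitary
  have hBs : B = U * Matrix.diagonal (RCLike.ofReal ∘ hB.eigenvalues) * star U := by
    conv_lhs => rw [hB.spectral_theorem, Unitary.conjStarAlgAut_apply]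
  have hcfc : hB.cfc f = U * Matrix.diagonal (RCLike.ofReal ∘ f ∘ hB.eigenvalues) * star U := by
    rw [IsHermitian.cfc, Unitary.conjStarAlgAut_apply]
  set w := star U *ᵥ u with hw
  have hUw : U *ᵥ w = u := by rw [hw, mulVec_mulVec, hUU', one_mulVec]
  have hdiag : Matrix.diagonal (RCLike.ofReal ∘ hB.eigenvalues) *ᵥ w = (s : ℂ) • w := by
    have hSB : star U * B = Matrix.diagonal (RCLike.ofReal ∘ hB.eigenvalues) * star U := by
      conv_lhs => rw [hBs]
      rw [← Matrix.mul_assoc, ← Matrix.mul_assoc, hUU, Matrix.one_mul]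
    rw [hw, mulVec_mulVec, ← hSB, ← mulVec_mulVec, hu, mulVec_smul]
  have hdiag' : Matrix.diagonal (RCLike.ofReal ∘ f ∘ hB.eigenvalues) *ᵥ w = (f s : ℂ) • w := by
    ext i
    have h := congrFun hdiag i
    simp only [mulVec_diagonal, Function.comp_apply, Pi.smul_apply, smul_eq_mul] at h ⊢
    rcases mul_eq_mul_right_iff.1 h with h | h
    · have : hB.eigenvalues i = s := Complex.ofReal_injective h
      rw [this]; rfl
    · simp [h]
  rw [hcfc, ← mulVec_mulVec, ← hw, ← mulVec_mulVec, hdiag', mulVec_smul, hUw]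

/-- Monotonicity of `f` along the rank one perturbation `diagonal t ≤ diagonal t + v vᵀ`, whose
right side has eigenvalues `s j` with eigenvectors `v i / (s j - t i)`. -/
lemma MatMonoOn.rank_one_form_nonneg {m : ℕ} {f : ℝ → ℝ} (hf : MatMonoOn m (Ioi 0) f)
    {t s v : Fin m → ℝ} (ht : ∀ i, 0 < t i) (hts : ∀ i j, s j ≠ t i)
    (hsec : ∀ j, ∑ i, v i ^ 2 / (s j - t i) = 1) (b x : Fin m → ℝ)
    (hx : ∀ i, x i = ∑ j, b j * (v i / (s j - t i))) :
    0 ≤ ∑ j, f (s j) * b j * (∑ i, x i * (v i / (s j - t i))) - ∑ i, f (t i) * x i ^ 2 := by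
  let A : Matrix (Fin m) (Fin m) ℂ := Matrix.diagonal fun i => (t i : ℂ)
  let vc : Fin m → ℂ := fun i => (v i : ℂ)
  let u : Fin m → Fin m → ℂ := fun j i => ((v i / (s j - t i) : ℝ) : ℂ)
  let e : Fin m → Fin m → ℂ := fun i => Pi.single i 1
  let xc : Fin m → ℂ := fun i => (x i : ℂ)
  have hApos : A.PosDef := PosDef.diagonal fun i => by simpa using ht i
  have hV : (vecMulVec vc (star vc)).PosSemidef := posSemidef_vecMulVec_self_star vc
  have hBpos : (A + vecMulVec vc (star vc)).PosDef := hApos.add_posSemidef hV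
  set B := A + vecMulVec vc (star vc) with hBdef
  have hAe (i) : A *ᵥ e i = (t i : ℂ) • e i := by
    ext k
    by_cases h : k = i
    · subst h; simp [A, e, mulVec_diagonal]
    · simp [A, e, mulVec_diagonal, h]
  have hBu (j) : B *ᵥ u j = (s j : ℂ) • u j := by
    have h1 : star vc ⬝ᵥ u j = 1 := by
      have := congrArg (fun r : ℝ => (r : ℂ)) (hsec j)
      simp only [Complex.ofReal_sum, Complex.ofReal_one] at this
      rw [← this, dotProduct]
      refine Finset.sum_congr rfl fun i _ => ?_
      simp only [vc, u, Pi.star_apply, RCLike.star_def, Complex.conj_ofReal]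
      push_cast; ring
    ext i
    have h2 : s j - t i ≠ 0 := sub_ne_zero.2 (hts i j)
    rw [hBdef, add_mulVec, vecMulVec_mulVec, h1]
    simp only [A, u, vc, Pi.add_apply, mulVec_diagonal, Pi.smul_apply, smul_eq_mul,
      MulOpposite.op_one, one_smul]
    norm_cast
    field_simp
    ring
  have hxe : xc = ∑ i, (x i : ℂ) • e i := by
    ext k
    simp [xc, e, Finset.sum_apply, Pi.single_apply]
  have hxu : xc = ∑ j, (b j : ℂ) • u j := by
    ext k
    simp [xc, u, Finset.sum_apply, hx]
  have hps := hf A B hApos.1 hBpos.1 (fun i => hApos.eigenvalues_pos i)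
    (fun i => hBpos.eigenvalues_pos i) (by rw [hBdef, add_sub_cancel_left]; exact hV)
  have key := hps.dotProduct_mulVec_nonneg xc
  have hA' : hApos.1.cfc f *ᵥ xc = ∑ i, ((f (t i) * x i : ℝ) : ℂ) • e i := by
    conv_lhs => rw [hxe]
    rw [mulVec_sum]
    refine Finset.sum_congr rfl fun i _ => ?_
    rw [mulVec_smul, cfc_mulVec_of_mulVec_eq_smul _ f (hAe i), smul_smul]
    push_cast; rw [mul_comm]
  have hB' : hBpos.1.cfc f *ᵥ xc = ∑ j, ((f (s j) * b j : ℝ) : ℂ) • u j := by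
    conv_lhs => rw [hxu]
    rw [mulVec_sum]
    refine Finset.sum_congr rfl fun i _ => ?_
    rw [mulVec_smul, cfc_mulVec_of_mulVec_eq_smul _ f (hBu i), smul_smul]
    push_cast; rw [mul_comm]
  rw [sub_mulVec, hA', hB', dotProduct_sub, dotProduct_sum, dotProduct_sum] at key
  have : (∑ j, star xc ⬝ᵥ ((f (s j) * b j : ℝ) : ℂ) • u j -
      ∑ i, star xc ⬝ᵥ ((f (t i) * x i : ℝ) : ℂ) • e i) =
      ((∑ j, f (s j) * b j * (∑ i, x i * (v i / (s j - t i))) - ∑ i, f (t i) * x i ^ 2 : ℝ) : ℂ) := by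
    rw [Complex.ofReal_sub, Complex.ofReal_sum, Complex.ofReal_sum]
    congr 1
    · refine Finset.sum_congr rfl fun j _ => ?_
      rw [dotProduct_smul, dotProduct, smul_eq_mul, Complex.ofReal_mul (f (s j) * b j),
        Complex.ofReal_sum]
      congr 1
      refine Finset.sum_congr rfl fun i _ => ?_
      simp [xc, u]
    · refine Finset.sum_congr rfl fun i _ => ?_
      simp [xc, e]
      ring
  rw [this] at key
  exact_mod_cast key

/-- Partial fractions with simple real poles. -/
lemma eval_div_eval_nodal {ι : Type*} [DecidableEq ι] {s : Finset ι} {v : ι → ℝ}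
    (hv : Set.InjOn v s) {p : ℝ[X]} (hp : p.degree < s.card) {x : ℝ} (hx : ∀ i ∈ s, x ≠ v i) :
    p.eval x / (nodal s v).eval x =
      ∑ i ∈ s, p.eval (v i) / (derivative (nodal s v)).eval (v i) / (x - v i) := by
  have h0 : (nodal s v).eval x ≠ 0 := eval_nodal_not_at_node hx
  conv_lhs => rw [eq_interpolate hv hp, eval_interpolate_not_at_node _ hx, mul_div_cancel_left₀ _ h0]
  refine Finset.sum_congr rfl fun i hi => ?_
  rw [nodalWeight_eq_eval_derivative_nodal hi]
  simp only [div_eq_mul_inv]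
  ring

lemma eval_derivative_nodal_ne_zero {ι : Type*} [DecidableEq ι] {s : Finset ι} {v : ι → ℝ}
    (hv : Set.InjOn v s) {i : ι} (hi : i ∈ s) : (derivative (nodal s v)).eval (v i) ≠ 0 := by
  have := nodalWeight_ne_zero hv hi
  rw [nodalWeight_eq_eval_derivative_nodal hi] at this
  exact fun h => this (by rw [h, _root_.inv_zero])

/-- Nonnegativity of the divided difference of `f q ^ 2` at the nodes `t i`, `s i`, when these are
the eigenvalues of a matrix and of a positive rank one perturbation of it. -/
lemma MatMonoOn.interlacing_sum_nonneg {m : ℕ} {f : ℝ → ℝ} (hf : MatMonoOn m (Ioi 0) f)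
    {t s : Fin m → ℝ} (ht : ∀ i, 0 < t i) (htinj : Function.Injective t)
    (hsinj : Function.Injective s) (hts : ∀ i j, s j ≠ t i)
    (hpos : ∀ i, 0 < -((nodal Finset.univ s).eval (t i) /
      (derivative (nodal Finset.univ t)).eval (t i)))
    {q : ℝ[X]} (hq : q.degree < m) :
    0 ≤ ∑ i, (f (t i) * q.eval (t i) ^ 2 / ((derivative (nodal Finset.univ t)).eval (t i) *
        (nodal Finset.univ s).eval (t i)) +
      f (s i) * q.eval (s i) ^ 2 / ((derivative (nodal Finset.univ s)).eval (s i) *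
        (nodal Finset.univ t).eval (s i))) := by
  set T := nodal Finset.univ t with hT
  set S := nodal Finset.univ s with hS
  have hTs (j) : T.eval (s j) ≠ 0 := eval_nodal_not_at_node fun i _ => hts i j
  have hSt (i) : S.eval (t i) ≠ 0 := eval_nodal_not_at_node fun j _ => (hts i j).symm
  have hT' (i) : (derivative T).eval (t i) ≠ 0 :=
    eval_derivative_nodal_ne_zero htinj.injOn (Finset.mem_univ i)
  have hS' (i) : (derivative S).eval (s i) ≠ 0 :=
    eval_derivative_nodal_ne_zero hsinj.injOn (Finset.mem_univ i)
  let v : Fin m → ℝ := fun i => √(-(S.eval (t i) / (derivative T).eval (t i)))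
  have hv (i) : v i ^ 2 = -(S.eval (t i) / (derivative T).eval (t i)) :=
    Real.sq_sqrt (hpos i).le
  have hdST : (S - T).degree < (Finset.univ : Finset (Fin m)).card := by
    have h1 : T.degree = (Finset.univ : Finset (Fin m)).card := degree_nodal
    have h2 : S.degree = (Finset.univ : Finset (Fin m)).card := degree_nodal
    rw [← h2]
    exact degree_sub_lt_left (h2.trans h1.symm) nodal_ne_zero
      (by rw [nodal_monic.leadingCoeff, nodal_monic.leadingCoeff])
  have hq' : q.degree < (Finset.univ : Finset (Fin m)).card := by simpa using hq
  have hsec (j) : ∑ i, v i ^ 2 / (s j - t i) = 1 := by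
    have h := eval_div_eval_nodal htinj.injOn hdST (x := s j) fun i _ => hts i j
    have hSj : S.eval (s j) = 0 := eval_nodal_at_node (Finset.mem_univ j)
    have hTi (i) : T.eval (t i) = 0 := eval_nodal_at_node (Finset.mem_univ i)
    simp only [← hT, eval_sub, hSj, hTi, zero_sub, sub_zero, neg_div, div_self (hTs j)] at h
    simp only [hv, neg_div, Finset.sum_neg_distrib]
    linarith
  have key := hf.rank_one_form_nonneg ht hts hsec
    (fun j => q.eval (s j) / (derivative S).eval (s j))
    (fun i => -(v i * (q.eval (t i) / S.eval (t i)))) (fun i => by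
      have h := eval_div_eval_nodal hsinj.injOn hq' (x := t i) fun j _ => (hts i j).symm
      rw [← hS] at h
      rw [h, Finset.mul_sum, ← Finset.sum_neg_distrib]
      refine Finset.sum_congr rfl fun j _ => ?_
      have h1 : t i - s j ≠ 0 := sub_ne_zero.2 (hts i j).symm
      have h2 : s j - t i ≠ 0 := sub_ne_zero.2 (hts i j)
      have h3 := hS' j
      rw [← neg_sub (s j) (t i)]
      field_simp)
  refine key.trans_eq ?_
  rw [← Finset.sum_sub_distrib]
  refine Finset.sum_congr rfl fun j _ => ?_
  have hin : ∑ i, -(v i * (q.eval (t i) / S.eval (t i))) * (v i / (s j - t i)) =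
      q.eval (s j) / T.eval (s j) := by
    have h := eval_div_eval_nodal htinj.injOn hq' (x := s j) fun i _ => hts i j
    rw [← hT] at h
    rw [h]
    refine Finset.sum_congr rfl fun i _ => ?_
    have h2 : s j - t i ≠ 0 := sub_ne_zero.2 (hts i j)
    have h3 := hT' i
    have h4 := hSt i
    calc _ = - (v i ^ 2) * (q.eval (t i) / S.eval (t i) / (s j - t i)) := by ring
      _ = _ := by rw [hv]; field_simp
  rw [hin]
  have h1 := hTs j
  have h2 := hS' j
  have h3 := hT' j
  have h4 := hSt j
  have : (-(v j * (q.eval (t j) / S.eval (t j)))) ^ 2 =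
      v j ^ 2 * (q.eval (t j) / S.eval (t j)) ^ 2 := by ring
  rw [this, hv]
  field_simp
  ring

/-- **Loewner's inequalities**: the divided difference of `f q ^ 2` at `2 m` distinct points is
nonnegative for `q` of degree less than `m`. -/
lemma MatMonoOn.sum_sq_div_nonneg {m : ℕ} {f : ℝ → ℝ} (hf : MatMonoOn m (Ioi 0) f)
    {s : Finset ℝ} (hs : ∀ x ∈ s, 0 < x) (hcard : s.card = m * 2) {q : ℝ[X]} (hq : q.degree < m) :
    0 ≤ ∑ x ∈ s, f x * q.eval x ^ 2 / (derivative (nodal s id)).eval x := by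
  let e := s.orderEmbOfFin hcard
  let g : Fin m × Fin 2 → ℝ := fun p => e (finProdFinEquiv p)
  have hginj : Function.Injective g := e.injective.comp finProdFinEquiv.injective
  have himg : s = Finset.univ.image g := by
    have h1 : Finset.univ.image g = Finset.univ.image e := by
      ext x
      simp only [Finset.mem_image, Finset.mem_univ, true_and]
      exact ⟨fun ⟨p, hp⟩ => ⟨_, hp⟩, fun ⟨k, hk⟩ => ⟨finProdFinEquiv.symm k,
        by simp only [g, Equiv.apply_symm_apply, hk]⟩⟩
    rw [h1, Finset.image_orderEmbOfFin_univ]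
  have hgs (p) : g p ∈ s := Finset.orderEmbOfFin_mem s hcard _
  have hlt {p p' : Fin m × Fin 2} (h : p.2.val + 2 * p.1.val < p'.2.val + 2 * p'.1.val) :
      g p < g p' := e.strictMono (by simpa [Fin.lt_def, finProdFinEquiv] using h)
  let t : Fin m → ℝ := fun i => g (i, 0)
  let r : Fin m → ℝ := fun i => g (i, 1)
  have htinj : Function.Injective t := fun i j h => by simpa using hginj h
  have hrinj : Function.Injective r := fun i j h => by simpa using hginj h
  have htr (i j) : r j ≠ t i := fun h => by simpa using hginj h
  have hW : nodal s id = nodal Finset.univ t * nodal Finset.univ r := by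
    rw [nodal, himg, Finset.prod_image hginj.injOn, Fintype.prod_prod_type]
    simp only [Fin.prod_univ_two, Finset.prod_mul_distrib, id, nodal, t, r]
  have hsum (F : ℝ → ℝ) : ∑ x ∈ s, F x = ∑ i, (F (t i) + F (r i)) := by
    rw [himg, Finset.sum_image hginj.injOn, Fintype.sum_prod_type]
    simp only [Fin.sum_univ_two, t, r]
  have hTi (i) : (nodal Finset.univ t).eval (t i) = 0 := eval_nodal_at_node (Finset.mem_univ i)
  have hRi (i) : (nodal Finset.univ r).eval (r i) = 0 := eval_nodal_at_node (Finset.mem_univ i)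
  rw [hsum]
  refine (hf.interlacing_sum_nonneg (fun i => hs _ (hgs _)) htinj hrinj htr (fun i => ?_)
    hq).trans_eq ?_
  · rw [eval_nodal_derivative_eval_node_eq (v := t) (Finset.mem_univ i), eval_nodal, eval_nodal,
      ← Finset.mul_prod_erase _ _ (Finset.mem_univ i), mul_div_assoc, ← Finset.prod_div_distrib,
      ← neg_mul]
    refine mul_pos ?_ (Finset.prod_pos fun j hj => ?_)
    · have : t i < r i := hlt (by simp)
      linarith
    · rcases lt_or_gt_of_ne (Finset.ne_of_mem_erase hj) with h | h
      · have h1 : r j < t i := hlt (by simp; omega)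
        have h2 : t j < t i := hlt (by simp; omega)
        exact div_pos (by linarith) (by linarith)
      · have h1 : t i < r j := hlt (by simp; omega)
        have h2 : t i < t j := hlt (by simp; omega)
        exact div_pos_of_neg_of_neg (by linarith) (by linarith)
  · refine Finset.sum_congr rfl fun i _ => ?_
    simp only [hW, derivative_mul, eval_add, eval_mul, hTi, hRi, zero_mul, mul_zero, add_zero,
      zero_add]
    rw [mul_comm ((derivative (nodal Finset.univ r)).eval _)]

/-- Companion of Loewner's inequalities for `t ↦ -f t / t`: adjoin a node near `0` and one near
infinity. -/
lemma sum_sq_div_mul_nonpos {f : ℝ → ℝ} (hpos : ∀ t ∈ Ioi (0:ℝ), 0 < f t)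
    (hf : ∀ n, MatMonoOn n (Ioi 0) f) {m : ℕ} {s : Finset ℝ} (hs : ∀ x ∈ s, 0 < x)
    (hcard : s.card = m * 2) {q : ℝ[X]} (hq : q.degree < m) :
    ∑ x ∈ s, f x * q.eval x ^ 2 / (x * (derivative (nodal s id)).eval x) ≤ 0 := by
  have hlim : Tendsto (fun ε : ℝ => ∑ x ∈ s, f x * q.eval x ^ 2 /
      (derivative (nodal s id)).eval x * ((1 - x * ε) / (x - ε))) (𝓝[>] 0)
      (𝓝 (∑ x ∈ s, f x * q.eval x ^ 2 / (derivative (nodal s id)).eval x *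
        ((1 - x * 0) / (x - 0)))) := by
    refine tendsto_finsetSum _ fun x hx => Tendsto.const_mul _ ?_
    refine ContinuousAt.tendsto (f := fun ε : ℝ => (1 - x * ε) / (x - ε)) ?_ |>.mono_left
      nhdsWithin_le_nhds
    exact ContinuousAt.div (by fun_prop) (by fun_prop) (by simpa using (hs x hx).ne')
  have heq : ∑ x ∈ s, f x * q.eval x ^ 2 / (x * (derivative (nodal s id)).eval x) =
      ∑ x ∈ s, f x * q.eval x ^ 2 / (derivative (nodal s id)).eval x *
        ((1 - x * 0) / (x - 0)) := by
    refine Finset.sum_congr rfl fun x _ => ?_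
    rw [mul_zero, sub_zero, sub_zero, div_mul_div_comm, mul_one, mul_comm x]
  rw [heq]
  refine le_of_tendsto hlim ?_
  have hev : ∀ᶠ ε in 𝓝[>] (0:ℝ), ∀ x ∈ s, ε < x ∧ x * ε < 1 := by
    rw [Filter.eventually_all_finset]
    intro x hx
    have h2 : Tendsto (fun ε : ℝ => x * ε) (𝓝 0) (𝓝 (x * 0)) :=
      (continuous_const.mul continuous_id).tendsto 0
    rw [mul_zero] at h2
    exact nhdsWithin_le_nhds ((eventually_lt_nhds (hs x hx)).and
      (h2.eventually_lt_const one_pos))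
  have hev1 : ∀ᶠ ε in 𝓝[>] (0:ℝ), ε < 1 :=
    nhdsWithin_le_nhds (eventually_lt_nhds one_pos)
  filter_upwards [hev, hev1, self_mem_nhdsWithin] with ε h hε1 hε
  have hε0 : 0 < ε := hε
  have hM1 : 1 < ε⁻¹ := (one_lt_inv₀ hε0).2 hε1
  have hxM (x) (hx : x ∈ s) : x < ε⁻¹ := by
    rw [lt_inv_comm₀ (hs x hx) hε0, ← one_div, lt_div_iff₀ (hs x hx), mul_comm]
    exact (h x hx).2
  have hMs : ε⁻¹ ∉ s := fun hx => lt_irrefl _ (hxM _ hx)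
  have hεs : ε ∉ insert ε⁻¹ s := by
    rw [Finset.mem_insert, not_or]
    exact ⟨by linarith, fun hx => lt_irrefl _ (h _ hx).1⟩
  have hdeg : (q * (X - C ε⁻¹)).degree < ((m + 1 : ℕ) : WithBot ℕ) := by
    rcases eq_or_ne q 0 with rfl | hq0
    · simp only [zero_mul, degree_zero]; exact WithBot.bot_lt_coe _
    · rw [degree_mul, degree_X_sub_C, degree_eq_natDegree hq0] at *
      norm_cast at *
      omega
  have key := (hf (m + 1)).sum_sq_div_nonneg (s := insert ε (insert ε⁻¹ s)) (by
    simp only [Finset.mem_insert]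
    rintro x (rfl | rfl | hx)
    exacts [hε0, inv_pos.2 hε0, hs x hx]) (by
    rw [Finset.card_insert_of_notMem hεs, Finset.card_insert_of_notMem hMs, hcard]; ring) hdeg
  have hW : nodal (insert ε (insert ε⁻¹ s)) (id : ℝ → ℝ) =
      (X - C ε) * ((X - C ε⁻¹) * nodal s id) := by
    rw [nodal_insert_eq_nodal hεs, nodal_insert_eq_nodal hMs]; rfl
  have hWε : 0 < (nodal s id).eval ε := by
    rw [eval_nodal]
    have : ∏ x ∈ s, (ε - id x) = ∏ x ∈ s, (x - ε) := by
      calc ∏ x ∈ s, (ε - id x) = ∏ x ∈ s, (-1) * (x - ε) :=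
            Finset.prod_congr rfl fun x _ => by simp
        _ = _ := by
          rw [Finset.prod_mul_distrib, Finset.prod_const, hcard, mul_comm m, pow_mul]; simp
    rw [this]
    exact Finset.prod_pos fun x hx => sub_pos.2 (h x hx).1
  rw [hW, Finset.sum_insert hεs, Finset.sum_insert hMs] at key
  have hWx (x) (hx : x ∈ s) : (nodal s (id : ℝ → ℝ)).eval x = 0 :=
    eval_nodal_at_node (v := id) hx
  simp only [derivative_mul, derivative_sub, derivative_X, derivative_C, eval_add, eval_mul,
    eval_sub, eval_X, eval_C, sub_self, sub_zero, mul_zero, zero_mul, one_mul,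
    add_zero, zero_add, ne_eq, OfNat.ofNat_ne_zero, not_false_eq_true, zero_pow, zero_div] at key
  have hfirst : f ε * (q.eval ε * (ε - ε⁻¹)) ^ 2 / ((ε - ε⁻¹) * (nodal s id).eval ε) ≤ 0 :=
    div_nonpos_of_nonneg_of_nonpos (mul_nonneg (hpos ε hε).le (sq_nonneg _))
      (mul_nonpos_of_nonpos_of_nonneg (by linarith) hWε.le)
  have hrest := key.trans (add_le_of_nonpos_left hfirst)
  refine nonpos_of_mul_nonneg_right ?_ (neg_lt_zero.2 (inv_pos.2 hε0))
  refine hrest.trans_eq ?_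
  rw [Finset.mul_sum]
  refine Finset.sum_congr rfl fun x hx => ?_
  have h1 : x - ε ≠ 0 := sub_ne_zero.2 (h x hx).1.ne'
  have h2 : x - ε⁻¹ ≠ 0 := sub_ne_zero.2 (hxM x hx).ne
  have h3 : (derivative (nodal s id)).eval x ≠ 0 :=
    eval_derivative_nodal_ne_zero (v := id) Function.injective_id.injOn hx
  have h4 : x - ε⁻¹ = -ε⁻¹ * (1 - x * ε) := by field_simp; ring
  rw [h4] at h2
  have h5 := right_ne_zero_of_mul h2
  rw [hWx x hx, h4]
  simp only [mul_zero, zero_add]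
  generalize 1 - x * ε = u at *
  field_simp

lemma nonneg_of_forall_ne {P : ℝ[X]} {a : ℝ} (h : ∀ x, 0 ≤ x → x ≠ a → 0 ≤ P.eval x) {x : ℝ}
    (hx : 0 ≤ x) : 0 ≤ P.eval x := by
  refine ge_of_tendsto (P.continuous.continuousAt.tendsto.mono_left
    (nhdsWithin_le_nhds (s := Ioi x))) ?_
  have hne : ∀ᶠ y in 𝓝[>] x, y ≠ a := by
    rcases eq_or_ne x a with rfl | hxa
    · filter_upwards [self_mem_nhdsWithin] with y hy using ne_of_gt hy
    · exact nhdsWithin_le_nhds (eventually_ne_nhds hxa)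
  filter_upwards [hne, self_mem_nhdsWithin] with y hy hy'
  exact h y (hx.trans (le_of_lt hy')) hy

/-- A functional that is nonnegative on the `q ^ 2` and `X * q ^ 2` of degree at most `deg R` is
nonnegative on `R`, if `R` is nonnegative on the half-line. -/
lemma map_nonneg_of_eval_nonneg (n : ℕ) : ∀ R : ℝ[X], R.natDegree = n →
    (∀ x, 0 ≤ x → 0 ≤ R.eval x) → ∀ L : ℝ[X] →ₗ[ℝ] ℝ,
    (∀ q : ℝ[X], 2 * q.natDegree ≤ n → 0 ≤ L (q ^ 2)) →
    (∀ q : ℝ[X], 2 * q.natDegree + 1 ≤ n → 0 ≤ L (X * q ^ 2)) → 0 ≤ L R := by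
  induction n using Nat.strong_induction_on with
  | _ n ih =>
  intro R hRn hR L hL1 hL2
  rcases Nat.eq_zero_or_pos n with rfl | hn
  · obtain ⟨c, rfl⟩ := natDegree_eq_zero.1 hRn
    have hc : 0 ≤ c := by simpa using hR 0 le_rfl
    have := hL1 (C √c) (by simp)
    rwa [← C_pow, Real.sq_sqrt hc] at this
  have hR0 : R ≠ 0 := by rintro rfl; simp at hRn; omega
  have quad (a b : ℝ) (R' : ℝ[X]) (hfac : R = ((X - C a) ^ 2 + C (b ^ 2)) * R') : 0 ≤ L R := by
    have hR'0 : R' ≠ 0 := by rintro rfl; simp at hfac; exact hR0 hfac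
    have hFd : ((X - C a) ^ 2 + C (b ^ 2)).natDegree = 2 := by
      rw [natDegree_add_C, natDegree_pow, natDegree_X_sub_C]
    have hF0 : (X - C a) ^ 2 + C (b ^ 2) ≠ 0 := by intro h; rw [h, natDegree_zero] at hFd; omega
    have hd : 2 + R'.natDegree = n := by
      rw [← hRn, hfac, natDegree_mul hF0 hR'0, hFd]
    have hdeg (q : ℝ[X]) : ((X - C a) * q).natDegree ≤ q.natDegree + 1 :=
      natDegree_mul_le.trans (by rw [natDegree_X_sub_C, add_comm])
    have hdeg' (q : ℝ[X]) : (C b * q).natDegree ≤ q.natDegree := natDegree_C_mul_le _ _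
    rw [hfac]
    refine ih R'.natDegree (by omega) R' rfl (fun x hx => ?_)
      (L ∘ₗ LinearMap.mulLeft ℝ ((X - C a) ^ 2 + C (b ^ 2))) (fun q hq => ?_) (fun q hq => ?_)
    · refine nonneg_of_forall_ne (a := a) (fun y hy hya => ?_) hx
      have h1 := hR y hy
      rw [hfac] at h1
      simp only [eval_mul, eval_add, eval_pow, eval_sub, eval_X, eval_C] at h1
      have : 0 < (y - a) ^ 2 := sq_pos_of_ne_zero (sub_ne_zero.2 hya)
      exact nonneg_of_mul_nonneg_right h1 (by positivity)
    · have e : ((X - C a) ^ 2 + C (b ^ 2)) * q ^ 2 = ((X - C a) * q) ^ 2 + (C b * q) ^ 2 := by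
        rw [C_pow]; ring
      rw [LinearMap.comp_apply, LinearMap.mulLeft_apply, e, map_add]
      have := hdeg q
      have := hdeg' q
      exact add_nonneg (hL1 _ (by omega)) (hL1 _ (by omega))
    · have e : ((X - C a) ^ 2 + C (b ^ 2)) * (X * q ^ 2) =
          X * ((X - C a) * q) ^ 2 + X * (C b * q) ^ 2 := by
        rw [C_pow]; ring
      rw [LinearMap.comp_apply, LinearMap.mulLeft_apply, e, map_add]
      have := hdeg q
      have := hdeg' q
      exact add_nonneg (hL2 _ (by omega)) (hL2 _ (by omega))
  obtain ⟨z, hz⟩ := IsAlgClosed.exists_aeval_eq_zero ℂ R (by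
    rw [degree_eq_natDegree hR0, hRn]; exact_mod_cast hn.ne')
  by_cases him : z.im = 0
  · have hroot : R.IsRoot z.re := by
      have hzr : z = (algebraMap ℝ ℂ) z.re := Complex.ext rfl (by simpa using him)
      rw [hzr, aeval_algebraMap_apply] at hz
      exact (algebraMap ℝ ℂ).injective (by simpa using hz)
    set a := z.re
    obtain ⟨R', hfac⟩ := dvd_iff_isRoot.2 hroot
    rcases le_or_gt a 0 with ha | ha
    · have hR'0 : R' ≠ 0 := by rintro rfl; simp at hfac; exact hR0 hfac
      have hd : 1 + R'.natDegree = n := by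
        rw [← hRn, hfac, natDegree_mul (X_sub_C_ne_zero a) hR'0, natDegree_X_sub_C]
      have hdeg (q : ℝ[X]) : (X * q).natDegree ≤ q.natDegree + 1 :=
        natDegree_mul_le.trans (by rw [natDegree_X, add_comm])
      have hdeg' (q : ℝ[X]) : (C √(-a) * q).natDegree ≤ q.natDegree := natDegree_C_mul_le _ _
      have hsq : (C √(-a) : ℝ[X]) ^ 2 = - C a := by
        rw [← C_pow, Real.sq_sqrt (by linarith), C_neg]
      rw [hfac]
      refine ih R'.natDegree (by omega) R' rfl (fun x hx => ?_)
        (L ∘ₗ LinearMap.mulLeft ℝ (X - C a)) (fun q hq => ?_) (fun q hq => ?_)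
      · refine nonneg_of_forall_ne (a := 0) (fun y hy hy0 => ?_) hx
        have h1 := hR y hy
        rw [hfac] at h1
        simp only [eval_mul, eval_sub, eval_X, eval_C] at h1
        have : 0 < y := lt_of_le_of_ne hy hy0.symm
        exact nonneg_of_mul_nonneg_right h1 (by linarith)
      · have e : (X - C a) * q ^ 2 = X * q ^ 2 + (C √(-a) * q) ^ 2 := by
          rw [mul_pow, hsq]; ring
        rw [LinearMap.comp_apply, LinearMap.mulLeft_apply, e, map_add]
        have := hdeg' q
        exact add_nonneg (hL2 _ (by omega)) (hL1 _ (by omega))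
      · have e : (X - C a) * (X * q ^ 2) = (X * q) ^ 2 + X * (C √(-a) * q) ^ 2 := by
          rw [mul_pow (C _), hsq]; ring
        rw [LinearMap.comp_apply, LinearMap.mulLeft_apply, e, map_add]
        have := hdeg q
        have := hdeg' q
        exact add_nonneg (hL1 _ (by omega)) (hL2 _ (by omega))
    · have hmin : IsLocalMin (fun x => R.eval x) a := by
        filter_upwards [eventually_gt_nhds ha] with y hy
        rw [hroot.eq_zero]
        exact hR y hy.le
      have hder := hmin.deriv_eq_zero
      rw [Polynomial.deriv, hfac] at hder
      have hroot' : R'.IsRoot a := by simpa using hder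
      obtain ⟨R'', hfac'⟩ := dvd_iff_isRoot.2 hroot'
      refine quad a 0 R'' ?_
      rw [hfac, hfac']
      simp only [ne_eq, OfNat.ofNat_ne_zero, not_false_eq_true, zero_pow, C_0]
      ring
  · obtain ⟨R', hfac⟩ := R.quadratic_dvd_of_aeval_eq_zero_im_ne_zero hz him
    refine quad z.re z.im R' ?_
    rw [hfac, ← Complex.normSq_eq_norm_sq, Complex.normSq_apply]
    simp only [C_add, C_mul, C_pow, C_ofNat]
    ring

/-- `sum_mul_nonneg` over an even number of nodes. -/
lemma sum_mul_nonneg_of_even {f : ℝ → ℝ} (hpos : ∀ t ∈ Ioi (0:ℝ), 0 < f t)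
    (hf : ∀ n, MatMonoOn n (Ioi 0) f) {m : ℕ} {s : Finset ℝ} (hs : ∀ x ∈ s, 0 < x)
    (hcard : s.card = m * 2) {c : ℝ → ℝ}
    (hc : ∀ l ∈ Icc (0:ℝ) 1, 0 ≤ ∑ t ∈ s, c t * (t / (l + (1 - l) * t))) :
    0 ≤ ∑ t ∈ s, c t * f t := by
  rcases Nat.eq_zero_or_pos m with rfl | hm
  · simp [Finset.card_eq_zero.1 (hcard.trans (zero_mul 2))]
  have hW' (t) (ht : t ∈ s) : (derivative (nodal s id)).eval t ≠ 0 :=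
    eval_derivative_nodal_ne_zero (v := id) Function.injective_id.injOn ht
  set P : ℝ[X] := ∑ t ∈ s, C (c t * t) * nodal (s.erase t) id with hP
  set R : ℝ[X] := -(P.comp (-X)) with hR
  set L : ℝ[X] →ₗ[ℝ] ℝ :=
    ∑ t ∈ s, (-(f t / (t * (derivative (nodal s id)).eval t))) • leval (-t) with hL
  have hLapp (Q : ℝ[X]) : L Q =
      ∑ t ∈ s, -(f t / (t * (derivative (nodal s id)).eval t)) * Q.eval (-t) := by
    simp [hL, LinearMap.sum_apply]
  have hdegP : P.natDegree ≤ m * 2 - 1 := by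
    refine natDegree_sum_le_of_forall_le _ _ fun t ht => (natDegree_C_mul_le _ _).trans ?_
    rw [natDegree_nodal, Finset.card_erase_of_mem ht, hcard]
  have hdegR : R.natDegree ≤ m * 2 - 1 := by
    rw [hR, natDegree_neg]
    refine natDegree_comp_le.trans ?_
    rwa [natDegree_neg, natDegree_X, mul_one]
  have hRpos (x : ℝ) (hx : 0 ≤ x) : 0 ≤ R.eval x := by
    have hx1 : 0 < 1 + x := by linarith
    have h := hc (x / (1 + x)) ⟨by positivity, (div_le_one hx1).2 (by linarith)⟩
    have hW : 0 < ∏ t ∈ s, (t + x) := Finset.prod_pos fun t ht => by linarith [hs t ht]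
    have hWneg : (nodal s (id : ℝ → ℝ)).eval (-x) = ∏ t ∈ s, (t + x) := by
      rw [eval_nodal]
      calc ∏ t ∈ s, (-x - id t) = ∏ t ∈ s, (-1) * (t + x) :=
            Finset.prod_congr rfl fun t _ => by simp; ring
        _ = _ := by
          rw [Finset.prod_mul_distrib, Finset.prod_const, hcard, mul_comm m, pow_mul]; simp
    have e : R.eval x = (∏ t ∈ s, (t + x)) / (1 + x) *
        ∑ t ∈ s, c t * (t / (x / (1 + x) + (1 - x / (1 + x)) * t)) := by
      rw [hR, eval_neg, eval_comp, hP, eval_finsetSum, Finset.mul_sum, ← Finset.sum_neg_distrib]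
      refine Finset.sum_congr rfl fun t ht => ?_
      have htx : t + x ≠ 0 := by linarith [hs t ht]
      have h1 : x / (1 + x) + (1 - x / (1 + x)) * t = (t + x) / (1 + x) := by field_simp; ring
      have h2 : (∏ t ∈ s, (t + x)) = -(t + x) * (nodal (s.erase t) id).eval (-x) := by
        rw [← hWneg, nodal_eq_mul_nodal_erase ht, eval_mul, eval_sub, eval_X, eval_C, id]
        ring
      rw [h1, h2, eval_mul, eval_C, eval_neg, eval_X]
      field_simp
    rw [e]
    positivity
  have hnonneg : 0 ≤ L R := by
    have hdeg (q : ℝ[X]) (hq : 2 * q.natDegree ≤ R.natDegree) : (q.comp (-X)).degree < m := by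
      refine degree_le_natDegree.trans_lt ?_
      rw [natDegree_comp, natDegree_neg, natDegree_X, mul_one]
      exact_mod_cast (by omega : q.natDegree < m)
    refine map_nonneg_of_eval_nonneg R.natDegree R rfl hRpos L (fun q hq => ?_) (fun q hq => ?_)
    · refine (neg_nonneg.2 (sum_sq_div_mul_nonpos hpos hf hs hcard (hdeg q hq))).trans_eq ?_
      rw [hLapp, ← Finset.sum_neg_distrib]
      refine Finset.sum_congr rfl fun t _ => ?_
      rw [eval_comp, eval_neg, eval_X, eval_pow]
      ring
    · refine ((hf m).sum_sq_div_nonneg hs hcard (hdeg q (by omega))).trans_eq ?_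
      rw [hLapp]
      refine Finset.sum_congr rfl fun t ht => ?_
      have := (hs t ht).ne'
      have := hW' t ht
      rw [eval_comp, eval_neg, eval_X, eval_mul, eval_pow, eval_X]
      field_simp
  refine hnonneg.trans_eq ?_
  rw [hLapp]
  refine Finset.sum_congr rfl fun t ht => ?_
  have ht0 := hs t ht
  have hPt : P.eval t = c t * t * (derivative (nodal s id)).eval t := by
    rw [hP, eval_finsetSum, Finset.sum_eq_single_of_mem t ht]
    · rw [eval_mul, eval_C]
      congr 1
      exact (eval_nodal_derivative_eval_node_eq (v := id) ht).symm
    · intro u hu hut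
      have := eval_nodal_at_node (v := id) (Finset.mem_erase.2 ⟨hut.symm, ht⟩)
      rw [eval_mul, show eval t _ = 0 from this, mul_zero]
  have := hW' t ht
  rw [hR, eval_neg, eval_comp, eval_neg, eval_X, neg_neg, hPt]
  field_simp

open MeasureTheory CompactlySupported in
/-- A functional that is nonnegative wherever `Φ` is, is integration of `Φ` against a finite
measure, provided that the constant `1` is in the range of `Φ`. -/
lemma exists_isFiniteMeasure_forall_eq_integral {X V : Type*} [TopologicalSpace X] [T2Space X]
    [CompactSpace X] [MeasurableSpace X] [BorelSpace X] [AddCommGroup V] [Module ℝ V]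
    (Φ : V →ₗ[ℝ] C_c(X, ℝ)) (ψ : V →ₗ[ℝ] ℝ) (h : ∀ v, 0 ≤ Φ v → 0 ≤ ψ v) {e : V}
    (he : ∀ x, Φ e x = 1) :
    ∃ μ : Measure X, IsFiniteMeasure μ ∧ ∀ v, ψ v = ∫ x, Φ v x ∂μ := by
  have hker : Φ.ker ≤ ψ.ker := by
    intro v hv
    rw [LinearMap.mem_ker] at hv ⊢
    refine le_antisymm ?_ (h v hv.ge)
    have := h (-v) (by rw [map_neg, hv, neg_zero])
    rwa [map_neg, neg_nonneg] at this
  let g₀ : C_c(X, ℝ) →ₗ.[ℝ] ℝ :=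
    ⟨Φ.range, Φ.ker.liftQ ψ hker ∘ₗ (Φ.quotKerEquivRange.symm : Φ.range →ₗ[ℝ] V ⧸ Φ.ker)⟩
  have hg₀ (v : V) : g₀ ⟨Φ v, LinearMap.mem_range_self Φ v⟩ = ψ v := by
    change Φ.ker.liftQ ψ hker (Φ.quotKerEquivRange.symm ⟨Φ v, LinearMap.mem_range_self Φ v⟩) = _
    rw [LinearMap.quotKerEquivRange_symm_apply_image]
    rfl
  have : PosSMulMono ℝ C_c(X, ℝ) :=
    ⟨fun a ha _ _ hbc x => mul_le_mul_of_nonneg_left (hbc x) ha⟩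
  obtain ⟨g, hg, hgpos⟩ := riesz_extension (PointedCone.positive ℝ C_c(X, ℝ)) g₀ (by
    rintro ⟨_, v, rfl⟩ hv
    rw [hg₀]
    exact h v hv) (by
    intro y
    obtain ⟨M, hM⟩ := (isCompact_range (map_continuous y)).bddBelow
    refine ⟨⟨Φ (-M • e), LinearMap.mem_range_self Φ _⟩, fun x => ?_⟩
    have := hM ⟨x, rfl⟩
    simp [he]
    linarith)
  let Λ : C_c(X, ℝ) →ₚ[ℝ] ℝ := PositiveLinearMap.mk₀ g hgpos
  refine ⟨RealRMK.rieszMeasure Λ, inferInstance, fun v => ?_⟩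
  rw [RealRMK.integral_rieszMeasure, ← hg₀, ← hg]
  rfl

/-- A combination of the kernels `t ↦ t / (l + (1 - l) * t)` that is nonnegative for every
`l ∈ [0, 1]` is nonnegative on `f`. -/
lemma sum_mul_nonneg {f : ℝ → ℝ} (hpos : ∀ t ∈ Ioi (0:ℝ), 0 < f t)
    (hf : ∀ n, MatMonoOn n (Ioi 0) f) (c : Ioi (0:ℝ) →₀ ℝ)
    (hc : ∀ l ∈ Icc (0:ℝ) 1, 0 ≤ c.sum fun t a => a * (t / (l + (1 - l) * t))) :
    0 ≤ c.sum fun t a => a * f t := by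
  obtain ⟨s, hcs, m, hs⟩ : ∃ s, c.support ⊆ s ∧ ∃ m, s.card = m * 2 := by
    rcases Nat.even_or_odd' c.support.card with ⟨k, hk | hk⟩
    · exact ⟨_, subset_rfl, k, by omega⟩
    · have : Infinite (Ioi (0:ℝ)) := (Ioi_infinite 0).to_subtype
      obtain ⟨a, ha⟩ := Infinite.exists_notMem_finset c.support
      exact ⟨insert a c.support, Finset.subset_insert _ _, k + 1, by
        rw [Finset.card_insert_of_notMem ha]; omega⟩
  have hsum (φ : ℝ → ℝ) : (c.sum fun t a => a * φ t) =
      ∑ t ∈ s.map (Function.Embedding.subtype _),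
        Function.extend Subtype.val c 0 t * φ t := by
    rw [c.sum_of_support_subset hcs _ (by simp), Finset.sum_map]
    simp
  rw [hsum f]
  refine sum_mul_nonneg_of_even hpos hf (m := m) (fun x hx => ?_) (by rw [Finset.card_map, hs])
    fun l hl => (hc l hl).trans_eq (hsum fun t => t / (l + (1 - l) * t))
  obtain ⟨t, -, rfl⟩ := Finset.mem_map.1 hx
  exact t.2

open CompactlySupported in
/-- The extreme positive operator monotone function `t ↦ t / (l + (1 - l) * t)`, as a function of
the parameter `l ∈ [0, 1]`. -/
def extremeKernel (t : Ioi (0:ℝ)) : C_c(Icc (0:ℝ) 1, ℝ) where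
  toFun l := t / (l + (1 - l) * t)
  continuous_toFun := by
    refine Continuous.div (by fun_prop) (by fun_prop) fun l => ?_
    have ht : 0 < (t : ℝ) := t.2
    obtain ⟨l, hl0, hl1⟩ := l
    rcases hl0.eq_or_lt with rfl | hl0
    · simpa using ht.ne'
    · have := mul_nonneg (sub_nonneg.2 hl1) ht.le
      exact (add_pos_of_pos_of_nonneg hl0 this).ne'
  hasCompactSupport' := HasCompactSupport.of_compactSpace _

lemma extremeKernel_apply (t : Ioi (0:ℝ)) (l : Icc (0:ℝ) 1) :
    extremeKernel t l = t / (l + (1 - l) * t) := rfl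

theorem stmt19 (f : ℝ → ℝ) (hpos : ∀ t ∈ Ioi (0:ℝ), 0 < f t)
    (hf : ∀ n, MatMonoOn n (Ioi 0) f) :
    ∃ μ : MeasureTheory.Measure ℝ, MeasureTheory.IsFiniteMeasure μ ∧
      μ (Icc (0:ℝ) 1)ᶜ = 0 ∧
      (∀ t ∈ Ioi (0:ℝ), f t = ∫ l in Icc (0:ℝ) 1, t / (l + (1 - l) * t) ∂μ) ∧
      (MeasureTheory.IsProbabilityMeasure μ ↔ f 1 = 1) := by
  have hΦ (c : Ioi (0:ℝ) →₀ ℝ) (l : Icc (0:ℝ) 1) :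
      Finsupp.linearCombination ℝ extremeKernel c l =
        c.sum fun t a => a * ((t : ℝ) / (l + (1 - l) * t)) := by
    rw [Finsupp.linearCombination_apply, Finsupp.sum, Finsupp.sum,
      CompactlySupportedContinuousMap.coe_sum, Finset.sum_apply]
    rfl
  obtain ⟨ν, hν, hint⟩ := exists_isFiniteMeasure_forall_eq_integral
    (Finsupp.linearCombination ℝ extremeKernel)
    (Finsupp.linearCombination ℝ fun t : Ioi (0:ℝ) => f t)
    (fun c hc => sum_mul_nonneg hpos hf c fun l hl => (hc ⟨l, hl⟩).trans_eq (hΦ c ⟨l, hl⟩))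
    (e := Finsupp.single ⟨1, mem_Ioi.2 one_pos⟩ 1) (fun l => by simp [extremeKernel_apply])
  have hmeas : MeasurableEmbedding (Subtype.val : Icc (0:ℝ) 1 → ℝ) :=
    MeasurableEmbedding.subtype_coe measurableSet_Icc
  have hnull : ν.map Subtype.val (Icc (0:ℝ) 1)ᶜ = 0 := by
    rw [hmeas.map_apply]
    simp
  have hrestr : (ν.map Subtype.val).restrict (Icc (0:ℝ) 1) = ν.map Subtype.val :=
    MeasureTheory.Measure.restrict_eq_self_of_ae_mem (MeasureTheory.mem_ae_iff.2 hnull)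
  have hrep (t : ℝ) (ht : t ∈ Ioi (0:ℝ)) :
      f t = ∫ l in Icc (0:ℝ) 1, t / (l + (1 - l) * t) ∂(ν.map Subtype.val) := by
    have := hint (Finsupp.single ⟨t, ht⟩ 1)
    rw [hrestr, hmeas.integral_map]
    simpa [extremeKernel_apply] using this
  refine ⟨ν.map Subtype.val, inferInstance, hnull, hrep, ?_⟩
  have h1 := hrep 1 (mem_Ioi.2 one_pos)
  rw [hrestr] at h1
  simp only [mul_one, add_sub_cancel, div_one, MeasureTheory.integral_const, smul_eq_mul] at h1
  rw [h1, MeasureTheory.isProbabilityMeasure_iff_real]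

end
end
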